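/- Let n ≥ 1 and α > 0. Let F : S → ℂ be a bounded smooth function with L_α F = 0, and let f : H^n → ℂ be a smooth bounded function which is the boundary value of F. Then F is anti-holomorphic if and only if ℒ_{-n} f = 0. -/

import Mathlib

noncomputable section
open MeasureTheory Filter Set
open scoped Topology BigOperators

/-- The Heisenberg group `H^n = ℂ^n × ℝ` as a set. -/
abbrev Hn (n : ℕ) : Type := (Fin n → ℂ) × ℝ

/-- The extension `S = H^n × (0,∞)`; we use `H^n × ℝ` and restrict to `a > 0`. -/
abbrev Sg (n : ℕ) : Type := Hn n × ℝ

/-- Directional derivative of a complex valued function in direction `v`. -/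
def dirD {E : Type} [NormedAddCommGroup E] [NormedSpace ℝ E]
    (v : E) (f : E → ℂ) (p : E) : ℂ := fderiv ℝ f p v

def eX (n : ℕ) (j : Fin n) : Hn n := (fun i => if i = j then (1 : ℂ) else 0, 0)
def eY (n : ℕ) (j : Fin n) : Hn n := (fun i => if i = j then Complex.I else 0, 0)
def eT (n : ℕ) : Hn n := (0, 1)

/-- `X_j = ∂_{x_j} + 2 y_j ∂_t` on `H^n`. -/
def XH (n : ℕ) (j : Fin n) (f : Hn n → ℂ) (p : Hn n) : ℂ :=
  dirD (eX n j) f p + 2 * ((p.1 j).im : ℂ) * dirD (eT n) f p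

/-- `Y_j = ∂_{y_j} - 2 x_j ∂_t` on `H^n`. -/
def YH (n : ℕ) (j : Fin n) (f : Hn n → ℂ) (p : Hn n) : ℂ :=
  dirD (eY n j) f p - 2 * ((p.1 j).re : ℂ) * dirD (eT n) f p

/-- `T = ∂_t` on `H^n`. -/
def TH (n : ℕ) (f : Hn n → ℂ) (p : Hn n) : ℂ := dirD (eT n) f p

/-- `ℒ_α = -(1/4) Σ (X_j² + Y_j²) + i α T` on `H^n`. -/
def LH (n : ℕ) (α : ℝ) (f : Hn n → ℂ) (p : Hn n) : ℂ :=
  -(1/4) * ∑ j, (XH n j (XH n j f) p + YH n j (YH n j f) p) + Complex.I * (α : ℂ) * TH n f p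

/-- `Z̄_j = (1/2)(X_j + i Y_j)` on `H^n`. -/
def ZbarH (n : ℕ) (j : Fin n) (f : Hn n → ℂ) (p : Hn n) : ℂ :=
  (1/2) * (XH n j f p + Complex.I * YH n j f p)

/-- A function is bounded. -/
def BddFun {X : Type} (f : X → ℂ) : Prop := ∃ C, ∀ p, ‖f p‖ ≤ C

def eXS (n : ℕ) (j : Fin n) : Sg n := (eX n j, 0)
def eYS (n : ℕ) (j : Fin n) : Sg n := (eY n j, 0)
def eTS (n : ℕ) : Sg n := (eT n, 0)
def eA (n : ℕ) : Sg n := (0, 1)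

/-- `X_j` on `S`. -/
def XS (n : ℕ) (j : Fin n) (F : Sg n → ℂ) (p : Sg n) : ℂ :=
  dirD (eXS n j) F p + 2 * ((p.1.1 j).im : ℂ) * dirD (eTS n) F p

/-- `Y_j` on `S`. -/
def YS (n : ℕ) (j : Fin n) (F : Sg n → ℂ) (p : Sg n) : ℂ :=
  dirD (eYS n j) F p - 2 * ((p.1.1 j).re : ℂ) * dirD (eTS n) F p

/-- `T = ∂_t` on `S`. -/
def TS (n : ℕ) (F : Sg n → ℂ) (p : Sg n) : ℂ := dirD (eTS n) F p

/-- `∂_a` on `S`. -/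
def DA (n : ℕ) (F : Sg n → ℂ) : Sg n → ℂ := fun p => dirD (eA n) F p

/-- `ℒ = -(1/4) Σ (X_j² + Y_j²)` acting in the `H^n`-variables on `S`. -/
def LS0 (n : ℕ) (F : Sg n → ℂ) (p : Sg n) : ℂ :=
  -(1/4) * ∑ j, (XS n j (XS n j F) p + YS n j (YS n j F) p)

/-- `L_α = -α a (ℒ + n ∂_a) + a² (∂_a² + T²)` on `S`. -/
def Lalpha (n : ℕ) (α : ℝ) (F : Sg n → ℂ) (p : Sg n) : ℂ :=
  -(α : ℂ) * (p.2 : ℂ) * (LS0 n F p + (n : ℂ) * DA n F p)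
    + (p.2 : ℂ) ^ 2 * (DA n (DA n F) p + TS n (TS n F) p)

/-- The complex space `ℂ^{n+1}` in which the Siegel upper half-plane lives. -/
abbrev Vn (n : ℕ) : Type := (Fin n → ℂ) × ℂ

/-- The Siegel upper half-plane `U^n`. -/
def Un (n : ℕ) : Set (Vn n) := {z | ∑ j, ‖z.1 j‖ ^ 2 < z.2.im}

/-- The function `F_u` on the Siegel upper half-plane corresponding to a function `F` on `S`,
via `F[ζ,t,a] = F_u(ζ, t + i|ζ|² + ia)`, i.e.
`F_u(z', z_{n+1}) = F(z', Re z_{n+1}, Im z_{n+1} - |z'|²)`. -/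
def Fu (n : ℕ) (F : Sg n → ℂ) : Vn n → ℂ :=
  fun z => F ((z.1, z.2.re), z.2.im - ∑ j, ‖z.1 j‖ ^ 2)

/-- `F` is holomorphic if `F_u` is holomorphic on `U^n`. -/
def IsHolo (n : ℕ) (F : Sg n → ℂ) : Prop := DifferentiableOn ℂ (Fu n F) (Un n)

/-- `F` is anti-holomorphic if the conjugate of `F_u` is holomorphic on `U^n`. -/
def IsAntiHolo (n : ℕ) (F : Sg n → ℂ) : Prop :=
  DifferentiableOn ℂ (fun z => (starRingEnd ℂ) (Fu n F z)) (Un n)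

/-- Wirtinger derivative `∂_z` in complex direction `v`. -/
def dzV (n : ℕ) (v : Vn n) (f : Vn n → ℂ) (p : Vn n) : ℂ :=
  (1/2) * (fderiv ℝ f p v - Complex.I * fderiv ℝ f p (Complex.I • v))

/-- Wirtinger derivative `∂_{z̄}` in complex direction `v`. -/
def dzbarV (n : ℕ) (v : Vn n) (f : Vn n → ℂ) (p : Vn n) : ℂ :=
  (1/2) * (fderiv ℝ f p v + Complex.I * fderiv ℝ f p (Complex.I • v))

/-- The standard complex basis vectors of `ℂ^{n+1} = ℂ^n × ℂ`. -/
def basisV (n : ℕ) (k : Fin (n + 1)) : Vn n :=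
  if _h : (k : ℕ) < n then (fun i => if (i : ℕ) = (k : ℕ) then (1 : ℂ) else 0, 0) else (0, 1)

/-- `F` is pluriharmonic if `∂_{z_k} ∂_{z̄_j} F_u = 0` on `U^n` for all `1 ≤ j,k ≤ n+1`. -/
def IsPluriharmonic (n : ℕ) (F : Sg n → ℂ) : Prop :=
  ∀ p ∈ Un n, ∀ j k : Fin (n + 1),
    dzV n (basisV n k) (dzbarV n (basisV n j) (Fu n F)) p = 0

/-- `f` is the boundary value of `F` : for every `φ ∈ L¹(H^n)`,
`∫ F(w,a) φ(w) dw → ∫ f(w) φ(w) dw` as `a → 0⁺`. -/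
def IsBoundaryValue (n : ℕ) (F : Sg n → ℂ) (f : Hn n → ℂ) : Prop :=
  ∀ φ : Hn n → ℂ, Integrable φ →
    Tendsto (fun a : ℝ => ∫ w : Hn n, F (w, a) * φ w) (𝓝[>] (0 : ℝ))
      (𝓝 (∫ w : Hn n, f w * φ w))

set_option linter.unusedSimpArgs false
set_option linter.unusedVariables false

/-! ### Left-invariant vector fields -/

/-- The bilinear form `2 Im (ζ · conj ξ)`. -/
def bt {n : ℕ} (ζ ξ : Fin n → ℂ) : ℝ :=
  ∑ j, 2 * ((ζ j).im * (ξ j).re - (ζ j).re * (ξ j).im)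

lemma bt_self {n : ℕ} (ξ : Fin n → ℂ) : bt ξ ξ = 0 := by
  unfold bt; apply Finset.sum_eq_zero; intros; ring

lemma bt_swap {n : ℕ} (ζ ξ : Fin n → ℂ) : bt ζ ξ = - bt ξ ζ := by
  unfold bt; rw [← Finset.sum_neg_distrib]; apply Finset.sum_congr rfl; intros; ring

lemma bt_add_left {n : ℕ} (ζ ζ' ξ : Fin n → ℂ) : bt (ζ + ζ') ξ = bt ζ ξ + bt ζ' ξ := by
  unfold bt; rw [← Finset.sum_add_distrib]; apply Finset.sum_congr rfl
  intros; simp only [Pi.add_apply, Complex.add_re, Complex.add_im]; ring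

lemma bt_sub_left {n : ℕ} (ζ ζ' ξ : Fin n → ℂ) : bt (ζ - ζ') ξ = bt ζ ξ - bt ζ' ξ := by
  unfold bt; rw [← Finset.sum_sub_distrib]; apply Finset.sum_congr rfl
  intros; simp only [Pi.sub_apply, Complex.sub_re, Complex.sub_im]; ring

lemma bt_smul_left {n : ℕ} (r : ℝ) (ζ ξ : Fin n → ℂ) : bt (r • ζ) ξ = r * bt ζ ξ := by
  unfold bt; rw [Finset.mul_sum]; apply Finset.sum_congr rfl
  intros; simp only [Pi.smul_apply, Complex.real_smul, Complex.mul_re, Complex.mul_im,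
    Complex.ofReal_re, Complex.ofReal_im]; ring

lemma bt_add_right {n : ℕ} (ζ ζ' ξ : Fin n → ℂ) : bt ξ (ζ + ζ') = bt ξ ζ + bt ξ ζ' := by
  rw [bt_swap, bt_add_left, bt_swap ζ, bt_swap ζ']; ring

lemma bt_sub_right {n : ℕ} (ζ ζ' ξ : Fin n → ℂ) : bt ξ (ζ - ζ') = bt ξ ζ - bt ξ ζ' := by
  rw [bt_swap, bt_sub_left, bt_swap ζ, bt_swap ζ']; ring

lemma bt_smul_right {n : ℕ} (r : ℝ) (ζ ξ : Fin n → ℂ) : bt ξ (r • ζ) = r * bt ξ ζ := by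
  rw [bt_swap, bt_smul_left, bt_swap ζ]; ring

lemma bt_zero_right {n : ℕ} (ξ : Fin n → ℂ) : bt ξ 0 = 0 := by
  simp [bt]

lemma bt_zero_left {n : ℕ} (ξ : Fin n → ℂ) : bt 0 ξ = 0 := by
  simp [bt]

lemma bt_contDiff {n : ℕ} {E : Type} [NormedAddCommGroup E] [NormedSpace ℝ E]
    {u v : E → (Fin n → ℂ)} {m : WithTop ℕ∞} (hu : ContDiff ℝ m u) (hv : ContDiff ℝ m v) :
    ContDiff ℝ m (fun x => bt (u x) (v x)) := by
  unfold bt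
  apply ContDiff.sum
  intro j _
  have h1 : ContDiff ℝ m (fun x => u x j) := (contDiff_apply ℝ ℂ j).comp hu
  have h2 : ContDiff ℝ m (fun x => v x j) := (contDiff_apply ℝ ℂ j).comp hv
  have r1 : ContDiff ℝ m (fun x => (u x j).re) := Complex.reCLM.contDiff.comp h1
  have i1 : ContDiff ℝ m (fun x => (u x j).im) := Complex.imCLM.contDiff.comp h1
  have r2 : ContDiff ℝ m (fun x => (v x j).re) := Complex.reCLM.contDiff.comp h2
  have i2 : ContDiff ℝ m (fun x => (v x j).im) := Complex.imCLM.contDiff.comp h2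
  exact contDiff_const.mul ((i1.mul r2).sub (r1.mul i2))

lemma bt_continuous {n : ℕ} {E : Type} [TopologicalSpace E]
    {u v : E → (Fin n → ℂ)} (hu : Continuous u) (hv : Continuous v) :
    Continuous (fun x => bt (u x) (v x)) := by
  unfold bt
  fun_prop

/-- The left-invariant vector field determined by `c`. -/
def VF {n : ℕ} (c p : Sg n) : Sg n := ((c.1.1, c.1.2 + bt p.1.1 c.1.1), c.2)

/-- The left-invariant derivative determined by `c`. -/
def LD {n : ℕ} (c : Sg n) (F : Sg n → ℂ) (p : Sg n) : ℂ := fderiv ℝ F p (VF c p)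

/-- The domain `a > 0`. -/
def Om (n : ℕ) : Set (Sg n) := {p | 0 < p.2}

lemma isOpen_Om (n : ℕ) : IsOpen (Om n) := isOpen_lt continuous_const continuous_snd

lemma Om_nhds {n : ℕ} {p : Sg n} (hp : p ∈ Om n) : Om n ∈ 𝓝 p := (isOpen_Om n).mem_nhds hp

/-- Smoothness on the domain. -/
def Sm {n : ℕ} (F : Sg n → ℂ) : Prop := ContDiffOn ℝ (⊤ : ℕ∞) F (Om n)

lemma VF_contDiff {n : ℕ} (c : Sg n) {m : WithTop ℕ∞} : ContDiff ℝ m (VF c) := by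
  unfold VF
  have h : ContDiff ℝ m (fun p : Sg n => bt p.1.1 c.1.1) :=
    bt_contDiff (contDiff_fst.comp contDiff_fst) contDiff_const
  exact (contDiff_const.prodMk (contDiff_const.add h)).prodMk contDiff_const

lemma VF_line {n : ℕ} (c p : Sg n) (s : ℝ) : VF c (p + s • VF c p) = VF c p := by
  simp [VF, bt_add_left, bt_smul_left, bt_self]

lemma Sm.diffAt {n : ℕ} {F : Sg n → ℂ} (hF : Sm F) {p : Sg n} (hp : p ∈ Om n) :
    DifferentiableAt ℝ F p :=
  (hF.differentiableOn (by simp)).differentiableAt (Om_nhds hp)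

lemma Sm.contDiffAt {n : ℕ} {F : Sg n → ℂ} (hF : Sm F) {p : Sg n} (hp : p ∈ Om n) :
    ContDiffAt ℝ (⊤ : ℕ∞) F p := ContDiffOn.contDiffAt hF (Om_nhds hp)

lemma Sm.LD {n : ℕ} {F : Sg n → ℂ} (hF : Sm F) (c : Sg n) : Sm (LD c F) := by
  have h : ContDiffOn ℝ (⊤ : ℕ∞) (fderiv ℝ F) (Om n) :=
    ContDiffOn.fderiv_of_isOpen hF (isOpen_Om n) (by simp)
  exact h.clm_apply (VF_contDiff c).contDiffOn

lemma Sm.mul {n : ℕ} {F G : Sg n → ℂ} (hF : Sm F) (hG : Sm G) : Sm (fun p => F p * G p) :=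
  ContDiffOn.mul hF hG
lemma Sm.add {n : ℕ} {F G : Sg n → ℂ} (hF : Sm F) (hG : Sm G) : Sm (fun p => F p + G p) :=
  ContDiffOn.add hF hG
lemma Sm.sub {n : ℕ} {F G : Sg n → ℂ} (hF : Sm F) (hG : Sm G) : Sm (fun p => F p - G p) :=
  ContDiffOn.sub hF hG
lemma Sm.const {n : ℕ} (k : ℂ) : Sm (fun _ : Sg n => k) := contDiffOn_const
lemma Sm.cj {n : ℕ} {F : Sg n → ℂ} (hF : Sm F) : Sm (fun p => (starRingEnd ℂ) (F p)) :=
  Complex.conjCLE.contDiff.comp_contDiffOn hF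

lemma LD_congr {n : ℕ} {c : Sg n} {F G : Sg n → ℂ} (h : ∀ p ∈ Om n, F p = G p)
    {p : Sg n} (hp : p ∈ Om n) : LD c F p = LD c G p := by
  have : F =ᶠ[𝓝 p] G := by
    filter_upwards [Om_nhds hp] with q hq using h q hq
  unfold LD; rw [this.fderiv_eq]

lemma LD_mul {n : ℕ} {c : Sg n} {F G : Sg n → ℂ} (hF : Sm F) (hG : Sm G) {p : Sg n}
    (hp : p ∈ Om n) : LD c (fun q => F q * G q) p = F p * LD c G p + G p * LD c F p := by
  unfold LD
  rw [fderiv_fun_mul (hF.diffAt hp) (hG.diffAt hp)]; simp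

lemma LD_add {n : ℕ} {c : Sg n} {F G : Sg n → ℂ} (hF : Sm F) (hG : Sm G) {p : Sg n}
    (hp : p ∈ Om n) : LD c (fun q => F q + G q) p = LD c F p + LD c G p := by
  unfold LD
  rw [fderiv_fun_add (hF.diffAt hp) (hG.diffAt hp)]; simp

lemma LD_sub {n : ℕ} {c : Sg n} {F G : Sg n → ℂ} (hF : Sm F) (hG : Sm G) {p : Sg n}
    (hp : p ∈ Om n) : LD c (fun q => F q - G q) p = LD c F p - LD c G p := by
  unfold LD
  rw [fderiv_fun_sub (hF.diffAt hp) (hG.diffAt hp)]; simp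

lemma LD_const {n : ℕ} {c : Sg n} (k : ℂ) (p : Sg n) : LD c (fun _ => k) p = 0 := by
  unfold LD; simp

lemma LD_cmul {n : ℕ} {c : Sg n} {F : Sg n → ℂ} (k : ℂ) (hF : Sm F) {p : Sg n}
    (hp : p ∈ Om n) : LD c (fun q => k * F q) p = k * LD c F p := by
  rw [LD_mul (Sm.const k) hF hp, LD_const]; ring

lemma LD_cj {n : ℕ} {c : Sg n} {F : Sg n → ℂ} (hF : Sm F) {p : Sg n}
    (hp : p ∈ Om n) :
    LD c (fun q => (starRingEnd ℂ) (F q)) p = (starRingEnd ℂ) (LD c F p) := by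
  unfold LD
  have h := (Complex.conjCLE.toContinuousLinearMap.hasFDerivAt (x := F p)).comp p
    (hF.diffAt hp).hasFDerivAt
  have h2 : HasFDerivAt (fun q => (starRingEnd ℂ) (F q))
    (Complex.conjCLE.toContinuousLinearMap.comp (fderiv ℝ F p)) p := h
  rw [h2.fderiv]; rfl

lemma hasDerivAt_line {n : ℕ} {c : Sg n} {F : Sg n → ℂ} (hF : Sm F) {p : Sg n} {s : ℝ}
    (hp : p + s • VF c p ∈ Om n) :
    HasDerivAt (fun r : ℝ => F (p + r • VF c p)) (LD c F (p + s • VF c p)) s := by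
  have h1 : HasDerivAt (fun r : ℝ => p + r • VF c p) (VF c p) s := by
    simpa using ((hasDerivAt_id s).smul_const (VF c p)).const_add p
  have h2 := (hF.diffAt hp).hasFDerivAt.comp_hasDerivAt s h1
  unfold LD; rw [VF_line]; exact h2

/-- Second derivative formula. -/
lemma LD_LD {n : ℕ} {c d : Sg n} {F : Sg n → ℂ} (hF : Sm F) {p : Sg n} (hp : p ∈ Om n) :
    LD c (LD d F) p = fderiv ℝ (fderiv ℝ F) p (VF c p) (VF d p)
      + fderiv ℝ F p ((0, bt c.1.1 d.1.1), 0) := by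
  have hd : DifferentiableAt ℝ (fderiv ℝ F) p :=
    ((ContDiffOn.fderiv_of_isOpen hF (isOpen_Om n) (m := 1) (by norm_cast)).differentiableOn
      (by simp)).differentiableAt (Om_nhds hp)
  have hV : HasFDerivAt (VF d) (fderiv ℝ (VF d) p) p :=
    ((VF_contDiff d (m := 1)).differentiable (by simp) p).hasFDerivAt
  have hV2 : fderiv ℝ (VF d) p (VF c p) = ((0, bt c.1.1 d.1.1), 0) := by
    have h1 : HasDerivAt (fun r : ℝ => p + r • VF c p) (VF c p) 0 := by
      simpa using ((hasDerivAt_id (0:ℝ)).smul_const (VF c p)).const_add p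
    have h2 := HasFDerivAt.comp_hasDerivAt (0:ℝ) (l := VF d) (l' := fderiv ℝ (VF d) p)
      (by simpa using hV) h1
    have h3 : HasDerivAt (fun r : ℝ => VF d p + r • (((0, bt c.1.1 d.1.1), 0) : Sg n))
        (((0, bt c.1.1 d.1.1), 0) : Sg n) 0 := by
      simpa using ((hasDerivAt_id (0:ℝ)).smul_const
        (((0, bt c.1.1 d.1.1), 0) : Sg n)).const_add (VF d p)
    have h4 : (VF d ∘ fun r : ℝ => p + r • VF c p)
        = (fun r : ℝ => VF d p + r • (((0, bt c.1.1 d.1.1), 0) : Sg n)) := by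
      funext r
      simp [VF, bt_add_left, bt_smul_left]; ring
    rw [h4] at h2
    exact h2.unique h3
  have := hd.hasFDerivAt.clm_apply hV
  unfold LD
  change fderiv ℝ (fun q => (fderiv ℝ F q) (VF d q)) p (VF c p) = _
  rw [this.fderiv]
  simp [hV2, add_comm]

lemma LD_comm {n : ℕ} {c d : Sg n} {F : Sg n → ℂ} (hF : Sm F) {p : Sg n} (hp : p ∈ Om n) :
    LD c (LD d F) p = LD d (LD c F) p + 2 * (bt c.1.1 d.1.1 : ℂ) * LD (eTS n) F p := by
  rw [LD_LD hF hp, LD_LD hF hp]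
  have hs : IsSymmSndFDerivAt ℝ F p :=
    (hF.contDiffAt hp).isSymmSndFDerivAt (by simp; norm_cast)
  rw [hs.eq (VF c p) (VF d p)]
  have h0 : ∀ r : ℝ, fderiv ℝ F p ((0, r), 0) = (r : ℂ) * LD (eTS n) F p := by
    intro r
    have : (((0, r), 0) : Sg n) = r • VF (eTS n) p := by
      simp [VF, eTS, eT, bt_zero_right]
    rw [this, map_smul]; simp [LD]
  rw [h0, h0, bt_swap d.1.1 c.1.1]
  push_cast; ring

lemma VF_eXS {n : ℕ} (j : Fin n) (p : Sg n) :
    VF (eXS n j) p = eXS n j + (2 * (p.1.1 j).im) • eTS n := by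
  simp [VF, eXS, eX, eTS, eT, bt]
  simp [apply_ite]

lemma VF_eYS {n : ℕ} (j : Fin n) (p : Sg n) :
    VF (eYS n j) p = eYS n j - (2 * (p.1.1 j).re) • eTS n := by
  simp [VF, eYS, eY, eTS, eT, bt]
  simp [apply_ite]

lemma XS_eq {n : ℕ} (j : Fin n) : XS n j = LD (eXS n j) := by
  funext F p
  simp [XS, LD, VF_eXS, dirD]

lemma YS_eq {n : ℕ} (j : Fin n) : YS n j = LD (eYS n j) := by
  funext F p
  simp [YS, LD, VF_eYS, dirD]

lemma TS_eq {n : ℕ} : TS n = LD (eTS n) := by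
  funext F p
  simp [TS, LD, VF, eTS, eT, dirD, bt_zero_right]

lemma DA_eq {n : ℕ} : DA n = LD (eA n) := by
  funext F p
  simp [DA, LD, VF, eA, dirD, bt_zero_right]
  rfl

lemma bt_XX {n : ℕ} (i j : Fin n) : bt (eXS n i).1.1 (eXS n j).1.1 = 0 := by
  simp [bt, eXS, eX, apply_ite]
lemma bt_YY {n : ℕ} (i j : Fin n) : bt (eYS n i).1.1 (eYS n j).1.1 = 0 := by
  simp [bt, eYS, eY, apply_ite]
lemma bt_XY {n : ℕ} (i j : Fin n) :
    bt (eXS n i).1.1 (eYS n j).1.1 = if i = j then -2 else 0 := by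
  simp only [bt, eXS, eX, eYS, eY]
  rw [Finset.sum_eq_single j]
  · by_cases h : i = j
    · subst h; simp
    · simp [h, Ne.symm h]
  · intro b _ hb; simp [hb]
  · simp
lemma bt_YX {n : ℕ} (i j : Fin n) :
    bt (eYS n i).1.1 (eXS n j).1.1 = if i = j then 2 else 0 := by
  rw [bt_swap, bt_XY]
  by_cases h : i = j
  · simp [h]
  · simp [h, Ne.symm h]

/-- commutation with `T` or `∂_a`. -/
lemma LD_comm_T {n : ℕ} {d : Sg n} {F : Sg n → ℂ} (hF : Sm F) {p : Sg n} (hp : p ∈ Om n) :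
    LD (eTS n) (LD d F) p = LD d (LD (eTS n) F) p := by
  rw [LD_comm hF hp]; simp [eTS, eT, bt_zero_left]
lemma LD_comm_A {n : ℕ} {d : Sg n} {F : Sg n → ℂ} (hF : Sm F) {p : Sg n} (hp : p ∈ Om n) :
    LD (eA n) (LD d F) p = LD d (LD (eA n) F) p := by
  rw [LD_comm hF hp]; simp [eA, bt_zero_left]

/-! ### Second order calculus -/

/-- The operator `1/4 Σ (X_j² + Y_j²) - n ∂_a`. -/
def Qo {n : ℕ} (F : Sg n → ℂ) (p : Sg n) : ℂ :=
  (1/4) * ∑ j, (LD (eXS n j) (LD (eXS n j) F) p + LD (eYS n j) (LD (eYS n j) F) p)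
    - n * LD (eA n) F p

/-- Carré du champ. -/
def Gam {n : ℕ} (F G : Sg n → ℂ) (p : Sg n) : ℂ :=
  (1/2) * ∑ j, (LD (eXS n j) F p * LD (eXS n j) G p + LD (eYS n j) F p * LD (eYS n j) G p)

/-- The derivation `Z_j`. -/
def Zo {n : ℕ} (j : Fin n) (F : Sg n → ℂ) (p : Sg n) : ℂ :=
  (1/2) * (LD (eXS n j) F p - Complex.I * LD (eYS n j) F p)

/-- The derivation `conj Z_j`. -/
def Zbo {n : ℕ} (j : Fin n) (F : Sg n → ℂ) (p : Sg n) : ℂ :=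
  (1/2) * (LD (eXS n j) F p + Complex.I * LD (eYS n j) F p)

lemma Sm.sum {n : ℕ} {ι : Type} {s : Finset ι} {F : ι → Sg n → ℂ} (h : ∀ i ∈ s, Sm (F i)) :
    Sm (fun p => ∑ i ∈ s, F i p) := ContDiffOn.sum h

lemma Sm.cmul {n : ℕ} {F : Sg n → ℂ} (k : ℂ) (h : Sm F) : Sm (fun p => k * F p) :=
  (Sm.const k).mul h

lemma Sm.congr {n : ℕ} {F G : Sg n → ℂ} (h : Sm F) (hFG : ∀ p ∈ Om n, G p = F p) : Sm G :=
  ContDiffOn.congr h hFG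

lemma Sm.Zo {n : ℕ} {F : Sg n → ℂ} (h : Sm F) (j : Fin n) : Sm (Zo j F) :=
  ((h.LD _).sub ((h.LD _).cmul _)).cmul _

lemma Sm.Zbo {n : ℕ} {F : Sg n → ℂ} (h : Sm F) (j : Fin n) : Sm (Zbo j F) :=
  ((h.LD _).add ((h.LD _).cmul _)).cmul _

lemma Sm.Gam {n : ℕ} {F G : Sg n → ℂ} (h : Sm F) (h' : Sm G) : Sm (Gam F G) :=
  Sm.cmul _ (Sm.sum fun j _ => ((h.LD _).mul (h'.LD _)).add ((h.LD _).mul (h'.LD _)))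

lemma LD2_mul {n : ℕ} {c : Sg n} {F G : Sg n → ℂ} (hF : Sm F) (hG : Sm G) {p : Sg n}
    (hp : p ∈ Om n) : LD c (LD c (fun q => F q * G q)) p
      = F p * LD c (LD c G) p + G p * LD c (LD c F) p + 2 * (LD c F p * LD c G p) := by
  rw [LD_congr (fun q hq => LD_mul hF hG hq) hp,
    LD_add (hF.mul (hG.LD c)) (hG.mul (hF.LD c)) hp, LD_mul hF (hG.LD c) hp,
    LD_mul hG (hF.LD c) hp]
  ring

lemma LD2_add {n : ℕ} {c d : Sg n} {F G : Sg n → ℂ} (hF : Sm F) (hG : Sm G) {p : Sg n}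
    (hp : p ∈ Om n) : LD c (LD d (fun q => F q + G q)) p
      = LD c (LD d F) p + LD c (LD d G) p := by
  rw [LD_congr (fun q hq => LD_add hF hG hq) hp, LD_add (hF.LD d) (hG.LD d) hp]

lemma LD2_sub {n : ℕ} {c d : Sg n} {F G : Sg n → ℂ} (hF : Sm F) (hG : Sm G) {p : Sg n}
    (hp : p ∈ Om n) : LD c (LD d (fun q => F q - G q)) p
      = LD c (LD d F) p - LD c (LD d G) p := by
  rw [LD_congr (fun q hq => LD_sub hF hG hq) hp, LD_sub (hF.LD d) (hG.LD d) hp]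

lemma LD2_cmul {n : ℕ} {c d : Sg n} {F : Sg n → ℂ} (k : ℂ) (hF : Sm F) {p : Sg n}
    (hp : p ∈ Om n) : LD c (LD d (fun q => k * F q)) p = k * LD c (LD d F) p := by
  rw [LD_congr (fun q hq => LD_cmul k hF hq) hp, LD_cmul k (hF.LD d) hp]

lemma LD2_cj {n : ℕ} {c d : Sg n} {F : Sg n → ℂ} (hF : Sm F) {p : Sg n}
    (hp : p ∈ Om n) : LD c (LD d (fun q => (starRingEnd ℂ) (F q))) p
      = (starRingEnd ℂ) (LD c (LD d F) p) := by
  rw [LD_congr (fun q hq => LD_cj hF hq) hp, LD_cj (hF.LD d) hp]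

lemma LD2_congr {n : ℕ} {c d : Sg n} {F G : Sg n → ℂ} (h : ∀ p ∈ Om n, F p = G p)
    {p : Sg n} (hp : p ∈ Om n) : LD c (LD d F) p = LD c (LD d G) p :=
  LD_congr (fun _ hq => LD_congr h hq) hp

lemma Qo_congr {n : ℕ} {F G : Sg n → ℂ} (h : ∀ p ∈ Om n, F p = G p)
    {p : Sg n} (hp : p ∈ Om n) : Qo F p = Qo G p := by
  unfold Qo
  rw [LD_congr h hp]
  congr 2
  apply Finset.sum_congr rfl; intro j _
  rw [LD2_congr h hp, LD2_congr h hp]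

lemma Qo_add {n : ℕ} {F G : Sg n → ℂ} (hF : Sm F) (hG : Sm G) {p : Sg n}
    (hp : p ∈ Om n) : Qo (fun q => F q + G q) p = Qo F p + Qo G p := by
  unfold Qo
  simp only [LD2_add hF hG hp, LD_add hF hG hp, Finset.sum_add_distrib]
  ring

lemma Qo_sub {n : ℕ} {F G : Sg n → ℂ} (hF : Sm F) (hG : Sm G) {p : Sg n}
    (hp : p ∈ Om n) : Qo (fun q => F q - G q) p = Qo F p - Qo G p := by
  unfold Qo
  simp only [LD2_sub hF hG hp, LD_sub hF hG hp, Finset.sum_add_distrib, Finset.sum_sub_distrib]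
  ring

lemma Qo_cmul {n : ℕ} {F : Sg n → ℂ} (k : ℂ) (hF : Sm F) {p : Sg n}
    (hp : p ∈ Om n) : Qo (fun q => k * F q) p = k * Qo F p := by
  unfold Qo
  simp only [LD2_cmul k hF hp, LD_cmul k hF hp, Finset.sum_add_distrib, ← Finset.mul_sum]
  ring

lemma Qo_cj {n : ℕ} {F : Sg n → ℂ} (hF : Sm F) {p : Sg n}
    (hp : p ∈ Om n) : Qo (fun q => (starRingEnd ℂ) (F q)) p = (starRingEnd ℂ) (Qo F p) := by
  unfold Qo
  simp only [LD2_cj hF hp, LD_cj hF hp, map_sub, map_mul, map_sum, map_add]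
  simp
  left; exact (map_ofNat (starRingEnd ℂ) 4).symm

lemma Qo_const {n : ℕ} (k : ℂ) (p : Sg n) : Qo (fun _ : Sg n => k) p = 0 := by
  unfold Qo
  have : ∀ c : Sg n, LD c (fun _ : Sg n => k) = fun _ => 0 := fun c => funext fun q => LD_const k q
  simp [this, LD_const]

lemma Qo_mul {n : ℕ} {F G : Sg n → ℂ} (hF : Sm F) (hG : Sm G) {p : Sg n}
    (hp : p ∈ Om n) :
    Qo (fun q => F q * G q) p = F p * Qo G p + G p * Qo F p + Gam F G p := by
  unfold Qo Gam
  simp only [LD2_mul hF hG hp, LD_mul hF hG hp, Finset.sum_add_distrib, ← Finset.mul_sum]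
  ring

/-- `L_α` in terms of `Q`. -/
lemma Lalpha_eq {n : ℕ} (α : ℝ) (F : Sg n → ℂ) (p : Sg n) :
    Lalpha n α F p = α * p.2 * Qo F p
      + (p.2 : ℂ) ^ 2 * (LD (eA n) (LD (eA n) F) p + LD (eTS n) (LD (eTS n) F) p) := by
  unfold Lalpha LS0 Qo
  simp only [XS_eq, YS_eq, TS_eq, DA_eq]
  ring

lemma LD_Zo {n : ℕ} {c : Sg n} {F : Sg n → ℂ} (hF : Sm F) {p : Sg n}
    (hp : p ∈ Om n) (i : Fin n) : LD c (Zo i F) p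
      = (1/2) * (LD c (LD (eXS n i) F) p - Complex.I * LD c (LD (eYS n i) F) p) := by
  unfold Zo
  rw [LD_cmul _ ((hF.LD _).sub ((hF.LD _).cmul _)) hp, LD_sub (hF.LD _) ((hF.LD _).cmul _) hp,
    LD_cmul _ (hF.LD _) hp]

/-- `Q` in terms of `conj Z_j Z_j`. -/
lemma Qo_eq_ZbZ {n : ℕ} {F : Sg n → ℂ} (hF : Sm F) {p : Sg n} (hp : p ∈ Om n) :
    Qo F p = ∑ j, Zbo j (Zo j F) p - Complex.I * n * LD (eTS n) F p - n * LD (eA n) F p := by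
  have h : ∀ j : Fin n, Zbo j (Zo j F) p
      = (1/4) * (LD (eXS n j) (LD (eXS n j) F) p + LD (eYS n j) (LD (eYS n j) F) p)
        + Complex.I * LD (eTS n) F p := by
    intro j
    unfold Zbo
    rw [LD_Zo hF hp, LD_Zo hF hp, LD_comm hF hp (c := eXS n j) (d := eYS n j), bt_XY]
    simp only [if_true]
    push_cast
    linear_combination (-(1/4) * LD (eYS n j) (LD (eYS n j) F) p) * Complex.I_sq
  simp only [h, Finset.sum_add_distrib, ← Finset.mul_sum]
  unfold Qo
  simp [Finset.sum_add_distrib]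
  ring

lemma LD_Qo {n : ℕ} {c : Sg n} {F : Sg n → ℂ} (hF : Sm F) {p : Sg n} (hp : p ∈ Om n) :
    LD c (Qo F) p = (1/4) * ∑ j, (LD c (LD (eXS n j) (LD (eXS n j) F)) p
      + LD c (LD (eYS n j) (LD (eYS n j) F)) p) - n * LD c (LD (eA n) F) p := by
  have h1 : ∀ j ∈ Finset.univ, Sm (fun p => LD (eXS n j) (LD (eXS n j) F) p
      + LD (eYS n j) (LD (eYS n j) F) p) :=
    fun j _ => ((hF.LD _).LD _).add ((hF.LD _).LD _)
  have h2 : LD c (fun p => ∑ j, (LD (eXS n j) (LD (eXS n j) F) p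
      + LD (eYS n j) (LD (eYS n j) F) p)) p = ∑ j, (LD c (LD (eXS n j) (LD (eXS n j) F)) p
      + LD c (LD (eYS n j) (LD (eYS n j) F)) p) := by
    have : ∀ s : Finset (Fin n), LD c (fun p => ∑ j ∈ s, (LD (eXS n j) (LD (eXS n j) F) p
      + LD (eYS n j) (LD (eYS n j) F) p)) p = ∑ j ∈ s, (LD c (LD (eXS n j) (LD (eXS n j) F)) p
      + LD c (LD (eYS n j) (LD (eYS n j) F)) p) := by
      intro s
      induction s using Finset.induction_on with
      | empty => simp [LD_const]
      | insert a s ha ih =>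
        simp only [Finset.sum_insert ha]
        rw [LD_add (h1 a (Finset.mem_univ _)) (Sm.sum fun j _ => h1 j (Finset.mem_univ _)) hp, ih,
          LD_add ((hF.LD _).LD _) ((hF.LD _).LD _) hp]
    exact this _
  unfold Qo
  rw [LD_sub ((Sm.sum h1).cmul _) ((hF.LD _).cmul _) hp, LD_cmul _ (Sm.sum h1) hp,
    LD_cmul _ (hF.LD _) hp, h2]

lemma Sm.Qo {n : ℕ} {F : Sg n → ℂ} (hF : Sm F) : Sm (Qo F) :=
  ((Sm.sum fun _ _ => ((hF.LD _).LD _).add ((hF.LD _).LD _)).cmul _).sub ((hF.LD _).cmul _)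

lemma LD_comm2 {n : ℕ} {c d : Sg n} {F : Sg n → ℂ} (hF : Sm F) {p : Sg n} (hp : p ∈ Om n) :
    LD c (LD c (LD d F)) p = LD d (LD c (LD c F)) p
      + 4 * (bt c.1.1 d.1.1 : ℂ) * LD (eTS n) (LD c F) p := by
  rw [LD_congr (fun q hq => LD_comm hF hq) hp,
    LD_add ((hF.LD _).LD _) ((hF.LD _).cmul _) hp, LD_comm (hF.LD c) hp, LD_cmul _ (hF.LD _) hp,
    LD_comm_T hF hp]
  ring

/-- commutator of `Q` and `X_i`. -/
lemma Qo_X {n : ℕ} {F : Sg n → ℂ} (hF : Sm F) {p : Sg n} (hp : p ∈ Om n) (i : Fin n) :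
    Qo (LD (eXS n i) F) p = LD (eXS n i) (Qo F) p + 2 * LD (eTS n) (LD (eYS n i) F) p := by
  rw [LD_Qo hF hp]
  unfold Qo
  simp only [LD_comm2 hF hp (d := eXS n i), bt_XX, bt_YX, LD_comm_A hF hp]
  simp only [Finset.sum_add_distrib]
  simp [apply_ite Complex.ofReal, ite_mul, mul_ite]
  ring

lemma Qo_Y {n : ℕ} {F : Sg n → ℂ} (hF : Sm F) {p : Sg n} (hp : p ∈ Om n) (i : Fin n) :
    Qo (LD (eYS n i) F) p = LD (eYS n i) (Qo F) p - 2 * LD (eTS n) (LD (eXS n i) F) p := by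
  rw [LD_Qo hF hp]
  unfold Qo
  simp only [LD_comm2 hF hp (d := eYS n i), bt_XY, bt_YY, LD_comm_A hF hp]
  simp only [Finset.sum_add_distrib]
  simp [apply_ite Complex.ofReal, ite_mul, mul_ite]
  ring

lemma Qo_Z {n : ℕ} {F : Sg n → ℂ} (hF : Sm F) {p : Sg n} (hp : p ∈ Om n) (i : Fin n) :
    Qo (Zo i F) p = Zo i (Qo F) p + 2 * Complex.I * LD (eTS n) (Zo i F) p := by
  rw [LD_Zo hF hp]
  have : Qo (Zo i F) p = (1/2) * (Qo (LD (eXS n i) F) p - Complex.I * Qo (LD (eYS n i) F) p) := by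
    unfold Zo
    rw [Qo_cmul _ ((hF.LD _).sub ((hF.LD _).cmul _)) hp, Qo_sub (hF.LD _) ((hF.LD _).cmul _) hp,
      Qo_cmul _ (hF.LD _) hp]
  rw [this, Qo_X hF hp, Qo_Y hF hp]
  unfold Zo
  linear_combination LD (eTS n) (LD (eYS n i) F) p * Complex.I_sq

lemma Zo_congr {n : ℕ} {F G : Sg n → ℂ} (h : ∀ p ∈ Om n, F p = G p) (i : Fin n)
    {p : Sg n} (hp : p ∈ Om n) : Zo i F p = Zo i G p := by
  unfold Zo; rw [LD_congr h hp, LD_congr h hp]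

lemma Zo_cmul {n : ℕ} {F : Sg n → ℂ} (k : ℂ) (hF : Sm F) (i : Fin n)
    {p : Sg n} (hp : p ∈ Om n) : Zo i (fun q => k * F q) p = k * Zo i F p := by
  unfold Zo; rw [LD_cmul k hF hp, LD_cmul k hF hp]; ring

/-! ### Line data and local maxima -/

/-- `u` is differentiable near `0`, with first and second derivative `d1`, `d2` at `0`. -/
def HL2 (u : ℝ → ℂ) (d1 d2 : ℂ) : Prop :=
  ∃ e : ℝ → ℂ, (∀ᶠ r in 𝓝 (0:ℝ), HasDerivAt u (e r) r) ∧ e 0 = d1 ∧ HasDerivAt e d2 0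

lemma HL2.add {u v : ℝ → ℂ} {d1 d2 d1' d2' : ℂ} (hu : HL2 u d1 d2) (hv : HL2 v d1' d2') :
    HL2 (fun r => u r + v r) (d1 + d1') (d2 + d2') := by
  obtain ⟨e, h1, h2, h3⟩ := hu
  obtain ⟨e', h1', h2', h3'⟩ := hv
  refine ⟨fun r => e r + e' r, ?_, by simp [h2, h2'], h3.fun_add h3'⟩
  filter_upwards [h1, h1'] with r a b using a.fun_add b

lemma HL2.cmul {u : ℝ → ℂ} {d1 d2 : ℂ} (k : ℂ) (hu : HL2 u d1 d2) :
    HL2 (fun r => k * u r) (k * d1) (k * d2) := by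
  obtain ⟨e, h1, h2, h3⟩ := hu
  refine ⟨fun r => k * e r, ?_, by simp [h2], h3.const_mul k⟩
  filter_upwards [h1] with r a using a.const_mul k

lemma HL2.sub {u v : ℝ → ℂ} {d1 d2 d1' d2' : ℂ} (hu : HL2 u d1 d2) (hv : HL2 v d1' d2') :
    HL2 (fun r => u r - v r) (d1 - d1') (d2 - d2') := by
  have := hu.add (hv.cmul (-1))
  simpa [sub_eq_add_neg] using this

lemma HL2.localMax {u : ℝ → ℂ} {d1 d2 : ℂ} (hu : HL2 u d1 d2)
    (hm : IsLocalMax (fun r => (u r).re) 0) : d1.re = 0 ∧ d2.re ≤ 0 := by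
  obtain ⟨e, h1, h2, h3⟩ := hu
  have hre : ∀ᶠ r in 𝓝 (0:ℝ), HasDerivAt (fun r => (u r).re) (e r).re r := by
    filter_upwards [h1] with r hr
    exact Complex.reCLM.hasFDerivAt.comp_hasDerivAt r hr
  have he : HasDerivAt (fun r => (e r).re) d2.re 0 :=
    Complex.reCLM.hasFDerivAt.comp_hasDerivAt 0 h3
  have hd : deriv (fun r => (u r).re) =ᶠ[𝓝 0] fun r => (e r).re := by
    filter_upwards [hre] with r hr using hr.deriv
  have h0 : d1.re = 0 := by
    have := hm.hasDerivAt_eq_zero hre.self_of_nhds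
    rwa [h2] at this
  refine ⟨h0, ?_⟩
  by_contra hpos
  push Not at hpos
  have hdd : deriv (deriv (fun r => (u r).re)) 0 = d2.re := by
    rw [hd.deriv_eq, he.deriv]
  have hmin : IsLocalMin (fun r => (u r).re) 0 := by
    apply isLocalMin_of_deriv_deriv_pos (by rw [hdd]; exact hpos)
    · rw [hd.self_of_nhds]; simp only [h2, h0]
    · exact hre.self_of_nhds.continuousAt
  have hc : (fun r => (u r).re) =ᶠ[𝓝 0] fun _ => (u 0).re := by
    filter_upwards [hm, hmin] with r a b using le_antisymm a b
  have : deriv (deriv (fun r => (u r).re)) 0 = 0 := by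
    have h5 := hc.deriv
    rw [h5.deriv_eq]; simp
  linarith

lemma HL2_of_Sm {n : ℕ} {F : Sg n → ℂ} (hF : Sm F) (c : Sg n) {p : Sg n} (hp : p ∈ Om n) :
    HL2 (fun r => F (p + r • VF c p)) (LD c F p) (LD c (LD c F) p) := by
  refine ⟨fun r => LD c F (p + r • VF c p), ?_, by simp, ?_⟩
  · have hc : ContinuousAt (fun r : ℝ => p + r • VF c p) 0 := by fun_prop
    have : ∀ᶠ r : ℝ in 𝓝 0, p + r • VF c p ∈ Om n :=
      hc.eventually (by simpa using Om_nhds hp)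
    filter_upwards [this] with r hr using hasDerivAt_line hF hr
  · have := hasDerivAt_line (hF.LD c) (c := c) (p := p) (s := 0) (by simpa using hp)
    simpa using this

lemma HL2.unique {u : ℝ → ℂ} {d1 d2 d1' d2' : ℂ} (hu : HL2 u d1 d2) (hv : HL2 u d1' d2') :
    d1 = d1' ∧ d2 = d2' := by
  obtain ⟨e, h1, h2, h3⟩ := hu
  obtain ⟨e', h1', h2', h3'⟩ := hv
  have : e =ᶠ[𝓝 0] e' := by
    filter_upwards [h1, h1'] with r a b using a.unique b
  refine ⟨by rw [← h2, ← h2', this.self_of_nhds], ?_⟩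
  exact h3.unique (h3'.congr_of_eventuallyEq this)

lemma line_localMax {n : ℕ} {u : Sg n → ℝ} {p : Sg n} (h : IsLocalMax u p) (v : Sg n) :
    IsLocalMax (fun r : ℝ => u (p + r • v)) 0 := by
  have hc : ContinuousAt (fun r : ℝ => p + r • v) 0 := by fun_prop
  have h' : ∀ᶠ q in 𝓝 (p + (0:ℝ) • v), u q ≤ u p := by rw [zero_smul, add_zero]; exact h
  have := hc.eventually h'
  filter_upwards [this] with r hr
  simpa using hr

lemma localMax_of_Sm {n : ℕ} {F : Sg n → ℂ} (hF : Sm F) {p : Sg n} (hp : p ∈ Om n)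
    (hm : IsLocalMax (fun q => (F q).re) p) (c : Sg n) :
    (LD c F p).re = 0 ∧ (LD c (LD c F) p).re ≤ 0 :=
  (HL2_of_Sm hF c hp).localMax (line_localMax hm _)

lemma localMax_Qo {n : ℕ} {F : Sg n → ℂ} (hF : Sm F) {p : Sg n} (hp : p ∈ Om n)
    (hm : IsLocalMax (fun q => (F q).re) p) : (Qo F p).re ≤ 0 := by
  have h := localMax_of_Sm hF hp hm
  unfold Qo
  have h1 : (∑ j, (LD (eXS n j) (LD (eXS n j) F) p + LD (eYS n j) (LD (eYS n j) F) p)).re ≤ 0 := by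
    rw [Complex.re_sum]
    apply Finset.sum_nonpos
    intro j _
    rw [Complex.add_re]
    linarith [(h (eXS n j)).2, (h (eYS n j)).2]
  have h2 : ((1/4 : ℂ)) = ((1/4 : ℝ) : ℂ) := by push_cast; rfl
  have h3 : ((n : ℂ)) = ((n : ℝ) : ℂ) := by push_cast; rfl
  rw [h2, h3, Complex.sub_re, Complex.re_ofReal_mul, Complex.re_ofReal_mul, (h (eA n)).1]
  linarith

/-- Maximum on a compact set. -/
lemma compact_max {n : ℕ} {u : Sg n → ℝ} {K : Set (Sg n)} (hK : IsCompact K)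
    (hu : ContinuousOn u K) {m : ℝ}
    (h : ∀ p ∈ K, m < u p → K ∈ 𝓝 p ∧ ¬ IsLocalMax u p) : ∀ p ∈ K, u p ≤ m := by
  intro p hp
  obtain ⟨q, hq, hmax⟩ := hK.exists_isMaxOn ⟨p, hp⟩ hu
  by_contra hlt
  push Not at hlt
  have hq2 : m < u q := lt_of_lt_of_le hlt (hmax hp)
  obtain ⟨h1, h2⟩ := h q hq hq2
  exact h2 (hmax.isLocalMax h1)

/-- Maximum principle on the half space. -/
lemma max_principle {n : ℕ} {u : Sg n → ℝ} {m : ℝ} (hu : ContinuousOn u (Om n))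
    (hb : ∀ w : Hn n, ∀ κ > 0, ∀ᶠ p in 𝓝[Om n] ((w, 0) : Sg n), u p < m + κ)
    (hbd : ∃ R : ℝ, ∀ p ∈ Om n, m < u p → ‖p‖ ≤ R)
    (hno : ∀ p ∈ Om n, m < u p → ¬ IsLocalMax u p) : ∀ p ∈ Om n, u p ≤ m := by
  intro p0 hp0
  apply le_of_forall_pos_le_add
  intro κ hκ
  by_contra hlt
  push Not at hlt
  obtain ⟨R, hR⟩ := hbd
  set K : Set (Sg n) := {p | p ∈ Om n ∧ m + κ ≤ u p} with hKdef
  have hclosed : IsClosed K := by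
    rw [← isOpen_compl_iff, isOpen_iff_mem_nhds]
    intro q hq
    rcases lt_trichotomy q.2 0 with h | h | h
    · have : {p : Sg n | p.2 < 0} ∈ 𝓝 q := (isOpen_lt continuous_snd continuous_const).mem_nhds h
      filter_upwards [this] with p hp hpK
      exact absurd hpK.1 (not_lt.2 (le_of_lt hp))
    · have h1 := hb q.1 κ hκ
      have h2 : ((q.1, (0:ℝ)) : Sg n) = q := by rw [← h]
      rw [h2, eventually_nhdsWithin_iff] at h1
      filter_upwards [h1] with p hp hpK
      exact absurd hpK.2 (not_le.2 (hp hpK.1))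
    · have hq' : u q < m + κ := by
        by_contra hc; exact hq ⟨h, not_lt.1 hc⟩
      have h1 : ContinuousAt u q := hu.continuousAt (Om_nhds h)
      filter_upwards [h1.eventually (gt_mem_nhds hq')] with p hp hpK
      exact absurd hpK.2 (not_le.2 hp)
  have hcomp : IsCompact K := by
    apply Metric.isCompact_of_isClosed_isBounded hclosed
    apply (Metric.isBounded_closedBall (x := (0 : Sg n)) (r := R)).subset
    intro p hp
    simpa using hR p hp.1 (by linarith [hp.2])
  have hp0K : p0 ∈ K := ⟨hp0, hlt.le⟩
  obtain ⟨q, hq, hmax⟩ := hcomp.exists_isMaxOn ⟨p0, hp0K⟩ (hu.mono fun p hp => hp.1)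
  refine hno q hq.1 (by linarith [hq.2]) ?_
  filter_upwards [Om_nhds hq.1] with p hp
  by_cases hpK : p ∈ K
  · exact hmax hpK
  · have : u p < m + κ := by by_contra hc; exact hpK ⟨hp, not_lt.1 hc⟩
    linarith [hq.2]

/-! ### The barrier -/

/-- `|ζ|² + a + 1`. -/
def bq {n : ℕ} (p : Sg n) : ℝ := ∑ j, ((p.1.1 j).re ^ 2 + (p.1.1 j).im ^ 2) + p.2 + 1
/-- `t² + b²`. -/
def Pq {n : ℕ} (p : Sg n) : ℝ := p.1.2 ^ 2 + bq p ^ 2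
/-- The barrier. -/
def psi {n : ℕ} (p : Sg n) : ℝ := (1/2) * Real.log (Pq p)

lemma bq_ge {n : ℕ} {p : Sg n} (hp : 0 ≤ p.2) : 1 ≤ bq p := by
  unfold bq
  have : 0 ≤ ∑ j, ((p.1.1 j).re ^ 2 + (p.1.1 j).im ^ 2) := Finset.sum_nonneg fun j _ => by positivity
  linarith

lemma Pq_ge {n : ℕ} {p : Sg n} (hp : 0 ≤ p.2) : 1 ≤ Pq p := by
  unfold Pq
  nlinarith [bq_ge hp, sq_nonneg p.1.2]

lemma psi_nonneg {n : ℕ} {p : Sg n} (hp : 0 ≤ p.2) : 0 ≤ psi p := by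
  unfold psi
  have := Real.log_nonneg (Pq_ge hp)
  linarith

lemma bq_contDiff {n : ℕ} : ContDiff ℝ (⊤ : ℕ∞) (bq : Sg n → ℝ) := by
  unfold bq
  have : ∀ j : Fin n, ContDiff ℝ (⊤ : ℕ∞) (fun p : Sg n => p.1.1 j) := fun j =>
    (contDiff_apply ℝ ℂ j).comp (contDiff_fst.comp contDiff_fst)
  refine ((ContDiff.sum fun j _ => ?_).add contDiff_snd).add contDiff_const
  exact ((Complex.reCLM.contDiff.comp (this j)).pow 2).add
    ((Complex.imCLM.contDiff.comp (this j)).pow 2)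

lemma Pq_contDiff {n : ℕ} : ContDiff ℝ (⊤ : ℕ∞) (Pq : Sg n → ℝ) :=
  ((contDiff_snd.comp contDiff_fst).pow 2).add (bq_contDiff.pow 2)

lemma psi_Sm {n : ℕ} : Sm (fun p : Sg n => (psi p : ℂ)) := by
  have h1 : ContDiffOn ℝ (⊤ : ℕ∞) (psi : Sg n → ℝ) (Om n) := by
    unfold psi
    refine contDiffOn_const.mul (Pq_contDiff.contDiffOn.log ?_)
    intro p hp
    have : 0 < p.2 := hp
    linarith [Pq_ge this.le]
  exact Complex.ofRealCLM.contDiff.comp_contDiffOn h1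

lemma norm_le_exp_psi {n : ℕ} {p : Sg n} (hp : 0 ≤ p.2) : ‖p‖ ≤ Real.exp (psi p) := by
  have hP := Pq_ge hp
  have hb := bq_ge hp
  have h2 : Real.exp (psi p) ^ 2 = Pq p := by
    rw [← Real.exp_nat_mul]
    unfold psi
    rw [show ((2:ℕ):ℝ) * (1/2 * Real.log (Pq p)) = Real.log (Pq p) by push_cast; ring,
      Real.exp_log (by linarith)]
  have he := Real.exp_pos (psi p)
  have hbe : bq p ≤ Real.exp (psi p) := by
    apply le_of_sq_le_sq _ he.le
    rw [h2]; unfold Pq; nlinarith [sq_nonneg p.1.2]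
  have hte : |p.1.2| ≤ Real.exp (psi p) := by
    apply le_of_sq_le_sq _ he.le
    rw [h2, sq_abs]; unfold Pq; nlinarith [sq_nonneg (bq p)]
  have hs : ∀ j, ‖p.1.1 j‖ ^ 2 ≤ ∑ j, ((p.1.1 j).re ^ 2 + (p.1.1 j).im ^ 2) := by
    intro j
    have := Finset.single_le_sum (f := fun j => ((p.1.1 j).re ^ 2 + (p.1.1 j).im ^ 2))
      (fun j _ => by positivity) (Finset.mem_univ j)
    refine le_trans (le_of_eq ?_) this
    rw [← Complex.normSq_eq_norm_sq, Complex.normSq_apply]; ring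
  have hs0 : 0 ≤ ∑ j, ((p.1.1 j).re ^ 2 + (p.1.1 j).im ^ 2) :=
    Finset.sum_nonneg fun j _ => by positivity
  rw [Prod.norm_def, Prod.norm_def]
  refine max_le (max_le ?_ ?_) ?_
  · rw [pi_norm_le_iff_of_nonneg he.le]
    intro j
    refine le_trans ?_ hbe
    unfold bq
    nlinarith [hs j, sq_nonneg (‖p.1.1 j‖ - 1), norm_nonneg (p.1.1 j)]
  · exact hte
  · rw [Real.norm_of_nonneg hp]
    refine le_trans ?_ hbe
    unfold bq; linarith

lemma HL2_log {t t1 b b1 k : ℝ} (hP : 0 < t ^ 2 + b ^ 2) :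
    HL2 (fun r : ℝ => (((1/2) * Real.log ((t + r * t1) ^ 2 + (b + r * b1 + r ^ 2 * k) ^ 2) : ℝ) : ℂ))
      (((t * t1 + b * b1) / (t ^ 2 + b ^ 2) : ℝ) : ℂ)
      (((t1 ^ 2 + b1 ^ 2 + 2 * k * b) / (t ^ 2 + b ^ 2)
        - 2 * (t * t1 + b * b1) ^ 2 / (t ^ 2 + b ^ 2) ^ 2 : ℝ) : ℂ) := by
  refine ⟨fun r => ((((t + r * t1) * t1 + (b + r * b1 + r ^ 2 * k) * (b1 + 2 * r * k))
    / ((t + r * t1) ^ 2 + (b + r * b1 + r ^ 2 * k) ^ 2) : ℝ) : ℂ), ?_, ?_, ?_⟩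
  · have hc : ContinuousAt (fun r : ℝ => (t + r * t1) ^ 2 + (b + r * b1 + r ^ 2 * k) ^ 2) 0 := by
      fun_prop
    have : ∀ᶠ r : ℝ in 𝓝 0, 0 < (t + r * t1) ^ 2 + (b + r * b1 + r ^ 2 * k) ^ 2 :=
      hc.eventually (lt_mem_nhds (by simpa using hP))
    filter_upwards [this] with r hr
    have h1 : HasDerivAt (fun r : ℝ => (t + r * t1)) t1 r := by
      simpa using ((hasDerivAt_id r).mul_const t1).const_add t
    have h2 : HasDerivAt (fun r : ℝ => (b + r * b1 + r ^ 2 * k)) (b1 + 2 * r * k) r := by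
      simpa using (((hasDerivAt_id r).mul_const b1).const_add b).fun_add
        ((hasDerivAt_pow 2 r).mul_const k)
    have h3 := (((h1.fun_pow 2).fun_add (h2.fun_pow 2)).log hr.ne').const_mul (1/2 : ℝ)
    have h4 := h3.ofReal_comp
    convert h4 using 1
    simp only [Complex.ofReal_inj]
    field_simp
    push_cast
    ring
  · simp
  · have h1 : HasDerivAt (fun r : ℝ => (t + r * t1)) t1 0 := by
      simpa using ((hasDerivAt_id (0:ℝ)).mul_const t1).const_add t
    have h2 : HasDerivAt (fun r : ℝ => (b + r * b1 + r ^ 2 * k)) b1 0 := by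
      simpa using (((hasDerivAt_id (0:ℝ)).mul_const b1).const_add b).fun_add
        ((hasDerivAt_pow 2 (0:ℝ)).mul_const k)
    have h2' : HasDerivAt (fun r : ℝ => (b1 + 2 * r * k)) (2 * k) 0 := by
      simpa using (((hasDerivAt_id (0:ℝ)).const_mul 2).mul_const k).const_add b1
    have h3 := ((h1.mul_const t1).fun_add (h2.fun_mul h2')).fun_div ((h1.fun_pow 2).fun_add (h2.fun_pow 2))
      (by simpa using hP.ne')
    have h4 := h3.ofReal_comp
    convert h4 using 1
    simp only [Complex.ofReal_inj]
    simp
    field_simp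
    ring

lemma psi_line {n : ℕ} {p : Sg n} (hp : p ∈ Om n) (c : Sg n) {t1 b1 k : ℝ}
    (h1 : (VF c p).1.2 = t1)
    (h2 : ∀ r : ℝ, bq (p + r • VF c p) = bq p + r * b1 + r ^ 2 * k) :
    LD c (fun p => (psi p : ℂ)) p = (((p.1.2 * t1 + bq p * b1) / Pq p : ℝ) : ℂ) ∧
    LD c (LD c (fun p => (psi p : ℂ))) p = (((t1 ^ 2 + b1 ^ 2 + 2 * k * bq p) / Pq p
        - 2 * (p.1.2 * t1 + bq p * b1) ^ 2 / (Pq p) ^ 2 : ℝ) : ℂ) := by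
  have hp' : 0 < p.2 := hp
  have hP : 0 < Pq p := by linarith [Pq_ge hp'.le]
  have h3 := HL2_log (t := p.1.2) (b := bq p) (t1 := t1) (b1 := b1) (k := k) hP
  have h4 := HL2_of_Sm psi_Sm c hp
  have h5 : (fun r : ℝ => ((psi (p + r • VF c p) : ℝ) : ℂ)) = (fun r : ℝ => (((1/2) * Real.log
      ((p.1.2 + r * t1) ^ 2 + (bq p + r * b1 + r ^ 2 * k) ^ 2) : ℝ) : ℂ)) := by
    funext r
    unfold psi Pq
    rw [h2 r, ← h1]
    simp
  rw [h5] at h4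
  exact h4.unique h3

lemma bq_line {n : ℕ} (p v : Sg n) (r : ℝ) : bq (p + r • v) = bq p
    + r * (∑ j, 2 * ((p.1.1 j).re * (v.1.1 j).re + (p.1.1 j).im * (v.1.1 j).im) + v.2)
    + r ^ 2 * ∑ j, ((v.1.1 j).re ^ 2 + (v.1.1 j).im ^ 2) := by
  unfold bq
  simp only [mul_add, Finset.mul_sum]
  have : ∀ a b c d : Fin n → ℝ, (∑ j, a j + ∑ j, c j) + ∑ j, d j = ∑ j, (a j + c j + d j) := by
    intro a b c d; simp [Finset.sum_add_distrib]
  have h2 : ∑ j, (((p + r • v).1.1 j).re ^ 2 + ((p + r • v).1.1 j).im ^ 2)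
      = ∑ j, ((p.1.1 j).re ^ 2 + (p.1.1 j).im ^ 2) + ∑ j, (r * (2 * ((p.1.1 j).re * (v.1.1 j).re))
        + r * (2 * ((p.1.1 j).im * (v.1.1 j).im)))
        + ∑ j, (r ^ 2 * (v.1.1 j).re ^ 2 + r ^ 2 * (v.1.1 j).im ^ 2) := by
    rw [← Finset.sum_add_distrib, ← Finset.sum_add_distrib]
    apply Finset.sum_congr rfl
    intro j _
    simp
    ring
  rw [h2]
  simp
  ring

lemma psi_X {n : ℕ} {p : Sg n} (hp : p ∈ Om n) (j : Fin n) :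
    LD (eXS n j) (fun p => (psi p : ℂ)) p
      = (((p.1.2 * (2 * (p.1.1 j).im) + bq p * (2 * (p.1.1 j).re)) / Pq p : ℝ) : ℂ) ∧
    LD (eXS n j) (LD (eXS n j) (fun p => (psi p : ℂ))) p
      = ((((2 * (p.1.1 j).im) ^ 2 + (2 * (p.1.1 j).re) ^ 2 + 2 * 1 * bq p) / Pq p
        - 2 * (p.1.2 * (2 * (p.1.1 j).im) + bq p * (2 * (p.1.1 j).re)) ^ 2 / (Pq p) ^ 2 : ℝ) : ℂ) := by
  apply psi_line hp
  · rw [VF_eXS]; simp [eXS, eX, eTS, eT]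
  · intro r
    rw [bq_line, VF_eXS]
    simp [eXS, eX, eTS, eT, apply_ite]

lemma psi_Y {n : ℕ} {p : Sg n} (hp : p ∈ Om n) (j : Fin n) :
    LD (eYS n j) (fun p => (psi p : ℂ)) p
      = (((p.1.2 * (-(2 * (p.1.1 j).re)) + bq p * (2 * (p.1.1 j).im)) / Pq p : ℝ) : ℂ) ∧
    LD (eYS n j) (LD (eYS n j) (fun p => (psi p : ℂ))) p
      = ((((-(2 * (p.1.1 j).re)) ^ 2 + (2 * (p.1.1 j).im) ^ 2 + 2 * 1 * bq p) / Pq p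
        - 2 * (p.1.2 * (-(2 * (p.1.1 j).re)) + bq p * (2 * (p.1.1 j).im)) ^ 2 / (Pq p) ^ 2 : ℝ) : ℂ) := by
  apply psi_line hp
  · rw [VF_eYS]; simp [eYS, eY, eTS, eT]
  · intro r
    rw [bq_line, VF_eYS]
    simp [eYS, eY, eTS, eT, apply_ite]

lemma psi_T {n : ℕ} {p : Sg n} (hp : p ∈ Om n) :
    LD (eTS n) (fun p => (psi p : ℂ)) p
      = (((p.1.2 * 1 + bq p * 0) / Pq p : ℝ) : ℂ) ∧
    LD (eTS n) (LD (eTS n) (fun p => (psi p : ℂ))) p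
      = ((((1:ℝ) ^ 2 + 0 ^ 2 + 2 * 0 * bq p) / Pq p
        - 2 * (p.1.2 * 1 + bq p * 0) ^ 2 / (Pq p) ^ 2 : ℝ) : ℂ) := by
  apply psi_line hp
  · simp [VF, eTS, eT, bt_zero_right]
  · intro r
    rw [bq_line]
    simp [VF, eTS, eT]

lemma psi_A {n : ℕ} {p : Sg n} (hp : p ∈ Om n) :
    LD (eA n) (fun p => (psi p : ℂ)) p
      = (((p.1.2 * 0 + bq p * 1) / Pq p : ℝ) : ℂ) ∧
    LD (eA n) (LD (eA n) (fun p => (psi p : ℂ))) p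
      = ((((0:ℝ) ^ 2 + 1 ^ 2 + 2 * 0 * bq p) / Pq p
        - 2 * (p.1.2 * 0 + bq p * 1) ^ 2 / (Pq p) ^ 2 : ℝ) : ℂ) := by
  apply psi_line hp
  · simp [VF, eA, bt_zero_right]
  · intro r
    rw [bq_line]
    simp [VF, eA]

lemma Qo_psi {n : ℕ} {p : Sg n} (hp : p ∈ Om n) : Qo (fun p : Sg n => (psi p : ℂ)) p = 0 := by
  have hp' : 0 < p.2 := hp
  have hP : 0 < Pq p := by linarith [Pq_ge hp'.le]
  unfold Qo
  have h : ∀ j : Fin n, LD (eXS n j) (LD (eXS n j) (fun p => (psi p : ℂ))) p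
      + LD (eYS n j) (LD (eYS n j) (fun p => (psi p : ℂ))) p = ((4 * bq p / Pq p : ℝ) : ℂ) := by
    intro j
    rw [(psi_X hp j).2, (psi_Y hp j).2, ← Complex.ofReal_add]
    congr 1
    field_simp
    unfold Pq
    ring
  simp only [h, (psi_A hp).1]
  simp
  ring

lemma lap_psi {n : ℕ} {p : Sg n} (hp : p ∈ Om n) :
    LD (eA n) (LD (eA n) (fun p : Sg n => (psi p : ℂ))) p
      + LD (eTS n) (LD (eTS n) (fun p : Sg n => (psi p : ℂ))) p = 0 := by
  have hp' : 0 < p.2 := hp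
  have hP : 0 < Pq p := by linarith [Pq_ge hp'.le]
  rw [(psi_A hp).2, (psi_T hp).2, ← Complex.ofReal_add, ← Complex.ofReal_zero]
  congr 1
  field_simp
  unfold Pq
  ring

lemma Gam_psi {n : ℕ} {p : Sg n} (hp : p ∈ Om n) : ∃ g : ℝ, 0 ≤ g ∧ g ≤ 1 / 2 ∧
    Gam (fun p : Sg n => (psi p : ℂ)) (fun p : Sg n => (psi p : ℂ)) p = (g : ℂ) := by
  have hp' : 0 < p.2 := hp
  have hP : 0 < Pq p := by linarith [Pq_ge hp'.le]
  have hb := bq_ge hp'.le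
  refine ⟨2 * (∑ j, ((p.1.1 j).re ^ 2 + (p.1.1 j).im ^ 2)) / Pq p, ?_, ?_, ?_⟩
  · have : 0 ≤ ∑ j, ((p.1.1 j).re ^ 2 + (p.1.1 j).im ^ 2) :=
      Finset.sum_nonneg fun j _ => by positivity
    positivity
  · rw [div_le_iff₀ hP]
    have h1 : (∑ j, ((p.1.1 j).re ^ 2 + (p.1.1 j).im ^ 2)) = bq p - p.2 - 1 := by unfold bq; ring
    rw [h1]; unfold Pq
    nlinarith [sq_nonneg (bq p - 2), sq_nonneg p.1.2]
  · unfold Gam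
    have h : ∀ j : Fin n, LD (eXS n j) (fun p => (psi p : ℂ)) p * LD (eXS n j) (fun p => (psi p : ℂ)) p
      + LD (eYS n j) (fun p => (psi p : ℂ)) p * LD (eYS n j) (fun p => (psi p : ℂ)) p
        = ((4 / Pq p * ((p.1.1 j).re ^ 2 + (p.1.1 j).im ^ 2) : ℝ) : ℂ) := by
      intro j
      rw [(psi_X hp j).1, (psi_Y hp j).1, ← Complex.ofReal_mul, ← Complex.ofReal_mul,
        ← Complex.ofReal_add]
      congr 1
      field_simp
      unfold Pq
      ring
    simp only [h]
    rw [← Complex.ofReal_sum, ← Finset.mul_sum]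
    push_cast
    ring

/-! ### Characterisation of anti-holomorphy -/

/-- The change of coordinates from the Siegel domain. -/
def Th {n : ℕ} (z : Vn n) : Sg n := ((z.1, z.2.re), z.2.im - ∑ j, ‖z.1 j‖ ^ 2)

lemma Th_contDiff {n : ℕ} : ContDiff ℝ (⊤ : ℕ∞) (Th : Vn n → Sg n) := by
  unfold Th
  have : ∀ j : Fin n, ContDiff ℝ (⊤ : ℕ∞) (fun p : Vn n => p.1 j) := fun j =>
    (contDiff_apply ℝ ℂ j).comp contDiff_fst
  refine (contDiff_fst.prodMk (Complex.reCLM.contDiff.comp contDiff_snd)).prodMk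
    ((Complex.imCLM.contDiff.comp contDiff_snd).sub (ContDiff.sum fun j _ => ?_))
  exact (this j).norm_sq ℝ

/-- Direction of the vector field corresponding to `w`. -/
def Tw {n : ℕ} (z w : Vn n) : Sg n :=
  ((w.1, w.2.re - bt z.1 w.1), w.2.im - ∑ j, 2 * ((z.1 j).re * (w.1 j).re + (z.1 j).im * (w.1 j).im))

lemma Th_fderiv {n : ℕ} (z w : Vn n) : fderiv ℝ Th z w = VF (Tw z w) (Th z) := by
  have hd : HasFDerivAt (Th : Vn n → Sg n) (fderiv ℝ Th z) z :=
    ((Th_contDiff (n := n)).differentiable (by simp) z).hasFDerivAt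
  have h1 : HasDerivAt (fun r : ℝ => z + r • w) w 0 := by
    simpa using ((hasDerivAt_id (0:ℝ)).smul_const w).const_add z
  have h2 := HasFDerivAt.comp_hasDerivAt (0:ℝ) (l := Th) (l' := fderiv ℝ Th z)
    (by simpa using hd) h1
  have h3 : (Th ∘ fun r : ℝ => z + r • w) = fun r : ℝ => Th z + r • VF (Tw z w) (Th z)
      - (r ^ 2) • (((0, 0), ∑ j, ‖w.1 j‖ ^ 2) : Sg n) := by
    funext r
    simp only [Function.comp, Th, Tw, VF]
    refine Prod.ext (Prod.ext ?_ ?_) ?_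
    · simp
    · simp
    · simp only [Prod.snd_add, Prod.snd_sub, Prod.smul_snd, Prod.fst_add, Prod.smul_fst]
      simp only [← Complex.normSq_eq_norm_sq, Complex.normSq_apply, smul_eq_mul, mul_sub,
        Finset.mul_sum]
      have : ∑ j, (((z.1 + r • w.1) j).re * ((z.1 + r • w.1) j).re
          + ((z.1 + r • w.1) j).im * ((z.1 + r • w.1) j).im)
          = ∑ j, ((z.1 j).re * (z.1 j).re + (z.1 j).im * (z.1 j).im)
            + ∑ j, r * (2 * ((z.1 j).re * (w.1 j).re + (z.1 j).im * (w.1 j).im))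
            + ∑ j, r ^ 2 * ((w.1 j).re * (w.1 j).re + (w.1 j).im * (w.1 j).im) := by
        rw [← Finset.sum_add_distrib, ← Finset.sum_add_distrib]
        apply Finset.sum_congr rfl
        intro j _
        simp
        ring
      rw [this]
      simp
      ring
  have h4 : HasDerivAt (fun r : ℝ => Th z + r • VF (Tw z w) (Th z)
      - (r ^ 2) • (((0, 0), ∑ j, ‖w.1 j‖ ^ 2) : Sg n)) (VF (Tw z w) (Th z)) 0 := by
    have a := ((hasDerivAt_id (0:ℝ)).smul_const (VF (Tw z w) (Th z))).const_add (Th z)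
    have b := (hasDerivAt_pow 2 (0:ℝ)).smul_const (((0, 0), ∑ j, ‖w.1 j‖ ^ 2) : Sg n)
    simpa using a.fun_sub b
  rw [h3] at h2
  exact h2.unique h4

lemma LD_expand {n : ℕ} (c : Sg n) (F : Sg n → ℂ) (p : Sg n) :
    LD c F p = ∑ j, (((c.1.1 j).re : ℂ) * LD (eXS n j) F p + ((c.1.1 j).im : ℂ) * LD (eYS n j) F p)
      + c.1.2 * LD (eTS n) F p + c.2 * LD (eA n) F p := by
  have h : VF c p = ∑ j, ((c.1.1 j).re • VF (eXS n j) p + (c.1.1 j).im • VF (eYS n j) p)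
      + c.1.2 • VF (eTS n) p + c.2 • VF (eA n) p := by
    simp only [VF_eXS, VF_eYS]
    refine Prod.ext (Prod.ext ?_ ?_) ?_
    · funext i
      simp [VF, eXS, eYS, eX, eY, eTS, eT, eA, Prod.fst_sum, Prod.snd_sum, Finset.sum_apply]
      rw [Finset.sum_add_distrib]
      simp [Complex.re_add_im]
    · simp [VF, eXS, eYS, eX, eY, eTS, eT, eA, Prod.fst_sum, Prod.snd_sum, bt_zero_right]
      rw [add_comm]
      congr 1
      unfold bt
      apply Finset.sum_congr rfl
      intro j _; ring
    · simp [VF, eXS, eYS, eX, eY, eTS, eT, eA, Prod.fst_sum, Prod.snd_sum]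
  unfold LD
  rw [h]
  simp only [map_add, map_sum, map_smul, Complex.real_smul]

lemma Fu_fderiv {n : ℕ} {F : Sg n → ℂ} (hF : Sm F) {z : Vn n} (hz : Th z ∈ Om n) :
    HasFDerivAt (Fu n F) ((fderiv ℝ F (Th z)).comp (fderiv ℝ Th z)) z := by
  have hd : HasFDerivAt (Th : Vn n → Sg n) (fderiv ℝ Th z) z :=
    ((Th_contDiff (n := n)).differentiable (by simp) z).hasFDerivAt
  exact (hF.diffAt hz).hasFDerivAt.comp z hd

lemma cjFu_fderiv {n : ℕ} {F : Sg n → ℂ} (hF : Sm F) {z : Vn n} (hz : Th z ∈ Om n) :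
    HasFDerivAt (fun z => (starRingEnd ℂ) (Fu n F z)) (Complex.conjCLE.toContinuousLinearMap.comp
      ((fderiv ℝ F (Th z)).comp (fderiv ℝ Th z))) z :=
  (Complex.conjCLE.toContinuousLinearMap.hasFDerivAt).comp z (Fu_fderiv hF hz)

lemma cjFu_apply {n : ℕ} {F : Sg n → ℂ} (hF : Sm F) {z : Vn n} (hz : Th z ∈ Om n) (w : Vn n) :
    fderiv ℝ (fun z => (starRingEnd ℂ) (Fu n F z)) z w
      = (starRingEnd ℂ) (LD (Tw z w) F (Th z)) := by
  rw [(cjFu_fderiv hF hz).fderiv]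
  simp only [ContinuousLinearMap.comp_apply, Th_fderiv]
  rfl

lemma Tw_I {n : ℕ} (z w : Vn n) : Tw z (Complex.I • w)
    = ((fun j => Complex.I * w.1 j, -(Tw z w).2), (Tw z w).1.2) := by
  unfold Tw bt
  refine Prod.ext (Prod.ext ?_ ?_) ?_
  · funext j; simp
  · simp
    rw [sub_eq_add_neg, ← Finset.sum_neg_distrib, add_comm]
    congr 1
    apply Finset.sum_congr rfl
    intro j _; ring
  · simp
    apply Finset.sum_congr rfl
    intro j _; ring

lemma antiHolo_iff {n : ℕ} {F : Sg n → ℂ} (hF : Sm F) :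
    IsAntiHolo n F ↔ ∀ p ∈ Om n, (∀ j, LD (eXS n j) F p = Complex.I * LD (eYS n j) F p)
      ∧ LD (eA n) F p = - Complex.I * LD (eTS n) F p := by
  have hUn : ∀ z : Vn n, z ∈ Un n ↔ Th z ∈ Om n := by
    intro z; simp [Un, Om, Th]
  have hopen : IsOpen (Un n) := by
    have : Un n = Th ⁻¹' (Om n) := by ext z; exact hUn z
    rw [this]
    exact (isOpen_Om n).preimage (Th_contDiff (n := n)).continuous
  constructor
  · intro h p hp
    set z : Vn n := (p.1.1, (p.1.2 : ℂ) + (p.2 + ∑ j, ‖p.1.1 j‖ ^ 2 : ℝ) * Complex.I) with hzdef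
    have hz : Th z = p := by
      rw [hzdef]; simp [Th, ← Complex.ofReal_pow, ← Complex.ofReal_sum]
    have hzU : z ∈ Un n := by rw [hUn, hz]; exact hp
    have hzO : Th z ∈ Om n := by rw [hz]; exact hp
    have hd : DifferentiableAt ℂ (fun z => (starRingEnd ℂ) (Fu n F z)) z :=
      (h z hzU).differentiableAt (hopen.mem_nhds hzU)
    have key : ∀ w, (starRingEnd ℂ) (LD (Tw z (Complex.I • w)) F (Th z))
        = Complex.I * (starRingEnd ℂ) (LD (Tw z w) F (Th z)) := by
      intro w
      rw [← cjFu_apply hF hzO, ← cjFu_apply hF hzO, hd.fderiv_restrictScalars ℝ]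
      simp
    have key2 : ∀ w, LD (Tw z w) F p = Complex.I * LD (Tw z (Complex.I • w)) F p := by
      intro w
      have := congrArg (starRingEnd ℂ) (key w)
      rw [hz] at this
      simp only [map_mul, Complex.conj_conj, Complex.conj_I] at this
      rw [this]
      linear_combination (LD (Tw z w) F p) * Complex.I_sq
    constructor
    · intro j
      have hw : ∃ w : Vn n, Tw z w = eXS n j := by
        refine ⟨((eX n j).1, (bt z.1 (eX n j).1 : ℂ) + (∑ i, 2 * ((z.1 i).re * ((eX n j).1 i).re
          + (z.1 i).im * ((eX n j).1 i).im) : ℝ) * Complex.I), ?_⟩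
        simp only [Tw, eXS, Complex.add_re, Complex.add_im, Complex.ofReal_re, Complex.ofReal_im,
          Complex.re_ofReal_mul, Complex.im_ofReal_mul, Complex.I_re, Complex.I_im]
        simp [eX]
      obtain ⟨w, hw⟩ := hw
      have h1 := key2 w
      rw [Tw_I, hw] at h1
      rw [h1]
      congr 2
      have h2 : w.1 = (eX n j).1 := by
        have := congrArg (fun q : Sg n => q.1.1) hw
        simpa [Tw, eXS] using this
      rw [h2]
      simp [eXS, eYS, eX, eY]
    · have hw : Tw z (0, 1) = eTS n := by
        simp [Tw, eTS, eT, bt_zero_right]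
      have h1 := key2 (0, 1)
      rw [Tw_I, hw] at h1
      have h2 : ((fun j => Complex.I * ((0, 1) : Vn n).1 j, -(eTS n).2), (eTS n).1.2) = eA n := by
        simp [eTS, eT, eA]; rfl
      rw [h2] at h1
      rw [h1]
      linear_combination (LD (eA n) F p) * Complex.I_sq
  · intro h z hz
    apply DifferentiableAt.differentiableWithinAt
    have hzO : Th z ∈ Om n := (hUn z).1 hz
    have hI : ∀ w, fderiv ℝ (fun z => (starRingEnd ℂ) (Fu n F z)) z (Complex.I • w)
        = Complex.I * fderiv ℝ (fun z => (starRingEnd ℂ) (Fu n F z)) z w := by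
      intro w
      rw [cjFu_apply hF hzO, cjFu_apply hF hzO, Tw_I]
      have : LD ((fun j => Complex.I * w.1 j, -(Tw z w).2), (Tw z w).1.2) F (Th z)
          = - Complex.I * LD (Tw z w) F (Th z) := by
        rw [LD_expand, LD_expand (Tw z w)]
        simp only [(h _ hzO).1, (h _ hzO).2]
        have e : ∀ j, (((Complex.I * w.1 j).re : ℂ) * (Complex.I * LD (eYS n j) F (Th z))
            + ((Complex.I * w.1 j).im : ℂ) * LD (eYS n j) F (Th z))
            = - Complex.I * ((((Tw z w).1.1 j).re : ℂ) * (Complex.I * LD (eYS n j) F (Th z))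
              + (((Tw z w).1.1 j).im : ℂ) * LD (eYS n j) F (Th z)) := by
          intro j
          simp [Tw]
          linear_combination (w.1 j).re * LD (eYS n j) F (Th z) * Complex.I_sq
        simp only [e, ← Finset.mul_sum]
        push_cast
        linear_combination ( - (Tw z w).2 * LD (eTS n) F (Th z) ) * Complex.I_sq
      rw [this]
      simp
    refine (differentiableAt_iff_restrictScalars ℝ (cjFu_fderiv hF hzO).differentiableAt).2 ?_
    set L := fderiv ℝ (fun z => (starRingEnd ℂ) (Fu n F z)) z with hL
    refine ⟨{ toFun := L, map_add' := L.map_add, map_smul' := ?_, cont := L.continuous }, ?_⟩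
    · intro k w
      have : k • w = k.re • w + k.im • (Complex.I • w) := by
        conv_lhs => rw [← Complex.re_add_im k]
        rw [add_smul, mul_smul]
        simp
      rw [this, map_add, map_smul, map_smul, hI]
      simp only [Complex.real_smul, RingHom.id_apply, smul_eq_mul]
      conv_rhs => rw [← Complex.re_add_im k]
      ring
    · ext w <;> rfl

/-! ### Bernstein type estimates -/

/-- squared modulus as a complex function -/
def nsq {n : ℕ} (f : Sg n → ℂ) (p : Sg n) : ℂ := f p * (starRingEnd ℂ) (f p)

lemma nsq_eq {n : ℕ} (f : Sg n → ℂ) (p : Sg n) : nsq f p = ((‖f p‖ ^ 2 : ℝ) : ℂ) := by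
  unfold nsq; rw [Complex.mul_conj, Complex.normSq_eq_norm_sq]

lemma Sm.nsq {n : ℕ} {f : Sg n → ℂ} (hf : Sm f) : Sm (nsq f) := hf.mul hf.cj

/-- real carré du champ -/
def Gm {n : ℕ} (f : Sg n → ℂ) (p : Sg n) : ℝ :=
  (1/2) * ∑ j, (‖LD (eXS n j) f p‖ ^ 2 + ‖LD (eYS n j) f p‖ ^ 2)

lemma Gm_nonneg {n : ℕ} (f : Sg n → ℂ) (p : Sg n) : 0 ≤ Gm f p := by
  unfold Gm
  have : 0 ≤ ∑ j, (‖LD (eXS n j) f p‖ ^ 2 + ‖LD (eYS n j) f p‖ ^ 2) :=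
    Finset.sum_nonneg fun j _ => by positivity
  linarith

lemma Gam_cj {n : ℕ} {f : Sg n → ℂ} (hf : Sm f) {p : Sg n} (hp : p ∈ Om n) :
    Gam f (fun q => (starRingEnd ℂ) (f q)) p = (Gm f p : ℂ) := by
  unfold Gam Gm
  simp only [LD_cj hf hp, Complex.mul_conj, Complex.normSq_eq_norm_sq]
  push_cast; rfl

lemma Qo_nsq {n : ℕ} {f : Sg n → ℂ} (hf : Sm f) {p : Sg n} (hp : p ∈ Om n) :
    (Qo (nsq f) p).re = 2 * ((starRingEnd ℂ) (f p) * Qo f p).re + Gm f p := by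
  have h := Qo_mul hf hf.cj hp
  rw [Qo_cj hf hp, Gam_cj hf hp] at h
  have h2 : Qo (nsq f) p = _ := h
  rw [h2]
  have h3 : f p * (starRingEnd ℂ) (Qo f p) = (starRingEnd ℂ) ((starRingEnd ℂ) (f p) * Qo f p) := by
    simp
  rw [h3, Complex.add_re, Complex.add_re, Complex.conj_re, Complex.ofReal_re]
  ring

lemma norm_Z_le {n : ℕ} (f : Sg n → ℂ) (p : Sg n) (i : Fin n) : ‖Zo i f p‖ ^ 2 ≤ Gm f p := by
  have h1 : ‖Zo i f p‖ ≤ (1/2) * (‖LD (eXS n i) f p‖ + ‖LD (eYS n i) f p‖) := by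
    unfold Zo
    rw [norm_mul]
    have : ‖(1/2 : ℂ)‖ = 1/2 := by norm_num
    rw [this]
    gcongr
    refine (norm_sub_le _ _).trans ?_
    simp
  have h2 := Finset.single_le_sum (f := fun j => ‖LD (eXS n j) f p‖ ^ 2 + ‖LD (eYS n j) f p‖ ^ 2)
      (fun j _ => by positivity) (Finset.mem_univ i)
  unfold Gm
  have h0 := norm_nonneg (Zo i f p)
  nlinarith [sq_nonneg (‖LD (eXS n i) f p‖ - ‖LD (eYS n i) f p‖)]

lemma real_LD {n : ℕ} {e : Sg n → ℝ} (he : Sm (fun q => (e q : ℂ))) (c : Sg n) {p : Sg n}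
    (hp : p ∈ Om n) : LD c (fun q => (e q : ℂ)) p = (((LD c (fun q => (e q : ℂ)) p).re : ℝ) : ℂ) := by
  have h := LD_cj he hp (c := c)
  simp only [Complex.conj_ofReal] at h
  exact (Complex.conj_eq_iff_re.1 h.symm).symm

lemma LD_nsq {n : ℕ} {f : Sg n → ℂ} (hf : Sm f) (c : Sg n) {p : Sg n} (hp : p ∈ Om n) :
    LD c (nsq f) p = ((2 * ((starRingEnd ℂ) (f p) * LD c f p).re : ℝ) : ℂ) := by
  have h := LD_mul hf hf.cj hp (c := c)
  rw [LD_cj hf hp] at h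
  have h2 : LD c (nsq f) p = _ := h
  rw [h2]
  have h3 : f p * (starRingEnd ℂ) (LD c f p) = (starRingEnd ℂ) ((starRingEnd ℂ) (f p) * LD c f p) := by
    simp
  rw [h3, add_comm, Complex.add_conj]

/-- The basic inequality for cut-offs. -/
lemma Qo_eta {n : ℕ} {e : Sg n → ℝ} (he : Sm (fun q => (e q : ℂ))) {f : Sg n → ℂ} (hf : Sm f)
    {p : Sg n} (hp : p ∈ Om n) {δ : ℝ} (hδ : 0 < δ) {q : ℝ}
    (hq : Qo (fun q => (e q : ℂ)) p = (q : ℂ)) :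
    e p ^ 2 * (2 * ((starRingEnd ℂ) (f p) * Qo f p).re + (1 - δ) * Gm f p)
      - (4 / δ) * ‖f p‖ ^ 2 * Gm (fun q => (e q : ℂ)) p
      + ‖f p‖ ^ 2 * (2 * e p * q + Gm (fun q => (e q : ℂ)) p)
    ≤ (Qo (fun q => ((e q : ℂ) * (e q : ℂ)) * nsq f q) p).re := by
  rw [Qo_mul (he.mul he) hf.nsq hp, Qo_mul he he hp, hq]
  have hG : Gam (fun q => (e q : ℂ)) (fun q => (e q : ℂ)) p = (Gm (fun q => (e q : ℂ)) p : ℂ) := by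
    have := Gam_cj he hp
    simpa only [Complex.conj_ofReal] using this
  rw [hG]
  have hcross : -(δ * e p ^ 2 * Gm f p) - (4 / δ) * ‖f p‖ ^ 2 * Gm (fun q => (e q : ℂ)) p
      ≤ (Gam (fun q => (e q : ℂ) * (e q : ℂ)) (nsq f) p).re := by
    have key : ∀ c : Sg n, -(δ * e p ^ 2 * ‖LD c f p‖ ^ 2)
        - (4 / δ) * ‖f p‖ ^ 2 * ‖LD c (fun q => (e q : ℂ)) p‖ ^ 2
        ≤ (LD c (fun q => (e q : ℂ) * (e q : ℂ)) p * LD c (nsq f) p).re := by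
      intro c
      rw [LD_mul he he hp, LD_nsq hf c hp, real_LD he c hp]
      set x := (LD c (fun q => (e q : ℂ)) p).re
      set y := ((starRingEnd ℂ) (f p) * LD c f p).re
      have hy : |y| ≤ ‖f p‖ * ‖LD c f p‖ := by
        refine (Complex.abs_re_le_norm _).trans ?_
        rw [norm_mul, RCLike.norm_conj]
      have h1 : (((e p : ℂ) * (x : ℂ) + (e p : ℂ) * (x : ℂ)) * ((2 * y : ℝ) : ℂ)).re
          = 4 * (e p * x * y) := by
        rw [← Complex.ofReal_mul, ← Complex.ofReal_add, ← Complex.ofReal_mul, Complex.ofReal_re]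
        ring
      rw [h1, Complex.norm_real, Real.norm_eq_abs, sq_abs]
      have h2 : |e p * x * y| ≤ |e p| * ‖LD c f p‖ * (‖f p‖ * |x|) := by
        rw [abs_mul, abs_mul]
        calc |e p| * |x| * |y| ≤ |e p| * |x| * (‖f p‖ * ‖LD c f p‖) := by gcongr
          _ = _ := by ring
      have h3 := neg_abs_le (e p * x * y)
      have h4 : 4 * ((|e p| * ‖LD c f p‖) * (‖f p‖ * |x|))
          ≤ δ * (|e p| * ‖LD c f p‖) ^ 2 + (4 / δ) * (‖f p‖ * |x|) ^ 2 := by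
        have : 0 ≤ δ * ((|e p| * ‖LD c f p‖) - (2 / δ) * (‖f p‖ * |x|)) ^ 2 := by positivity
        have h5 : δ * ((|e p| * ‖LD c f p‖) - (2 / δ) * (‖f p‖ * |x|)) ^ 2
          = δ * (|e p| * ‖LD c f p‖) ^ 2 + (4 / δ) * (‖f p‖ * |x|) ^ 2
            - 4 * ((|e p| * ‖LD c f p‖) * (‖f p‖ * |x|)) := by
          field_simp; ring
        linarith
      have h6 : δ * (|e p| * ‖LD c f p‖) ^ 2 = δ * e p ^ 2 * ‖LD c f p‖ ^ 2 := by
        rw [mul_pow, sq_abs]; ring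
      have h7 : (4 / δ) * (‖f p‖ * |x|) ^ 2 = 4 / δ * ‖f p‖ ^ 2 * x ^ 2 := by
        rw [mul_pow, sq_abs]; ring
      linarith
    unfold Gam
    have h2 : ((1/2 : ℂ)) = ((1/2 : ℝ) : ℂ) := by push_cast; rfl
    rw [h2, Complex.re_ofReal_mul, Complex.re_sum]
    have hs := Finset.sum_le_sum (s := Finset.univ) fun (j : Fin n) _ =>
      add_le_add (key (eXS n j)) (key (eYS n j))
    simp only [Complex.add_re]
    refine le_trans (le_of_eq ?_) (mul_le_mul_of_nonneg_left hs (by norm_num : (0:ℝ) ≤ 1/2))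
    unfold Gm
    simp only [Finset.mul_sum, ← Finset.sum_add_distrib, ← Finset.sum_neg_distrib,
      ← Finset.sum_sub_distrib]
    apply Finset.sum_congr rfl
    intro j _; ring
  rw [Complex.add_re, Complex.add_re]
  have hr1 : ((e p : ℂ) * (e p : ℂ) * Qo (nsq f) p).re
      = e p ^ 2 * (2 * ((starRingEnd ℂ) (f p) * Qo f p).re + Gm f p) := by
    rw [← Complex.ofReal_mul, Complex.re_ofReal_mul, Qo_nsq hf hp]; ring
  have hr2 : (nsq f p * ((e p : ℂ) * (q : ℂ) + (e p : ℂ) * (q : ℂ)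
      + (Gm (fun q => (e q : ℂ)) p : ℂ))).re
      = ‖f p‖ ^ 2 * (2 * e p * q + Gm (fun q => (e q : ℂ)) p) := by
    rw [nsq_eq, ← Complex.ofReal_mul, ← Complex.ofReal_add, ← Complex.ofReal_add,
      ← Complex.ofReal_mul, Complex.ofReal_re]; ring
  rw [hr1, hr2]
  linarith

/-! ### Functions of `a` alone -/

lemma fa_Sm {n : ℕ} {g : ℝ → ℝ} (hg : ContDiff ℝ (⊤ : ℕ∞) g) :
    Sm (fun p : Sg n => ((g p.2 : ℝ) : ℂ)) :=
  (Complex.ofRealCLM.contDiff.comp (hg.comp contDiff_snd)).contDiffOn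

lemma LD_fa {n : ℕ} {g : ℝ → ℝ} (hg : ContDiff ℝ (⊤ : ℕ∞) g) (c p : Sg n) :
    LD c (fun p : Sg n => ((g p.2 : ℝ) : ℂ)) p = (c.2 * deriv g p.2 : ℝ) := by
  have h1 : HasDerivAt g (deriv g p.2) p.2 := (hg.differentiable (by simp) p.2).hasDerivAt
  have h2 : HasFDerivAt (fun p : Sg n => p.2) (ContinuousLinearMap.snd ℝ (Hn n) ℝ) p :=
    hasFDerivAt_snd
  have h3 := Complex.ofRealCLM.hasFDerivAt.comp p (h1.comp_hasFDerivAt p h2)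
  have h4 : HasFDerivAt (fun p : Sg n => ((g p.2 : ℝ) : ℂ)) _ p := h3
  unfold LD
  rw [h4.fderiv]
  simp [VF]
  ring

lemma LD_fa_zero {n : ℕ} {g : ℝ → ℝ} (hg : ContDiff ℝ (⊤ : ℕ∞) g) (c : Sg n) (hc : c.2 = 0) :
    LD c (fun p : Sg n => ((g p.2 : ℝ) : ℂ)) = fun _ => 0 := by
  funext p; rw [LD_fa hg]; simp [hc]

lemma Qo_fa {n : ℕ} {g : ℝ → ℝ} (hg : ContDiff ℝ (⊤ : ℕ∞) g) (p : Sg n) :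
    Qo (fun p : Sg n => ((g p.2 : ℝ) : ℂ)) p = ((-(n * deriv g p.2) : ℝ) : ℂ) := by
  unfold Qo
  simp only [LD_fa_zero hg (eXS n _) rfl, LD_fa_zero hg (eYS n _) rfl, LD_const, LD_fa hg]
  simp [eA]

lemma Gam_fa {n : ℕ} {g : ℝ → ℝ} (hg : ContDiff ℝ (⊤ : ℕ∞) g) (f : Sg n → ℂ) (p : Sg n) :
    Gam (fun p : Sg n => ((g p.2 : ℝ) : ℂ)) f p = 0 := by
  unfold Gam
  simp [LD_fa_zero hg (eXS n _) rfl, LD_fa_zero hg (eYS n _) rfl]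


/-! ### Slices in the central and vertical variables -/

lemma slice_hasDerivAt {n : ℕ} {V : Sg n → ℂ} (hV : Sm V)
    (hD : ∀ p ∈ Om n, LD (eA n) V p = -Complex.I * LD (eTS n) V p) (ζ : Fin n → ℂ) {z : ℂ}
    (hz : 0 < z.im) :
    HasDerivAt (fun z : ℂ => (starRingEnd ℂ) (V ((ζ, z.re), z.im)))
      ((starRingEnd ℂ) (LD (eTS n) V ((ζ, z.re), z.im))) z := by
  have hp : (((ζ, z.re), z.im) : Sg n) ∈ Om n := hz
  have h1 : HasFDerivAt (fun z : ℂ => (((ζ, z.re), z.im) : Sg n))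
      (((0 : ℂ →L[ℝ] (Fin n → ℂ)).prod Complex.reCLM).prod Complex.imCLM) z := by
    have h2 : HasFDerivAt (fun z : ℂ => (((0 : ℂ →L[ℝ] (Fin n → ℂ)).prod Complex.reCLM).prod Complex.imCLM) z
        + (((ζ, 0), 0) : Sg n)) (((0 : ℂ →L[ℝ] (Fin n → ℂ)).prod Complex.reCLM).prod Complex.imCLM) z :=
      (ContinuousLinearMap.hasFDerivAt _).add_const _
    convert h2 using 2 with w
    simp
  have h3 : HasFDerivAt (fun z : ℂ => (starRingEnd ℂ) (V ((ζ, z.re), z.im))) _ z :=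
    Complex.conjCLE.toContinuousLinearMap.hasFDerivAt.comp z
      ((hV.diffAt hp).hasFDerivAt.comp z h1)
  have hT : fderiv ℝ V ((ζ, z.re), z.im) ((0, 1), 0) = LD (eTS n) V ((ζ, z.re), z.im) := by
    simp [LD, VF, eTS, eT, bt_zero_right]
  have hA : fderiv ℝ V ((ζ, z.re), z.im) ((0, 0), 1) = LD (eA n) V ((ζ, z.re), z.im) := by
    simp [LD, VF, eA, bt_zero_right]
  have h4 := HasFDerivWithinAt.complexOfReal (hasFDerivWithinAt_univ.2 h3) (by
    simp [hT, hA, hD _ hp])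
  have h5 := (hasFDerivWithinAt_univ.1 h4).hasDerivAt
  rw [← hT]
  exact h5

lemma cauchy_A {n : ℕ} {V : Sg n → ℂ} (hV : Sm V)
    (hD : ∀ p ∈ Om n, LD (eA n) V p = -Complex.I * LD (eTS n) V p) {k : ℕ} {C : ℝ}
    (hb : ∀ p ∈ Om n, ‖V p‖ ^ 2 * p.2 ^ k ≤ C) :
    ∀ p ∈ Om n, ‖LD (eA n) V p‖ ^ 2 * p.2 ^ (k + 2) ≤ C * (4 * 2 ^ k) := by
  intro p hp
  have ha : 0 < p.2 := hp
  have hC : 0 ≤ C := le_trans (by positivity) (hb p hp)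
  set z0 : ℂ := ⟨p.1.2, p.2⟩ with hz0
  set B := Real.sqrt (C * 2 ^ k / p.2 ^ k) with hB
  have him : ∀ z ∈ Metric.closedBall z0 (p.2 / 2), p.2 / 2 ≤ z.im := by
    intro z hz
    rw [mem_closedBall_iff_norm] at hz
    have h1 := (Complex.abs_im_le_norm (z - z0)).trans hz
    rw [abs_le] at h1
    simp [hz0] at h1
    linarith
  have h := Complex.norm_deriv_le_of_forall_mem_sphere_norm_le (c := z0) (R := p.2 / 2) (C := B)
    (f := fun z : ℂ => (starRingEnd ℂ) (V ((p.1.1, z.re), z.im))) (by positivity)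
    (by
      refine DifferentiableOn.diffContOnCl_ball (U := Metric.closedBall z0 (p.2/2)) ?_ subset_rfl
      intro z hz
      exact (slice_hasDerivAt hV hD p.1.1 (by linarith [him z hz])).differentiableAt.differentiableWithinAt)
    (by
      intro z hz
      have hzi := him z (Metric.sphere_subset_closedBall hz)
      have hz0' : 0 < z.im := by linarith
      have h1 := hb ((p.1.1, z.re), z.im) hz0'
      rw [RCLike.norm_conj]
      apply Real.le_sqrt_of_sq_le
      rw [le_div_iff₀ (by positivity)]
      have h2 : p.2 ^ k ≤ z.im ^ k * 2 ^ k := by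
        rw [← mul_pow]; gcongr; linarith
      have h3 : ‖V ((p.1.1, z.re), z.im)‖ ^ 2 * z.im ^ k ≤ C := h1
      calc ‖V ((p.1.1, z.re), z.im)‖ ^ 2 * p.2 ^ k
          ≤ ‖V ((p.1.1, z.re), z.im)‖ ^ 2 * (z.im ^ k * 2 ^ k) := by gcongr
        _ = (‖V ((p.1.1, z.re), z.im)‖ ^ 2 * z.im ^ k) * 2 ^ k := by ring
        _ ≤ _ := by gcongr)
  rw [(slice_hasDerivAt hV hD p.1.1 (z := z0) ha).deriv, RCLike.norm_conj] at h
  have e : (((p.1.1, z0.re), z0.im) : Sg n) = p := by simp [hz0]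
  rw [e] at h
  rw [hD p hp, norm_mul, norm_neg, Complex.norm_I, one_mul]
  have hBs : B ^ 2 = C * 2 ^ k / p.2 ^ k := Real.sq_sqrt (by positivity)
  calc ‖LD (eTS n) V p‖ ^ 2 * p.2 ^ (k + 2) ≤ (B / (p.2 / 2)) ^ 2 * p.2 ^ (k + 2) := by gcongr
    _ = B ^ 2 * 4 * p.2 ^ k := by field_simp; ring
    _ = _ := by rw [hBs]; field_simp

/-- The class of functions used in the Liouville argument. -/
structure KK {n : ℕ} (k : ℕ) (C : ℝ) (V : Sg n → ℂ) : Prop where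
  sm : Sm V
  hD : ∀ p ∈ Om n, LD (eA n) V p = -Complex.I * LD (eTS n) V p
  hQ : ∀ p ∈ Om n, Qo V p = -(2 * k : ℝ) * LD (eA n) V p
  hb : ∀ p ∈ Om n, ‖V p‖ ^ 2 * p.2 ^ k ≤ C

lemma LD_A_Zo {n : ℕ} {V : Sg n → ℂ} (hV : Sm V) (i : Fin n) {p : Sg n} (hp : p ∈ Om n) :
    LD (eA n) (Zo i V) p = Zo i (LD (eA n) V) p := by
  rw [LD_Zo hV hp, LD_comm_A hV hp, LD_comm_A hV hp]; rfl

lemma LD_T_Zo {n : ℕ} {V : Sg n → ℂ} (hV : Sm V) (i : Fin n) {p : Sg n} (hp : p ∈ Om n) :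
    LD (eTS n) (Zo i V) p = Zo i (LD (eTS n) V) p := by
  rw [LD_Zo hV hp, LD_comm_T hV hp, LD_comm_T hV hp]; rfl

lemma Qo_A {n : ℕ} {V : Sg n → ℂ} (hV : Sm V) {p : Sg n} (hp : p ∈ Om n) :
    Qo (LD (eA n) V) p = LD (eA n) (Qo V) p := by
  rw [LD_Qo hV hp]
  unfold Qo
  have h : ∀ c : Sg n, LD c (LD c (LD (eA n) V)) p = LD (eA n) (LD c (LD c V)) p := by
    intro c
    rw [LD_comm2 hV hp]; simp [eA, bt_zero_right]
  simp only [h]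

lemma KK_A_D {n k : ℕ} {C : ℝ} {V : Sg n → ℂ} (h : KK k C V) :
    ∀ p ∈ Om n, LD (eA n) (LD (eA n) V) p = -Complex.I * LD (eTS n) (LD (eA n) V) p := by
  intro p hp
  rw [LD_congr h.hD hp, LD_cmul _ (h.sm.LD _) hp, LD_comm_A h.sm hp]

lemma KK_A_Q {n k : ℕ} {C : ℝ} {V : Sg n → ℂ} (h : KK k C V) :
    ∀ p ∈ Om n, Qo (LD (eA n) V) p = -(2 * k : ℝ) * LD (eA n) (LD (eA n) V) p := by
  intro p hp
  rw [Qo_A h.sm hp, LD_congr h.hQ hp, LD_cmul _ (h.sm.LD _) hp]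

lemma KK_Z_D {n k : ℕ} {C : ℝ} {V : Sg n → ℂ} (h : KK k C V) (i : Fin n) :
    ∀ p ∈ Om n, LD (eA n) (Zo i V) p = -Complex.I * LD (eTS n) (Zo i V) p := by
  intro p hp
  rw [LD_A_Zo h.sm i hp, LD_T_Zo h.sm i hp, Zo_congr h.hD i hp, Zo_cmul _ (h.sm.LD _) i hp]

lemma KK_Z_Q {n k : ℕ} {C : ℝ} {V : Sg n → ℂ} (h : KK k C V) (i : Fin n) :
    ∀ p ∈ Om n, Qo (Zo i V) p = -(2 * (k + 1 : ℕ) : ℝ) * LD (eA n) (Zo i V) p := by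
  intro p hp
  rw [Qo_Z h.sm hp, Zo_congr h.hQ i hp, Zo_cmul _ (h.sm.LD _) i hp, ← LD_A_Zo h.sm i hp]
  have : 2 * Complex.I * LD (eTS n) (Zo i V) p = -2 * LD (eA n) (Zo i V) p := by
    rw [KK_Z_D h i p hp]; ring
  rw [this]; push_cast; ring


/-! ### The Bernstein estimate for `Z_i V` -/

lemma Gm_psi {n : ℕ} {p : Sg n} (hp : p ∈ Om n) : Gm (fun p : Sg n => (psi p : ℂ)) p ≤ 1 / 2 := by
  obtain ⟨g, h0, h1, h2⟩ := Gam_psi hp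
  have h := Gam_cj (psi_Sm (n := n)) hp
  simp only [Complex.conj_ofReal] at h
  rw [h2] at h
  have := Complex.ofReal_injective h
  linarith

/-- The vertical cut-off. -/
def thet (A a : ℝ) : ℝ := (a - A) * (3 * A - a) / A ^ 2

lemma thet_contDiff (A : ℝ) : ContDiff ℝ (⊤ : ℕ∞) (thet A) := by
  unfold thet; fun_prop

lemma thet_deriv (A a : ℝ) : deriv (thet A) a = (4 * A - 2 * a) / A ^ 2 := by
  have h : HasDerivAt (thet A) ((1 * (3 * A - a) + (a - A) * (-1)) / A ^ 2) a := by
    unfold thet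
    exact (((hasDerivAt_id a).sub_const A).mul ((hasDerivAt_id a).const_sub (3 * A))).div_const _
  rw [h.deriv]; ring

/-- The full cut-off. -/
def etac {n : ℕ} (A ε : ℝ) (p : Sg n) : ℝ := thet A p.2 * (1 - ε * psi p)

lemma etac_eq {n : ℕ} (A ε : ℝ) : (fun p : Sg n => (etac A ε p : ℂ))
    = fun p => ((thet A p.2 : ℝ) : ℂ) * ((1:ℂ) - (ε : ℂ) * (psi p : ℂ)) := by
  funext p; unfold etac; push_cast; rfl

lemma ompsi_Sm {n : ℕ} (ε : ℝ) : Sm (fun p : Sg n => (1:ℂ) - (ε : ℂ) * (psi p : ℂ)) :=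
  (Sm.const 1).sub (psi_Sm.cmul _)

lemma etac_Sm {n : ℕ} (A ε : ℝ) : Sm (fun p : Sg n => (etac A ε p : ℂ)) := by
  rw [etac_eq]
  exact (fa_Sm (thet_contDiff A)).mul (ompsi_Sm ε)

lemma Qo_etac {n : ℕ} (A ε : ℝ) {p : Sg n} (hp : p ∈ Om n) :
    Qo (fun p : Sg n => (etac A ε p : ℂ)) p
      = ((-(n * ((4 * A - 2 * p.2) / A ^ 2)) * (1 - ε * psi p) : ℝ) : ℂ) := by
  rw [etac_eq, Qo_mul (fa_Sm (thet_contDiff A)) (ompsi_Sm ε) hp, Gam_fa (thet_contDiff A),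
    Qo_fa (thet_contDiff A), Qo_sub (Sm.const 1) (psi_Sm.cmul _) hp, Qo_const,
    Qo_cmul _ psi_Sm hp, Qo_psi hp, thet_deriv]
  push_cast; ring

lemma Gm_etac {n : ℕ} (A ε : ℝ) {p : Sg n} (hp : p ∈ Om n) :
    Gm (fun p : Sg n => (etac A ε p : ℂ)) p ≤ thet A p.2 ^ 2 * ε ^ 2 * (1 / 2) := by
  have h : ∀ c : Sg n, c.2 = 0 → ‖LD c (fun p : Sg n => (etac A ε p : ℂ)) p‖ ^ 2
      = thet A p.2 ^ 2 * ε ^ 2 * ‖LD c (fun p : Sg n => (psi p : ℂ)) p‖ ^ 2 := by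
    intro c hc
    rw [etac_eq, LD_mul (fa_Sm (thet_contDiff A)) (ompsi_Sm ε) hp, LD_fa_zero (thet_contDiff A) c hc,
      LD_sub (Sm.const 1) (psi_Sm.cmul _) hp, LD_const, LD_cmul _ psi_Sm hp]
    simp only [mul_zero, add_zero, zero_sub, norm_mul, norm_neg, Complex.norm_real, mul_pow,
      Real.norm_eq_abs, sq_abs]
    ring
  have h2 := Gm_psi hp
  have h3 : Gm (fun p : Sg n => (etac A ε p : ℂ)) p
      = thet A p.2 ^ 2 * ε ^ 2 * Gm (fun p : Sg n => (psi p : ℂ)) p := by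
    unfold Gm
    simp only [h (eXS n _) rfl, h (eYS n _) rfl, ← mul_add, ← Finset.mul_sum]
    ring
  rw [h3]
  gcongr

lemma re_conj_mul_ge (x y : ℂ) (r : ℝ) (hr : 0 ≤ r) :
    -(2 * (2 * r) * (‖x‖ * ‖y‖)) ≤ 2 * ((starRingEnd ℂ) x * (-((2 * r : ℝ) : ℂ) * y)).re := by
  have h := Complex.abs_re_le_norm ((starRingEnd ℂ) x * (-((2 * r : ℝ) : ℂ) * y))
  rw [norm_mul, norm_mul, norm_neg, RCLike.norm_conj, Complex.norm_real, Real.norm_eq_abs,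
    abs_of_nonneg (by positivity : 0 ≤ 2 * r)] at h
  have := (abs_le.1 h).1
  nlinarith

set_option maxHeartbeats 1000000 in
lemma bern_alg {k n A y B e q g v w K K' V GK GV Sv SK SV QV1 QK1 QVV C1 C2 : ℝ}
    (hk : 0 ≤ k) (hn : 1 ≤ n) (hA : 0 < A) (hy : 0 < y) (hB : 0 ≤ B)
    (he0 : 0 ≤ e) (he1 : e ≤ 1) (hq : |q| ≤ 2 * n / A) (hg0 : 0 ≤ g) (hg : g ≤ 1 / (2 * A))
    (hv : 0 ≤ v) (hw : 0 ≤ w) (hwG : w ^ 2 ≤ GK)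
    (hvG : v ^ 2 ≤ GV) (hV : V ^ 2 ≤ B * A * y) (hK : K ^ 2 * A ≤ B * y)
    (hK' : K' ^ 2 * A ^ 3 ≤ B * y)
    (hSv : -(2 * (2 * (k + 1)) * (v * w)) ≤ Sv) (hSK : -(2 * (2 * k) * (K * K')) ≤ SK)
    (hSV : -(2 * (2 * k) * (V * K)) ≤ SV)
    (h1 : e ^ 2 * (Sv + (1 - 1) * (0:ℝ)) - (4 / 1) * v ^ 2 * g + v ^ 2 * (2 * e * q + g) ≤ QV1)
    (h2 : e ^ 2 * (SK + (1 - 1 / 2) * GK) - (4 / (1/2)) * K ^ 2 * g + K ^ 2 * (2 * e * q + g) ≤ QK1)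
    (h3 : SV + GV ≤ QVV)
    (hC1 : C1 = 8 * (k + 1) ^ 2 + 4 * n + 3)
    (hC2 : C2 = ((4 + 4 * n) + 4 * k + 4 * k * C1) * B + 1) :
    0 < A * QV1 + A ^ 2 * QK1 + C1 * QVV + n * (C2 * y) := by
  have hC1p : 0 < C1 := by rw [hC1]; positivity
  have he2 : 0 ≤ e ^ 2 := by positivity
  have he21 : e ^ 2 ≤ 1 := by nlinarith
  -- q terms
  have heq : -(4 * n / A) ≤ 2 * e * q := by
    have h : |2 * e * q| ≤ 4 * n / A := by
      rw [abs_mul, abs_of_nonneg (by positivity : 0 ≤ 2 * e)]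
      calc 2 * e * |q| ≤ 2 * 1 * (2 * n / A) := by gcongr
        _ = _ := by ring
    exact (abs_le.1 h).1
  have hgA : g * A ≤ 1 / 2 := by
    calc g * A ≤ 1 / (2 * A) * A := by gcongr
      _ = 1 / 2 := by field_simp
  have heqA : -(4 * n) ≤ 2 * e * q * A := by
    calc -(4 * n) = -(4 * n / A) * A := by field_simp
      _ ≤ _ := by gcongr
  -- first
  have a1 : A * (e ^ 2 * Sv) ≥ -(e ^ 2 * A ^ 2 * (1/2) * GK) - 8 * (k + 1) ^ 2 * v ^ 2 := by
    have i1 : A * (e ^ 2 * Sv) ≥ -(e ^ 2 * (4 * (k + 1) * v * (A * w))) := by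
      have := mul_le_mul_of_nonneg_left hSv (by positivity : 0 ≤ A * e ^ 2)
      linarith
    have i2 : 4 * (k + 1) * v * (A * w) ≤ 8 * (k+1)^2 * v^2 + (1/2) * (A * w) ^ 2 := by
      linarith [sq_nonneg (4 * (k + 1) * v - A * w)]
    have i3 : (A * w) ^ 2 ≤ A ^ 2 * GK := by rw [mul_pow]; gcongr
    have i4 : e ^ 2 * (4 * (k + 1) * v * (A * w)) ≤ e ^ 2 * (8 * (k+1)^2 * v^2 + (1/2) * (A ^ 2 * GK)) := by
      gcongr; linarith
    have i5 : e ^ 2 * (8 * (k+1)^2 * v^2) ≤ 1 * (8 * (k+1)^2 * v^2) := by gcongr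
    linarith
  have a2 : A * (-(4 / 1) * v ^ 2 * g + v ^ 2 * (2 * e * q + g)) ≥ -(2 + 4 * n) * v ^ 2 := by
    have : A * (-(4 / 1) * v ^ 2 * g + v ^ 2 * (2 * e * q + g))
       = v ^ 2 * (-4 * (g * A) + 2 * e * q * A + g * A) := by ring
    rw [this]
    have hgA0 : 0 ≤ g * A := by positivity
    have : v ^ 2 * (-4 * (g * A) + 2 * e * q * A + g * A) ≥ v ^ 2 * (-(2 + 4 * n)) := by
      apply mul_le_mul_of_nonneg_left _ (by positivity); linarith
    linarith
  have a3 : A ^ 2 * (-(4 / (1/2)) * K ^ 2 * g + K ^ 2 * (2 * e * q + g)) ≥ -(4 + 4 * n) * (B * y) := by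
    have : A ^ 2 * (-(4 / (1/2)) * K ^ 2 * g + K ^ 2 * (2 * e * q + g))
       = (K ^ 2 * A) * (-8 * (g * A) + 2 * e * q * A + g * A) := by ring
    rw [this]
    have hgA0 : 0 ≤ g * A := by positivity
    have i : (K ^ 2 * A) * (-8 * (g * A) + 2 * e * q * A + g * A) ≥ (K ^ 2 * A) * (-(4 + 4 * n)) := by
      apply mul_le_mul_of_nonneg_left _ (by positivity); linarith
    have : (K ^ 2 * A) * (4 + 4 * n) ≤ (B * y) * (4 + 4 * n) := by gcongr
    linarith
  have a4 : A ^ 2 * (e ^ 2 * SK) ≥ -(4 * k * (B * y)) := by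
    have i1 : A ^ 2 * (e ^ 2 * SK) ≥ -(e ^ 2 * (2 * k * (2 * (A ^ 2 * (K * K'))))) := by
      have := mul_le_mul_of_nonneg_left hSK (by positivity : 0 ≤ A ^ 2 * e ^ 2)
      linarith
    have i2 : 2 * (A ^ 2 * (K * K')) ≤ K ^ 2 * A + K' ^ 2 * A ^ 3 := by
      linarith [mul_nonneg hA.le (sq_nonneg (K - A * K'))]
    have i3 : e ^ 2 * (2 * k * (2 * (A ^ 2 * (K * K')))) ≤ e ^ 2 * (2 * k * (2 * (B * y))) := by
      gcongr e ^ 2 * (2 * k * ?_); linarith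
    have i4 : e ^ 2 * (2 * k * (2 * (B * y))) ≤ 1 * (2 * k * (2 * (B * y))) := by gcongr
    linarith
  have a5 : SV ≥ -(4 * k * (B * y)) := by
    have i2 : 2 * (V * K) ≤ 2 * (B * y) := by
      have j : 2 * (V * K) * A ≤ 2 * (B * y) * A := by
        linarith [sq_nonneg (V - A * K), mul_le_mul_of_nonneg_right hK hA.le]
      exact le_of_mul_le_mul_right j hA
    have := mul_le_mul_of_nonneg_left i2 (by positivity : 0 ≤ 2 * k)
    linarith
  have b1 := mul_le_mul_of_nonneg_left h1 hA.le
  have b2 := mul_le_mul_of_nonneg_left h2 (by positivity : 0 ≤ A ^ 2)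
  have b3 := mul_le_mul_of_nonneg_left h3 hC1p.le
  have b4 : C1 * (-(4 * k * (B * y)) + v ^ 2) ≤ C1 * (SV + GV) := by gcongr
  have b5 : C2 * y ≤ n * (C2 * y) := by
    have : 0 ≤ C2 * y := by rw [hC2]; positivity
    have := mul_le_mul_of_nonneg_right hn this
    linarith
  have b6 : C2 * y = ((4 + 4 * n) + 4 * k + 4 * k * C1) * (B * y) + y := by rw [hC2]; ring
  have b7 : C1 * v ^ 2 = 8 * (k+1)^2 * v^2 + (4 * n + 3) * v ^ 2 := by rw [hC1]; ring
  have : 0 ≤ v ^ 2 := by positivity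
  linarith


/-- A compact slab. -/
def slab (n : ℕ) (a1 a2 R : ℝ) : Set (Sg n) := {p | a1 ≤ p.2 ∧ p.2 ≤ a2 ∧ psi p ≤ R}

lemma psi_contOn {n : ℕ} : ContinuousOn (psi : Sg n → ℝ) (Om n) := by
  have h := (psi_Sm (n := n)).continuousOn
  have := Complex.continuous_re.comp_continuousOn h
  exact this

lemma slab_sub {n : ℕ} {a1 a2 R : ℝ} (h1 : 0 < a1) : slab n a1 a2 R ⊆ Om n := by
  intro p hp; exact lt_of_lt_of_le h1 hp.1

lemma slab_compact {n : ℕ} {a1 a2 R : ℝ} (h1 : 0 < a1) : IsCompact (slab n a1 a2 R) := by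
  have hc : IsClosed ({p : Sg n | a1 ≤ p.2 ∧ p.2 ≤ a2}) :=
    (isClosed_le continuous_const continuous_snd).inter (isClosed_le continuous_snd continuous_const)
  have hcl : IsClosed (slab n a1 a2 R) := by
    have := (psi_contOn (n := n)).mono (s := Om n) (t := {p : Sg n | a1 ≤ p.2 ∧ p.2 ≤ a2})
      (fun p hp => lt_of_lt_of_le h1 hp.1)
    have := this.preimage_isClosed_of_isClosed hc (isClosed_Iic (a := R))
    convert this using 1
    ext p; simp [slab, and_assoc]
  refine Metric.isCompact_of_isClosed_isBounded hcl ?_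
  refine (isBounded_iff_forall_norm_le).2 ⟨Real.exp R, fun p hp => ?_⟩
  exact (norm_le_exp_psi (slab_sub h1 hp).le).trans (Real.exp_le_exp.2 hp.2.2)

lemma slab_nhds {n : ℕ} {a1 a2 R : ℝ} (h1 : 0 < a1) {p : Sg n} (ha : a1 < p.2) (hb : p.2 < a2)
    (hR : psi p < R) : slab n a1 a2 R ∈ 𝓝 p := by
  have hp : p ∈ Om n := h1.trans ha
  have h3 := (psi_contOn.continuousAt (Om_nhds hp)).eventually (gt_mem_nhds hR)
  have h4 := (continuous_snd (X := Hn n) (Y := ℝ)).continuousAt.eventually (lt_mem_nhds ha)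
  have h5 := (continuous_snd (X := Hn n) (Y := ℝ)).continuousAt.eventually (gt_mem_nhds hb)
  filter_upwards [h3, h4, h5] with q q1 q2 q3
  exact ⟨q2.le, q3.le, q1.le⟩

lemma lin_contDiff (c : ℝ) : ContDiff ℝ (⊤ : ℕ∞) (fun a : ℝ => c * a) := by fun_prop

lemma lin_deriv (c a : ℝ) : deriv (fun a : ℝ => c * a) a = c := by
  have h := (hasDerivAt_id a).const_mul c
  have h' : HasDerivAt (fun a : ℝ => c * a) (c * 1) a := h
  rw [h'.deriv, mul_one]

lemma thet_bd {A a : ℝ} (hA : 0 < A) (h1 : A ≤ a) (h2 : a ≤ 3 * A) :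
    0 ≤ thet A a ∧ thet A a ≤ 1 := by
  unfold thet
  constructor
  · have := mul_nonneg (sub_nonneg.2 h1) (sub_nonneg.2 h2); positivity
  · rw [div_le_one (by positivity)]; nlinarith [sq_nonneg (a - 2 * A)]

lemma bern_step {n : ℕ} (hn : 1 ≤ n) {k : ℕ} {C B : ℝ} {V : Sg n → ℂ} (h : KK k C V) (i : Fin n)
    (hB0 : 0 ≤ B)
    (hBV : ∀ p ∈ Om n, ‖V p‖ ^ 2 * p.2 ^ k ≤ B)
    (hBK : ∀ p ∈ Om n, ‖LD (eA n) V p‖ ^ 2 * p.2 ^ (k + 2) ≤ B)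
    (hBK' : ∀ p ∈ Om n, ‖LD (eA n) (LD (eA n) V) p‖ ^ 2 * p.2 ^ (k + 4) ≤ B)
    {A ε C1 C2 : ℝ} (hA : 0 < A) (hε : 0 < ε) (hεA : ε ^ 2 ≤ 1 / A)
    (hC1 : C1 = 8 * ((k:ℝ) + 1) ^ 2 + 4 * n + 3)
    (hC2 : C2 = ((4 + 4 * (n:ℝ)) + 4 * k + 4 * k * C1) * B + 1)
    {p0 : Sg n} (hp0 : p0.2 = 2 * A) (hp0' : ε * psi p0 ≤ 1) :
    (1 - ε * psi p0) ^ 2 * ‖Zo i V p0‖ ^ 2 ≤ (C1 * B + 2 * C2) * (A ^ (k + 1))⁻¹ := by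
  set y := (A ^ (k + 1))⁻¹ with hy
  have hyp : 0 < y := by positivity
  have hyA : y * A ^ (k + 1) = 1 := by rw [hy]; field_simp
  have hC1p : 0 < C1 := by rw [hC1]; positivity
  have hC2p : 0 < C2 := by rw [hC2]; positivity
  have hn1 : (1:ℝ) ≤ n := by exact_mod_cast hn
  set S := slab n A (3 * A) (1 / ε) with hS
  have hSO : S ⊆ Om n := slab_sub hA
  have bV : ∀ p ∈ S, ‖V p‖ ^ 2 ≤ B * A * y := by
    intro p hp
    have h1 : ‖V p‖ ^ 2 * A ^ k ≤ B := le_trans (by gcongr; exact hp.1) (hBV p (hSO hp))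
    calc ‖V p‖ ^ 2 = ‖V p‖ ^ 2 * (y * A ^ (k + 1)) := by rw [hyA, mul_one]
      _ = (‖V p‖ ^ 2 * A ^ k) * (A * y) := by ring
      _ ≤ B * (A * y) := by gcongr
      _ = _ := by ring
  have bK : ∀ p ∈ S, ‖LD (eA n) V p‖ ^ 2 * A ≤ B * y := by
    intro p hp
    have h1 : ‖LD (eA n) V p‖ ^ 2 * A ^ (k + 2) ≤ B :=
      le_trans (by gcongr; exact hp.1) (hBK p (hSO hp))
    calc ‖LD (eA n) V p‖ ^ 2 * A = ‖LD (eA n) V p‖ ^ 2 * A * (y * A ^ (k + 1)) := by rw [hyA, mul_one]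
      _ = (‖LD (eA n) V p‖ ^ 2 * A ^ (k + 2)) * y := by ring
      _ ≤ B * y := by gcongr
  have bK' : ∀ p ∈ S, ‖LD (eA n) (LD (eA n) V) p‖ ^ 2 * A ^ 3 ≤ B * y := by
    intro p hp
    have h1 : ‖LD (eA n) (LD (eA n) V) p‖ ^ 2 * A ^ (k + 4) ≤ B :=
      le_trans (by gcongr; exact hp.1) (hBK' p (hSO hp))
    calc ‖LD (eA n) (LD (eA n) V) p‖ ^ 2 * A ^ 3
        = ‖LD (eA n) (LD (eA n) V) p‖ ^ 2 * A ^ 3 * (y * A ^ (k + 1)) := by rw [hyA, mul_one]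
      _ = (‖LD (eA n) (LD (eA n) V) p‖ ^ 2 * A ^ (k + 4)) * y := by ring
      _ ≤ B * y := by gcongr
  have hv : Sm (Zo i V) := h.sm.Zo i
  have hKs : Sm (LD (eA n) V) := h.sm.LD _
  have he : Sm (fun q : Sg n => (etac A ε q : ℂ)) := etac_Sm A ε
  have hE1 : Sm (fun q : Sg n => ((etac A ε q : ℂ) * (etac A ε q : ℂ)) * nsq (Zo i V) q) :=
    (he.mul he).mul hv.nsq
  have hE2 : Sm (fun q : Sg n => ((etac A ε q : ℂ) * (etac A ε q : ℂ)) * nsq (LD (eA n) V) q) :=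
    (he.mul he).mul hKs.nsq
  have hfa : Sm (fun q : Sg n => ((-(C2 * y) * q.2 : ℝ) : ℂ)) := fa_Sm (lin_contDiff _)
  set Φ : Sg n → ℂ := fun q => ((A : ℂ) * (((etac A ε q : ℂ) * (etac A ε q : ℂ)) * nsq (Zo i V) q)
    + ((A ^ 2 : ℝ) : ℂ) * (((etac A ε q : ℂ) * (etac A ε q : ℂ)) * nsq (LD (eA n) V) q))
    + ((C1 : ℂ) * nsq V q + ((-(C2 * y) * q.2 : ℝ) : ℂ)) with hΦ
  have hΦs : Sm Φ := ((hE1.cmul _).add (hE2.cmul _)).add ((h.sm.nsq.cmul _).add hfa)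
  have hΦre : ∀ q, (Φ q).re = A * (etac A ε q ^ 2 * ‖Zo i V q‖ ^ 2)
      + A ^ 2 * (etac A ε q ^ 2 * ‖LD (eA n) V q‖ ^ 2) + (C1 * ‖V q‖ ^ 2 - C2 * y * q.2) := by
    intro q
    have : Φ q = ((A * (etac A ε q ^ 2 * ‖Zo i V q‖ ^ 2)
      + A ^ 2 * (etac A ε q ^ 2 * ‖LD (eA n) V q‖ ^ 2) + (C1 * ‖V q‖ ^ 2 - C2 * y * q.2) : ℝ) : ℂ) := by
      simp only [hΦ, nsq_eq]; push_cast; ring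
    rw [this, Complex.ofReal_re]
  have hmain := compact_max (slab_compact (n := n) (a1 := A) (a2 := 3 * A) (R := 1 / ε) hA)
    (u := fun q => (Φ q).re) (m := C1 * B * A * y)
    (Complex.continuous_re.comp_continuousOn (hΦs.continuousOn.mono hSO)) (by
    intro p hp hm
    have hpO := hSO hp
    have hpp : 0 < p.2 := hpO
    have heps : ε * psi p ≤ 1 := by
      have := hp.2.2; rw [le_div_iff₀ hε] at this; linarith
    have hpsi := psi_nonneg hpp.le
    have heps0 : 0 ≤ ε * psi p := by positivity
    obtain ⟨ht0, ht1⟩ := thet_bd hA hp.1 hp.2.1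
    -- eta is nonzero
    have hne : etac A ε p ≠ 0 := by
      intro h0
      simp only [hΦre, h0] at hm
      have h1 : C1 * ‖V p‖ ^ 2 ≤ C1 * (B * A * y) := by gcongr; exact bV p hp
      have h2 : 0 ≤ C2 * y * p.2 := by positivity
      nlinarith
    constructor
    · apply slab_nhds hA
      · refine lt_of_le_of_ne hp.1 fun h0 => hne ?_
        simp [etac, thet, ← h0]
      · refine lt_of_le_of_ne hp.2.1 fun h0 => hne ?_
        simp [etac, thet, h0]
      · refine lt_of_le_of_ne hp.2.2 fun h0 => hne ?_
        simp [etac, h0, hε.ne']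
    · intro hloc
      have hQ := localMax_Qo hΦs hpO hloc
      have hQe : Qo Φ p = ((A : ℂ) * Qo (fun q : Sg n => ((etac A ε q : ℂ) * (etac A ε q : ℂ)) * nsq (Zo i V) q) p
          + ((A ^ 2 : ℝ) : ℂ) * Qo (fun q : Sg n => ((etac A ε q : ℂ) * (etac A ε q : ℂ)) * nsq (LD (eA n) V) q) p)
          + ((C1 : ℂ) * Qo (nsq V) p + ((-(n * -(C2 * y)) : ℝ) : ℂ)) := by
        simp only [hΦ]
        rw [Qo_add ((hE1.cmul _).add (hE2.cmul _)) ((h.sm.nsq.cmul _).add hfa) hpO,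
          Qo_add (hE1.cmul _) (hE2.cmul _) hpO, Qo_cmul _ hE1 hpO, Qo_cmul _ hE2 hpO,
          Qo_add (h.sm.nsq.cmul _) hfa hpO, Qo_cmul _ h.sm.nsq hpO, Qo_fa (lin_contDiff _), lin_deriv]
      rw [hQe] at hQ
      simp only [Complex.add_re, Complex.re_ofReal_mul, Complex.ofReal_re] at hQ
      have hqe := Qo_etac A ε hpO
      have hge := Gm_etac A ε hpO
      have hx1 := Qo_eta he hv hpO (δ := 1) one_pos hqe
      have hx2 := Qo_eta he hKs hpO (δ := 1/2) (by norm_num) hqe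
      have hx3 := Qo_nsq h.sm hpO
      rw [KK_Z_Q h i p hpO] at hx1
      rw [KK_A_Q h p hpO] at hx2
      rw [h.hQ p hpO] at hx3
      have he0 : 0 ≤ etac A ε p := mul_nonneg ht0 (by linarith)
      have he1 : etac A ε p ≤ 1 := mul_le_one₀ ht1 (by linarith) (by linarith)
      have key := bern_alg (k := k) (n := n) (A := A) (y := y) (B := B) (e := etac A ε p)
        (q := -(n * ((4 * A - 2 * p.2) / A ^ 2)) * (1 - ε * psi p))
        (g := Gm (fun p : Sg n => (etac A ε p : ℂ)) p)
        (v := ‖Zo i V p‖) (w := ‖LD (eA n) (Zo i V) p‖) (K := ‖LD (eA n) V p‖)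
        (K' := ‖LD (eA n) (LD (eA n) V) p‖) (V := ‖V p‖) (GK := Gm (LD (eA n) V) p)
        (GV := Gm V p) (C1 := C1) (C2 := C2)
        (Nat.cast_nonneg k) hn1 hA hyp hB0 he0 he1
        (by
          rw [abs_mul, abs_neg, abs_mul, abs_div, abs_of_nonneg (by positivity : 0 ≤ (n:ℝ)),
            abs_of_nonneg (by positivity : 0 ≤ A ^ 2),
            abs_of_nonneg (by linarith : 0 ≤ 1 - ε * psi p)]
          have h4 : |4 * A - 2 * p.2| ≤ 2 * A := by
            rw [abs_le]; constructor <;> linarith [hp.1, hp.2.1]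
          calc (n:ℝ) * (|4 * A - 2 * p.2| / A ^ 2) * (1 - ε * psi p)
              ≤ (n:ℝ) * ((2 * A) / A ^ 2) * 1 := by gcongr; linarith
            _ = 2 * n / A := by field_simp)
        (Gm_nonneg _ _)
        (hge.trans (by
          have : thet A p.2 ^ 2 ≤ 1 := by nlinarith
          calc thet A p.2 ^ 2 * ε ^ 2 * (1 / 2) ≤ 1 * (1 / A) * (1/2) := by gcongr
            _ = 1 / (2 * A) := by field_simp))
        (norm_nonneg _) (norm_nonneg _)
        (by rw [LD_A_Zo h.sm i hpO]; exact norm_Z_le _ _ _)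
        (norm_Z_le _ _ _) (bV p hp) (bK p hp) (bK' p hp)
        (Sv := 2 * ((starRingEnd ℂ) (Zo i V p) * (-((2 * ((k + 1 : ℕ) : ℝ) : ℝ) : ℂ) * LD (eA n) (Zo i V) p)).re)
        (by
          have := re_conj_mul_ge (Zo i V p) (LD (eA n) (Zo i V) p) ((k + 1 : ℕ) : ℝ) (by positivity)
          push_cast at this ⊢; exact this)
        (re_conj_mul_ge (LD (eA n) V p) (LD (eA n) (LD (eA n) V) p) (k : ℝ) (by positivity))
        (re_conj_mul_ge (V p) (LD (eA n) V p) (k : ℝ) (by positivity))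
        (QV1 := (Qo (fun q : Sg n => ((etac A ε q : ℂ) * (etac A ε q : ℂ)) * nsq (Zo i V) q) p).re)
        (QK1 := (Qo (fun q : Sg n => ((etac A ε q : ℂ) * (etac A ε q : ℂ)) * nsq (LD (eA n) V) q) p).re)
        (QVV := (Qo (nsq V) p).re)
        (by refine le_trans (le_of_eq ?_) hx1; push_cast; ring)
        (by refine le_trans (le_of_eq ?_) hx2; push_cast; ring)
        (by rw [hx3])
        hC1 hC2
      linarith)
  have hp0S : p0 ∈ S := by
    refine ⟨by linarith, by linarith, ?_⟩
    rw [le_div_iff₀ hε]; linarith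
  have h1 := hmain p0 hp0S
  simp only [hΦre] at h1
  have het : etac A ε p0 = 1 - ε * psi p0 := by
    unfold etac thet; rw [hp0]; field_simp; ring
  rw [het, hp0] at h1
  have h2 : 0 ≤ A ^ 2 * ((1 - ε * psi p0) ^ 2 * ‖LD (eA n) V p0‖ ^ 2) := by positivity
  have h3 : 0 ≤ C1 * ‖V p0‖ ^ 2 := by positivity
  have h4 : A * ((1 - ε * psi p0) ^ 2 * ‖Zo i V p0‖ ^ 2) ≤ A * ((C1 * B + 2 * C2) * y) := by
    linarith
  exact le_of_mul_le_mul_left h4 hA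


/-! ### The Liouville argument -/

lemma KK_Z {n : ℕ} (hn : 1 ≤ n) {k : ℕ} {C : ℝ} {V : Sg n → ℂ} (h : KK k C V) (i : Fin n) :
    ∃ C', KK (k + 1) C' (Zo i V) := by
  have hKb := cauchy_A h.sm h.hD h.hb
  have hKb' := cauchy_A (h.sm.LD (eA n)) (KK_A_D h) hKb
  have hC : 0 ≤ C := by
    have hp : (((0, 0), 1) : Sg n) ∈ Om n := (one_pos : (0:ℝ) < 1)
    exact le_trans (by simp) (h.hb _ hp)
  set B := C + C * (4 * 2 ^ k) + C * (4 * 2 ^ k) * (4 * 2 ^ (k + 2)) with hB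
  have e1 : 0 ≤ C * (4 * 2 ^ k) := by positivity
  have e2 : 0 ≤ C * (4 * 2 ^ k) * (4 * 2 ^ (k + 2)) := by positivity
  set C1 : ℝ := 8 * ((k:ℝ) + 1) ^ 2 + 4 * n + 3 with hC1
  set C2 : ℝ := ((4 + 4 * (n:ℝ)) + 4 * k + 4 * k * C1) * B + 1 with hC2
  refine ⟨(C1 * B + 2 * C2) * 2 ^ (k + 1), h.sm.Zo i, KK_Z_D h i, KK_Z_Q h i, ?_⟩
  intro p hp
  have hpp : 0 < p.2 := hp
  set A := p.2 / 2 with hAdef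
  have hA : 0 < A := by positivity
  have h2A : p.2 = 2 * A := by rw [hAdef]; ring
  have hpsi := psi_nonneg hpp.le
  have hlim : Tendsto (fun ε : ℝ => (1 - ε * psi p) ^ 2 * ‖Zo i V p‖ ^ 2) (𝓝[>] 0)
      (𝓝 ((1 - 0 * psi p) ^ 2 * ‖Zo i V p‖ ^ 2)) := by
    apply Tendsto.mono_left _ nhdsWithin_le_nhds
    apply Continuous.tendsto
    fun_prop
  have hev : ∀ᶠ ε : ℝ in 𝓝[>] 0, (1 - ε * psi p) ^ 2 * ‖Zo i V p‖ ^ 2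
      ≤ (C1 * B + 2 * C2) * (A ^ (k + 1))⁻¹ := by
    have c1 : ∀ᶠ ε : ℝ in 𝓝[>] 0, ε ^ 2 < 1 / A := by
      apply Filter.Eventually.filter_mono nhdsWithin_le_nhds
      have : ContinuousAt (fun ε : ℝ => ε ^ 2) 0 := by fun_prop
      exact this.eventually (gt_mem_nhds (by simp; positivity))
    have c2 : ∀ᶠ ε : ℝ in 𝓝[>] 0, ε * psi p < 1 := by
      apply Filter.Eventually.filter_mono nhdsWithin_le_nhds
      have : ContinuousAt (fun ε : ℝ => ε * psi p) 0 := by fun_prop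
      exact this.eventually (gt_mem_nhds (by simp))
    filter_upwards [c1, c2, self_mem_nhdsWithin] with ε h1 h2 h3
    exact bern_step hn h i (by positivity)
      (fun q hq => (h.hb q hq).trans (by linarith)) (fun q hq => (hKb q hq).trans (by linarith))
      (fun q hq => (hKb' q hq).trans (by linarith)) hA h3 h1.le hC1 hC2 h2A h2.le
  have := le_of_tendsto hlim hev
  simp only [zero_mul, sub_zero, one_pow, one_mul] at this
  calc ‖Zo i V p‖ ^ 2 * p.2 ^ (k + 1) ≤ (C1 * B + 2 * C2) * (A ^ (k + 1))⁻¹ * p.2 ^ (k + 1) := by gcongr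
    _ = _ := by rw [h2A, mul_pow]; field_simp

lemma psi_A_le {n : ℕ} {p : Sg n} (hp : p ∈ Om n) :
    (LD (eA n) (fun p : Sg n => (psi p : ℂ)) p).re ≤ 1 := by
  have hp' : 0 < p.2 := hp
  rw [(psi_A hp).1, Complex.ofReal_re]
  have hb := bq_ge hp'.le
  have hP : 0 < Pq p := by linarith [Pq_ge hp'.le]
  rw [div_le_one hP]
  unfold Pq
  nlinarith [sq_nonneg p.1.2]

lemma liou_step {n : ℕ} {k : ℕ} (hk : n + 1 ≤ k) {C : ℝ} {V : Sg n → ℂ} (h : KK k C V)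
    {a0 A ε : ℝ} (ha0 : 0 < a0) (haA : a0 < A) (hε : 0 < ε) {p0 : Sg n} (h1 : a0 ≤ p0.2) (h2 : p0.2 ≤ A) :
    (p0.2 - a0) * ‖V p0‖ ^ 2 ≤ A * (C / A ^ k) + 2 * k * ε * A + ε * psi p0 := by
  have hA : 0 < A := ha0.trans haA
  have hC : 0 ≤ C := by
    have hp : (((0, 0), 1) : Sg n) ∈ Om n := (one_pos : (0:ℝ) < 1)
    exact le_trans (by positivity) (h.hb _ hp)
  have hkn : (n:ℝ) + 1 ≤ k := by exact_mod_cast hk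
  have hn0 : (0:ℝ) ≤ n := by positivity
  set R := max (psi p0) (A * (C / a0 ^ k) / ε) with hR
  set S := slab n a0 A R with hS
  have hSO : S ⊆ Om n := slab_sub ha0
  have hlin : Sm (fun q : Sg n => ((1 * q.2 - a0 : ℝ) : ℂ)) :=
    fa_Sm (g := fun a => 1 * a - a0) (by fun_prop)
  have hld : ContDiff ℝ (⊤ : ℕ∞) (fun a : ℝ => 1 * a - a0) := by fun_prop
  have hlder : ∀ a, deriv (fun a : ℝ => 1 * a - a0) a = 1 := by
    intro a
    have h : HasDerivAt (fun a : ℝ => 1 * a - a0) (1 * 1) a := ((hasDerivAt_id a).const_mul 1).sub_const a0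
    rw [h.deriv]; norm_num
  have hfa : Sm (fun q : Sg n => ((2 * k * ε * q.2 : ℝ) : ℂ)) := fa_Sm (lin_contDiff _)
  set Φ : Sg n → ℂ := fun q => (((1 * q.2 - a0 : ℝ) : ℂ) * nsq V q
    - (ε : ℂ) * (psi q : ℂ)) + ((2 * k * ε * q.2 : ℝ) : ℂ) with hΦ
  have hW := hlin.mul h.sm.nsq
  have hΦs : Sm Φ := (hW.sub (psi_Sm.cmul _)).add hfa
  have hΦre : ∀ q, (Φ q).re = (q.2 - a0) * ‖V q‖ ^ 2 - ε * psi q + 2 * k * ε * q.2 := by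
    intro q
    have : Φ q = (((q.2 - a0) * ‖V q‖ ^ 2 - ε * psi q + 2 * k * ε * q.2 : ℝ) : ℂ) := by
      simp only [hΦ, nsq_eq]; push_cast; ring
    rw [this, Complex.ofReal_re]
  have hmain := compact_max (slab_compact (n := n) (a1 := a0) (a2 := A) (R := R) ha0)
    (u := fun q => (Φ q).re) (m := A * (C / A ^ k) + 2 * k * ε * A)
    (Complex.continuous_re.comp_continuousOn (hΦs.continuousOn.mono hSO)) (by
    intro p hp hm
    have hpO := hSO hp
    have hpp : 0 < p.2 := hpO
    have hpsi := psi_nonneg hpp.le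
    have hcA : 2 * k * ε * p.2 ≤ 2 * k * ε * A := by gcongr; exact hp.2.1
    have hAC : 0 ≤ A * (C / A ^ k) := by positivity
    simp only [hΦre] at hm
    have hVb : ‖V p‖ ^ 2 ≤ C / p.2 ^ k := by
      rw [le_div_iff₀ (by positivity)]; exact h.hb p hpO
    have heps := mul_nonneg hε.le hpsi
    constructor
    · apply slab_nhds ha0
      · refine lt_of_le_of_ne hp.1 fun h0 => ?_
        rw [← h0] at hm hcA; nlinarith
      · refine lt_of_le_of_ne hp.2.1 fun h0 => ?_
        rw [h0] at hm hVb
        have : (A - a0) * ‖V p‖ ^ 2 ≤ A * (C / A ^ k) := by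
          apply mul_le_mul _ hVb (by positivity) hA.le; linarith
        linarith
      · refine lt_of_le_of_ne hp.2.2 fun h0 => ?_
        have h3 : A * (C / a0 ^ k) ≤ ε * psi p := by
          rw [h0, hR]
          calc A * (C / a0 ^ k) = ε * (A * (C / a0 ^ k) / ε) := by field_simp
            _ ≤ _ := by gcongr; exact le_max_right _ _
        have h4 : (p.2 - a0) * ‖V p‖ ^ 2 ≤ A * (C / a0 ^ k) := by
          apply mul_le_mul _ _ (by positivity) hA.le
          · linarith [hp.2.1]
          · refine hVb.trans ?_
            gcongr; exact hp.1
        linarith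
    · intro hloc
      have hQ := localMax_Qo hΦs hpO hloc
      have hL := (localMax_of_Sm hΦs hpO hloc (eA n)).1
      have hQe : Qo Φ p = (((1 * p.2 - a0 : ℝ) : ℂ) * Qo (nsq V) p
          + nsq V p * ((-(n * 1) : ℝ) : ℂ)) + ((-(n * (2 * k * ε)) : ℝ) : ℂ) := by
        simp only [hΦ]
        rw [Qo_add (hW.sub (psi_Sm.cmul _)) hfa hpO, Qo_sub hW (psi_Sm.cmul _) hpO,
          Qo_mul hlin h.sm.nsq hpO, Qo_cmul _ psi_Sm hpO, Qo_psi hpO, Qo_fa (lin_contDiff _),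
          lin_deriv, Gam_fa hld, Qo_fa hld, hlder]
        simp
      have hLe : LD (eA n) Φ p = ((((1 * p.2 - a0 : ℝ) : ℂ) * LD (eA n) (nsq V) p
          + nsq V p * ((1 * 1 : ℝ) : ℂ)) - (ε : ℂ) * LD (eA n) (fun q : Sg n => (psi q : ℂ)) p)
          + ((1 * (2 * k * ε) : ℝ) : ℂ) := by
        simp only [hΦ]
        rw [LD_add (hW.sub (psi_Sm.cmul _)) hfa hpO, LD_sub hW (psi_Sm.cmul _) hpO,
          LD_mul hlin h.sm.nsq hpO, LD_cmul _ psi_Sm hpO, LD_fa (lin_contDiff _),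
          lin_deriv, LD_fa hld, hlder]
        simp [eA]
      rw [hQe] at hQ
      rw [hLe] at hL
      rw [nsq_eq, LD_nsq h.sm _ hpO] at hL
      rw [nsq_eq] at hQ
      simp only [Complex.add_re, Complex.sub_re, Complex.re_ofReal_mul, Complex.ofReal_re] at hQ hL
      have hx3 := Qo_nsq h.sm hpO
      rw [h.hQ p hpO] at hx3
      have hx4 : ((starRingEnd ℂ) (V p) * (-((2 * k : ℝ) : ℂ) * LD (eA n) V p)).re
          = -(2 * k) * ((starRingEnd ℂ) (V p) * LD (eA n) V p).re := by
        rw [show (starRingEnd ℂ) (V p) * (-((2 * k : ℝ) : ℂ) * LD (eA n) V p)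
          = ((-(2 * k) : ℝ) : ℂ) * ((starRingEnd ℂ) (V p) * LD (eA n) V p) by push_cast; ring,
          Complex.re_ofReal_mul]
      rw [hx4] at hx3
      rw [hx3] at hQ
      have hG := Gm_nonneg V p
      have hpA := psi_A_le hpO
      set r := ((starRingEnd ℂ) (V p) * LD (eA n) V p).re
      have hag : 0 ≤ (p.2 - a0) * Gm V p := mul_nonneg (by linarith [hp.1]) hG
      -- Q + 2k ∂_a
      have hkp : (0:ℝ) < k := by linarith
      have t1 : ε * (LD (eA n) (fun q : Sg n => (psi q : ℂ)) p).re ≤ ε := by nlinarith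
      have hV2 : 0 ≤ (2 * (k:ℝ) - n) * ‖V p‖ ^ 2 := mul_nonneg (by linarith) (by positivity)
      have hkε : 0 < k * ε := by positivity
      have hsum : (p.2 - a0) * Gm V p + (2 * (k:ℝ) - n) * ‖V p‖ ^ 2
          - 2 * k * (ε * (LD (eA n) (fun q : Sg n => (psi q : ℂ)) p).re)
          + (2 * k - n) * (2 * (k * ε)) ≤ 0 := by
        linear_combination hQ + (2 * k) * hL
      have t2 : 2 * k * (ε * (LD (eA n) (fun q : Sg n => (psi q : ℂ)) p).re) ≤ 2 * k * ε := by gcongr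
      have t3 : 2 * (2 * (k * ε)) ≤ (2 * k - n) * (2 * (k * ε)) := by
        gcongr; linarith
      linarith)
  have hp0S : p0 ∈ S := ⟨h1, h2, le_max_left _ _⟩
  have h3 := hmain p0 hp0S
  simp only [hΦre] at h3
  have h4 : 0 ≤ 2 * k * ε * p0.2 := by have := ha0.le.trans h1; positivity
  linarith

lemma KK_zero {n : ℕ} (hn : 1 ≤ n) {k : ℕ} (hk : n + 1 ≤ k) {C : ℝ} {V : Sg n → ℂ} (h : KK k C V) :
    ∀ p ∈ Om n, V p = 0 := by
  intro p hp
  have hpp : 0 < p.2 := hp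
  have hC : 0 ≤ C := le_trans (by positivity) (h.hb _ hp)
  have h1 : ∀ A, p.2 ≤ A → 1 ≤ A → (p.2 - p.2 / 2) * ‖V p‖ ^ 2 ≤ C / A := by
    intro A hA hA1
    have hA0 : 0 < A := by linarith
    have h2 : (p.2 - p.2 / 2) * ‖V p‖ ^ 2 ≤ A * (C / A ^ k) := by
      have hlim : Tendsto (fun ε : ℝ => A * (C / A ^ k) + 2 * k * ε * A + ε * psi p) (𝓝[>] 0)
          (𝓝 (A * (C / A ^ k) + 2 * k * 0 * A + 0 * psi p)) := by
        apply Tendsto.mono_left _ nhdsWithin_le_nhds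
        apply Continuous.tendsto
        fun_prop
      have := ge_of_tendsto hlim (b := (p.2 - p.2 / 2) * ‖V p‖ ^ 2) (by
        filter_upwards [self_mem_nhdsWithin] with ε hε
        exact liou_step hk h (by positivity) (by linarith) hε (by linarith) hA)
      simpa using this
    refine h2.trans ?_
    have hk2 : A ^ 2 ≤ A ^ k := pow_le_pow_right₀ hA1 (by omega)
    calc A * (C / A ^ k) ≤ A * (C / A ^ 2) := by gcongr
      _ = C / A := by field_simp
  have hlim : Tendsto (fun A : ℝ => C / A) atTop (𝓝 0) := tendsto_id.const_div_atTop C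
  have h3 := ge_of_tendsto hlim (by
    filter_upwards [eventually_ge_atTop p.2, eventually_ge_atTop 1] with A a b using h1 A a b)
  have h4 : ‖V p‖ ^ 2 ≤ 0 := by nlinarith
  have h5 : ‖V p‖ = 0 := by nlinarith [norm_nonneg (V p)]
  exact norm_eq_zero.1 h5

lemma KK_Zzero {n : ℕ} {k : ℕ} (hk : 1 ≤ k) {C : ℝ} {V : Sg n → ℂ} (h : KK k C V)
    (hZ : ∀ i, ∀ p ∈ Om n, Zo i V p = 0) : ∀ p ∈ Om n, V p = 0 := by
  have hA : ∀ p ∈ Om n, LD (eA n) V p = 0 := by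
    intro p hp
    have h1 := Qo_eq_ZbZ h.sm hp
    have h2 : ∀ j : Fin n, Zbo j (Zo j V) p = 0 := by
      intro j
      unfold Zbo
      rw [LD_congr (G := fun _ => 0) (hZ j) hp, LD_congr (G := fun _ => 0) (hZ j) hp, LD_const, LD_const]
      simp
    simp only [h2, Finset.sum_const_zero] at h1
    rw [h.hQ p hp] at h1
    have h3 : Complex.I * n * LD (eTS n) V p = - n * LD (eA n) V p := by
      rw [h.hD p hp]; ring
    rw [h3] at h1
    have h4 : ((2 * k : ℝ) : ℂ) * LD (eA n) V p = 0 := by linear_combination -h1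
    rcases mul_eq_zero.1 h4 with h5 | h5
    · exfalso
      have h6 : (2 * (k:ℝ)) = 0 := by exact_mod_cast h5
      have h7 : (1:ℝ) ≤ k := by exact_mod_cast hk
      linarith
    · exact h5
  intro p hp
  have hpp : 0 < p.2 := hp
  have hC : 0 ≤ C := le_trans (by positivity) (h.hb _ hp)
  have hconst : ∀ b : ℝ, 0 ≤ b → V (p + b • VF (eA n) p) = V p := by
    intro b hb
    have hm : ∀ r : ℝ, 0 ≤ r → p + r • VF (eA n) p ∈ Om n := by
      intro r hr
      have : (p + r • VF (eA n) p).2 = p.2 + r := by simp [VF, eA]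
      show 0 < (p + r • VF (eA n) p).2
      rw [this]; linarith
    have hd : ∀ r : ℝ, 0 ≤ r → HasDerivAt (fun r : ℝ => V (p + r • VF (eA n) p)) 0 r := by
      intro r hr
      have := hasDerivAt_line h.sm (hm r hr)
      rwa [hA _ (hm r hr)] at this
    have := constant_of_has_deriv_right_zero (f := fun r : ℝ => V (p + r • VF (eA n) p)) (a := 0) (b := b)
      (fun r hr => (hd r hr.1).continuousAt.continuousWithinAt)
      (fun r hr => (hd r hr.1).hasDerivWithinAt) b ⟨hb, le_rfl⟩
    simpa using this
  have h1 : ∀ b : ℝ, 1 ≤ b → ‖V p‖ ^ 2 ≤ C / b := by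
    intro b hb
    have h2 := h.hb (p + b • VF (eA n) p) (by
      have : (p + b • VF (eA n) p).2 = p.2 + b := by simp [VF, eA]
      show 0 < (p + b • VF (eA n) p).2
      rw [this]; linarith)
    have h3 : (p + b • VF (eA n) p).2 = p.2 + b := by simp [VF, eA]
    rw [hconst b (by linarith), h3] at h2
    rw [le_div_iff₀ (by linarith)]
    refine le_trans ?_ h2
    gcongr
    calc b ≤ p.2 + b := by linarith
      _ = (p.2 + b) ^ 1 := by ring
      _ ≤ _ := pow_le_pow_right₀ (by linarith) hk
  have hlim : Tendsto (fun A : ℝ => C / A) atTop (𝓝 0) := tendsto_id.const_div_atTop C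
  have h3 := ge_of_tendsto hlim (by
    filter_upwards [eventually_ge_atTop 1] with A a using h1 A a)
  have h5 : ‖V p‖ = 0 := by nlinarith [norm_nonneg (V p)]
  exact norm_eq_zero.1 h5

lemma KK_all_zero {n : ℕ} (hn : 1 ≤ n) (j : ℕ) : ∀ k : ℕ, 1 ≤ k → n + 1 ≤ k + j → ∀ (C : ℝ) (V : Sg n → ℂ),
    KK k C V → ∀ p ∈ Om n, V p = 0 := by
  induction j with
  | zero => intro k hk hkj C V h; exact KK_zero hn hkj h
  | succ j ih =>
    intro k hk hkj C V h
    refine KK_Zzero hk h fun i => ?_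
    obtain ⟨C', h'⟩ := KK_Z hn h i
    exact ih (k + 1) (by omega) (by omega) C' _ h'

/-- The final conclusion of the Liouville argument. -/
lemma antiHolo_of_DQ {n : ℕ} (hn : 1 ≤ n) {F : Sg n → ℂ} (hF : Sm F) {C : ℝ}
    (hb : ∀ p ∈ Om n, ‖F p‖ ≤ C)
    (hD : ∀ p ∈ Om n, LD (eA n) F p = -Complex.I * LD (eTS n) F p)
    (hQ : ∀ p ∈ Om n, Qo F p = 0) : IsAntiHolo n F := by
  have hK : KK 0 (C ^ 2) F := by
    refine ⟨hF, hD, fun p hp => by rw [hQ p hp]; simp, fun p hp => ?_⟩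
    rw [pow_zero, mul_one]
    exact pow_le_pow_left₀ (norm_nonneg _) (hb p hp) 2
  rw [antiHolo_iff hF]
  intro p hp
  refine ⟨fun j => ?_, hD p hp⟩
  obtain ⟨C', h'⟩ := KK_Z hn hK j
  have := KK_all_zero hn n 1 le_rfl (by omega) C' _ h' p hp
  unfold Zo at this
  have h2 : LD (eXS n j) F p - Complex.I * LD (eYS n j) F p = 0 := by
    rcases mul_eq_zero.1 this with h | h
    · norm_num at h
    · exact h
  linear_combination h2


/-! ### Mollification by left translations -/

/-- `g⁻¹ p`. -/
def gi {n : ℕ} (g : Hn n) (p : Sg n) : Sg n :=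
  ((p.1.1 - g.1, p.1.2 - g.2 + bt p.1.1 g.1), p.2)

lemma gi_snd {n : ℕ} (g : Hn n) (p : Sg n) : (gi g p).2 = p.2 := rfl

lemma gi_mem {n : ℕ} {g : Hn n} {p : Sg n} (hp : p ∈ Om n) : gi g p ∈ Om n := hp

lemma gi_line {n : ℕ} (g : Hn n) (c p : Sg n) (r : ℝ) :
    gi g (p + r • VF c p) = gi g p + r • VF c (gi g p) := by
  refine Prod.ext (Prod.ext ?_ ?_) ?_
  · simp [gi, VF]; abel
  · simp [gi, VF, bt_add_left, bt_smul_left, bt_sub_left]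
    rw [bt_swap c.1.1 g.1]; ring
  · simp [gi, VF]

lemma gi_continuous {n : ℕ} : Continuous (fun x : Hn n × Sg n => gi x.1 x.2) := by
  unfold gi
  have : Continuous (fun x : Hn n × Sg n => bt x.2.1.1 x.1.1) :=
    bt_continuous (by fun_prop) (by fun_prop)
  fun_prop

/-- The mollification. -/
def mol {n : ℕ} (φ : Hn n → ℂ) (F : Sg n → ℂ) (p : Sg n) : ℂ := ∫ g, φ g * F (gi g p)

/-- continuous, compactly supported -/
structure Cc {n : ℕ} (φ : Hn n → ℂ) : Prop where
  cont : Continuous φ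
  supp : HasCompactSupport φ

lemma Cc.int {n : ℕ} {φ : Hn n → ℂ} (h : Cc φ) : Integrable φ := h.cont.integrable_of_hasCompactSupport h.supp

lemma Fgi_contOn {n : ℕ} {F : Sg n → ℂ} (hF : ContinuousOn F (Om n)) :
    ContinuousOn (fun x : Sg n × Hn n => F (gi x.2 x.1)) (Om n ×ˢ univ) := by
  refine hF.comp (Continuous.continuousOn ?_) ?_
  · exact gi_continuous.comp (continuous_snd.prodMk continuous_fst)
  · intro x hx; exact hx.1

lemma Fgi_cont {n : ℕ} {F : Sg n → ℂ} (hF : ContinuousOn F (Om n)) {p : Sg n} (hp : p ∈ Om n) :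
    Continuous (fun g : Hn n => F (gi g p)) := by
  refine hF.comp_continuous ?_ (fun g => gi_mem hp)
  exact gi_continuous.comp (continuous_id.prodMk continuous_const)

lemma mol_int {n : ℕ} {φ : Hn n → ℂ} (hφ : Cc φ) {F : Sg n → ℂ} (hF : ContinuousOn F (Om n)) {p : Sg n}
    (hp : p ∈ Om n) : Integrable (fun g => φ g * F (gi g p)) :=
  (hφ.cont.mul (Fgi_cont hF hp)).integrable_of_hasCompactSupport hφ.supp.mul_right

lemma mol_continuousOn {n : ℕ} {φ : Hn n → ℂ} (hφ : Cc φ) {F : Sg n → ℂ} (hF : ContinuousOn F (Om n)) :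
    ContinuousOn (mol φ F) (Om n) := by
  refine continuousOn_integral_of_compact_support (f := fun p g => φ g * F (gi g p)) hφ.supp ?_ ?_
  · exact (hφ.cont.comp continuous_snd).continuousOn.mul (Fgi_contOn hF)
  · intro p g _ hg
    rw [image_eq_zero_of_notMem_tsupport hg, zero_mul]

lemma mol_norm {n : ℕ} {φ : Hn n → ℂ} (hφ : Cc φ) {F : Sg n → ℂ} {C : ℝ}
    (hC : ∀ p ∈ Om n, ‖F p‖ ≤ C) {p : Sg n} (hp : p ∈ Om n) :
    ‖mol φ F p‖ ≤ C * ∫ g, ‖φ g‖ := by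
  unfold mol
  rw [← integral_const_mul]
  refine norm_integral_le_of_norm_le (hφ.int.norm.const_mul C) (Eventually.of_forall fun g => ?_)
  rw [norm_mul, mul_comm]
  gcongr
  exact hC _ (gi_mem hp)

lemma mol_hasDerivAt {n : ℕ} {φ : Hn n → ℂ} (hφ : Cc φ) {F : Sg n → ℂ} (hF : Sm F) {c p : Sg n} {s : ℝ}
    (hp : p + s • VF c p ∈ Om n) :
    HasDerivAt (fun r : ℝ => mol φ F (p + r • VF c p)) (mol φ (LD c F) (p + s • VF c p)) s := by
  have hlc : Continuous (fun r : ℝ => p + r • VF c p) := by fun_prop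
  have hev : (fun r : ℝ => p + r • VF c p) ⁻¹' (Om n) ∈ 𝓝 s := hlc.continuousAt (Om_nhds hp)
  obtain ⟨δ, hδ, hball⟩ := Metric.nhds_basis_closedBall.mem_iff.1 hev
  have hcF : ContinuousOn (fun x : ℝ × Hn n => LD c F (gi x.2 (p + x.1 • VF c p)))
      (Metric.closedBall s δ ×ˢ tsupport φ) := by
    have h1 := Fgi_contOn (hF.LD c).continuousOn
    refine h1.comp (f := fun x : ℝ × Hn n => (p + x.1 • VF c p, x.2))
      (Continuous.continuousOn (by fun_prop)) ?_
    intro x hx; exact ⟨hball hx.1, mem_univ _⟩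
  obtain ⟨M, hM⟩ := ((isCompact_closedBall s δ).prod hφ.supp).exists_bound_of_continuousOn hcF
  refine (hasDerivAt_integral_of_dominated_loc_of_deriv_le (s := Metric.closedBall s δ)
    (bound := fun g => ‖φ g‖ * M)
    (F := fun r g => φ g * F (gi g (p + r • VF c p)))
    (F' := fun r g => φ g * LD c F (gi g (p + r • VF c p)))
    (Metric.closedBall_mem_nhds s hδ) ?_ ?_ ?_ ?_ ?_ ?_).2
  · filter_upwards [hev] with r hr
    exact (mol_int hφ hF.continuousOn hr).aestronglyMeasurable
  · exact mol_int hφ hF.continuousOn hp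
  · exact (mol_int hφ (hF.LD c).continuousOn hp).aestronglyMeasurable
  · refine Eventually.of_forall fun g r hr => ?_
    rw [norm_mul]
    by_cases hg : g ∈ tsupport φ
    · gcongr
      exact hM (r, g) ⟨hr, hg⟩
    · rw [image_eq_zero_of_notMem_tsupport hg]; simp
  · exact hφ.int.norm.mul_const M
  · refine Eventually.of_forall fun g r hr => ?_
    have hr' := hball hr
    have h1 := hasDerivAt_line (c := c) (F := F) hF (p := gi g p) (s := r)
      (by rw [← gi_line]; exact gi_mem hr')
    simp only [← gi_line] at h1
    exact h1.const_mul _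

lemma mol_HL2 {n : ℕ} {φ : Hn n → ℂ} (hφ : Cc φ) {F : Sg n → ℂ} (hF : Sm F) (c : Sg n) {p : Sg n}
    (hp : p ∈ Om n) :
    HL2 (fun r => mol φ F (p + r • VF c p)) (mol φ (LD c F) p) (mol φ (LD c (LD c F)) p) := by
  refine ⟨fun r => mol φ (LD c F) (p + r • VF c p), ?_, by simp, ?_⟩
  · have hc : ContinuousAt (fun r : ℝ => p + r • VF c p) 0 := by fun_prop
    have : ∀ᶠ r : ℝ in 𝓝 0, p + r • VF c p ∈ Om n :=
      hc (by simpa using Om_nhds hp)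
    filter_upwards [this] with r hr using mol_hasDerivAt hφ hF hr
  · have := mol_hasDerivAt hφ (hF.LD c) (c := c) (p := p) (s := 0) (by simpa using hp)
    simpa using this

lemma mol_add {n : ℕ} {φ : Hn n → ℂ} (hφ : Cc φ) {F G : Sg n → ℂ} (hF : Sm F) (hG : Sm G) {p : Sg n}
    (hp : p ∈ Om n) : mol φ (fun q => F q + G q) p = mol φ F p + mol φ G p := by
  unfold mol
  rw [← integral_add (mol_int hφ hF.continuousOn hp) (mol_int hφ hG.continuousOn hp)]
  congr 1; funext g; ring

lemma mol_cmul {n : ℕ} (φ : Hn n → ℂ) (F : Sg n → ℂ) (k : ℂ) (p : Sg n) :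
    mol φ (fun q => k * F q) p = k * mol φ F p := by
  unfold mol
  rw [← integral_const_mul]
  congr 1; funext g; ring

lemma mol_sum {n : ℕ} {ι : Type} (s : Finset ι) {φ : Hn n → ℂ} (hφ : Cc φ) {F : ι → Sg n → ℂ}
    (hF : ∀ i, Sm (F i)) {p : Sg n}
    (hp : p ∈ Om n) : mol φ (fun q => ∑ i ∈ s, F i q) p = ∑ i ∈ s, mol φ (F i) p := by
  unfold mol
  rw [← integral_finsetSum _ fun i _ => mol_int hφ (hF i).continuousOn hp]
  congr 1; funext g; rw [Finset.mul_sum]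

lemma mol_congr {n : ℕ} (φ : Hn n → ℂ) {F G : Sg n → ℂ} (h : ∀ p ∈ Om n, F p = G p) {p : Sg n}
    (hp : p ∈ Om n) : mol φ F p = mol φ G p := by
  unfold mol
  congr 1; funext g; rw [h _ (gi_mem hp)]

/-! ### Change of variables -/

/-- `g⁻¹ w` -/
def giH {n : ℕ} (w g : Hn n) : Hn n := (w.1 - g.1, w.2 - g.2 + bt w.1 g.1)
/-- `w h⁻¹` -/
def wi {n : ℕ} (w h : Hn n) : Hn n := (w.1 - h.1, w.2 - h.2 - bt w.1 h.1)

lemma wi_giH {n : ℕ} (w g : Hn n) : wi w (giH w g) = g := by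
  refine Prod.ext ?_ ?_
  · simp [wi, giH]
  · simp [wi, giH, bt_sub_right, bt_self]; ring

lemma giH_wi {n : ℕ} (w g : Hn n) : giH w (wi w g) = g := by
  refine Prod.ext ?_ ?_
  · simp [wi, giH]
  · simp [wi, giH, bt_sub_right, bt_self]; ring

lemma giH_cont {n : ℕ} : Continuous (fun x : Hn n × Hn n => giH x.1 x.2) := by
  unfold giH
  have : Continuous (fun x : Hn n × Hn n => bt x.1.1 x.2.1) :=
    bt_continuous (by fun_prop) (by fun_prop)
  fun_prop

lemma wi_cont {n : ℕ} : Continuous (fun x : Hn n × Hn n => wi x.1 x.2) := by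
  unfold wi
  have : Continuous (fun x : Hn n × Hn n => bt x.1.1 x.2.1) :=
    bt_continuous (by fun_prop) (by fun_prop)
  fun_prop

/-- The change of variables as a homeomorphism. -/
def giHomeo {n : ℕ} (w : Hn n) : Hn n ≃ₜ Hn n where
  toFun := giH w
  invFun := wi w
  left_inv := wi_giH w
  right_inv := giH_wi w
  continuous_toFun := giH_cont.comp (continuous_const.prodMk continuous_id)
  continuous_invFun := wi_cont.comp (continuous_const.prodMk continuous_id)

lemma giH_mp {n : ℕ} (w : Hn n) : MeasurePreserving (giH w) volume volume := by
  have h1 : MeasurePreserving (fun η : Fin n → ℂ => w.1 - η) volume volume :=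
    Measure.measurePreserving_sub_left volume w.1
  have h2 := h1.skew_product (μc := (volume : Measure ℝ)) (μd := (volume : Measure ℝ))
    (g := fun η s => w.2 - s + bt w.1 η) (by
      apply Continuous.measurable
      have : Continuous (fun x : (Fin n → ℂ) × ℝ => bt w.1 x.1) :=
        bt_continuous (by fun_prop) (by fun_prop)
      simp only [Function.uncurry_def]
      fun_prop) (by
      refine Eventually.of_forall fun η => ?_
      have := (Measure.measurePreserving_sub_left (volume : Measure ℝ) (w.2 + bt w.1 η)).map_eq
      convert this using 2
      funext s; ring)
  exact h2

lemma mol_eq {n : ℕ} (φ : Hn n → ℂ) (F : Sg n → ℂ) (w : Hn n) (a : ℝ) :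
    mol φ F (w, a) = ∫ h, φ (wi w h) * F (h, a) := by
  have := (giH_mp w).integral_comp (giHomeo w).measurableEmbedding
    (fun h => φ (wi w h) * F (h, a))
  rw [← this]
  simp only [wi_giH]
  rfl


/-! ### Integration by parts on the group -/

/-- Left invariant derivative on `H^n`. -/
def HD {n : ℕ} (c : Hn n) (f : Hn n → ℂ) (h : Hn n) : ℂ := fderiv ℝ f h (c.1, c.2 + bt h.1 c.1)

/-- Right invariant type derivative on `H^n`. -/
def RD {n : ℕ} (c : Hn n) (f : Hn n → ℂ) (h : Hn n) : ℂ := fderiv ℝ f h (c.1, c.2 - bt h.1 c.1)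

/-- smooth, compactly supported -/
structure Cs {n : ℕ} (φ : Hn n → ℂ) : Prop where
  smooth : ContDiff ℝ (⊤ : ℕ∞) φ
  supp : HasCompactSupport φ

lemma Cs.cc {n : ℕ} {φ : Hn n → ℂ} (h : Cs φ) : Cc φ := ⟨h.smooth.continuous, h.supp⟩

lemma fd_smooth {n : ℕ} {φ : Hn n → ℂ} (h : ContDiff ℝ (⊤ : ℕ∞) φ) {v : Hn n → Hn n}
    (hv : ContDiff ℝ (⊤ : ℕ∞) v) : ContDiff ℝ (⊤ : ℕ∞) (fun g => fderiv ℝ φ g (v g)) :=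
  (h.fderiv_right (m := (⊤ : ℕ∞)) (by simp)).clm_apply hv

lemma fd_supp {n : ℕ} {φ : Hn n → ℂ} (h : HasCompactSupport φ) (v : Hn n → Hn n) :
    HasCompactSupport (fun g => fderiv ℝ φ g (v g)) := by
  refine (h.fderiv ℝ).mono ?_
  intro x hx hx'
  apply hx
  simp [hx']

lemma Cs_fd {n : ℕ} {φ : Hn n → ℂ} (h : Cs φ) {v : Hn n → Hn n}
    (hv : ContDiff ℝ (⊤ : ℕ∞) v) : Cs (fun g => fderiv ℝ φ g (v g)) :=
  ⟨fd_smooth h.smooth hv, fd_supp h.supp v⟩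

lemma HDv_smooth {n : ℕ} (c : Hn n) :
    ContDiff ℝ (⊤ : ℕ∞) (fun h : Hn n => ((c.1, c.2 + bt h.1 c.1) : Hn n)) :=
  contDiff_const.prodMk (contDiff_const.add (bt_contDiff contDiff_fst contDiff_const))

lemma RDv_smooth {n : ℕ} (c : Hn n) :
    ContDiff ℝ (⊤ : ℕ∞) (fun h : Hn n => ((c.1, c.2 - bt h.1 c.1) : Hn n)) :=
  contDiff_const.prodMk (contDiff_const.sub (bt_contDiff contDiff_fst contDiff_const))

lemma Cs_HD {n : ℕ} {φ : Hn n → ℂ} (h : Cs φ) (c : Hn n) : Cs (HD c φ) := Cs_fd h (HDv_smooth c)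
lemma Cs_RD {n : ℕ} {φ : Hn n → ℂ} (h : Cs φ) (c : Hn n) : Cs (RD c φ) := Cs_fd h (RDv_smooth c)

lemma Hn_haar (n : ℕ) : (volume : Measure (Hn n)).IsAddHaarMeasure := by
  have h1 : (volume : Measure (Fin n → ℂ)).IsAddHaarMeasure := by
    rw [volume_pi]; infer_instance
  exact Measure.prod.instIsAddHaarMeasure (volume : Measure (Fin n → ℂ)) (volume : Measure ℝ)

lemma ibp0 {n : ℕ} {φ f : Hn n → ℂ} (hφ : Cs φ) (hf : ContDiff ℝ (⊤ : ℕ∞) f) (v : Hn n) :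
    ∫ h, φ h * fderiv ℝ f h v = - ∫ h, fderiv ℝ φ h v * f h := by
  have := Hn_haar n
  have h1 := fd_smooth hf (v := fun _ => v) contDiff_const
  have h2 := Cs_fd hφ (v := fun _ => v) contDiff_const
  refine integral_mul_fderiv_eq_neg_fderiv_mul_of_integrable ?_ ?_ ?_ ?_ ?_
  · exact (h2.smooth.continuous.mul hf.continuous).integrable_of_hasCompactSupport h2.supp.mul_right
  · exact (hφ.smooth.continuous.mul h1.continuous).integrable_of_hasCompactSupport hφ.supp.mul_right
  · exact (hφ.smooth.continuous.mul hf.continuous).integrable_of_hasCompactSupport hφ.supp.mul_right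
  · intro x _; exact hφ.smooth.differentiable (by simp) x
  · intro x _; exact hf.differentiable (by simp) x

lemma fd_split {n : ℕ} (f : Hn n → ℂ) (h : Hn n) (ξ : Fin n → ℂ) (τ b : ℝ) :
    fderiv ℝ f h (ξ, τ + b) = fderiv ℝ f h (ξ, τ) + b * fderiv ℝ f h (0, 1) := by
  have : ((ξ, τ + b) : Hn n) = (ξ, τ) + b • ((0, 1) : Hn n) := by
    refine Prod.ext ?_ ?_ <;> simp
  rw [this, map_add, map_smul, Complex.real_smul]

lemma ibp {n : ℕ} {φ f : Hn n → ℂ} (hφ : Cs φ) (hf : ContDiff ℝ (⊤ : ℕ∞) f) (c : Hn n) :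
    ∫ h, φ h * HD c f h = - ∫ h, HD c φ h * f h := by
  have hb : ContDiff ℝ (⊤ : ℕ∞) (fun h : Hn n => (bt h.1 c.1 : ℂ)) :=
    Complex.ofRealCLM.contDiff.comp (bt_contDiff contDiff_fst contDiff_const)
  have hφ2 : Cs (fun h => φ h * (bt h.1 c.1 : ℂ)) := ⟨hφ.smooth.mul hb, hφ.supp.mul_right⟩
  have e1 := ibp0 hφ hf (c.1, c.2)
  have e2 := ibp0 hφ2 hf (0, 1)
  have hd : ∀ h : Hn n, fderiv ℝ (fun h => φ h * (bt h.1 c.1 : ℂ)) h (0, 1)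
      = fderiv ℝ φ h (0, 1) * (bt h.1 c.1 : ℂ) := by
    intro h
    have k1 : HasDerivAt (fun r : ℝ => φ (h + r • ((0, 1) : Hn n)) * (bt h.1 c.1 : ℂ))
        (fderiv ℝ φ h (0, 1) * (bt h.1 c.1 : ℂ)) 0 := by
      have : HasDerivAt _ _ _ := (hφ.smooth.differentiable (by simp) h).hasFDerivAt.hasLineDerivAt (0, 1)
      exact this.mul_const _
    have k2 : HasDerivAt _ _ _ := (hφ2.smooth.differentiable (by simp) h).hasFDerivAt.hasLineDerivAt (0, 1)
    have : (fun r : ℝ => φ (h + r • ((0, 1) : Hn n)) * (bt (h + r • ((0, 1) : Hn n)).1 c.1 : ℂ))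
       = (fun r : ℝ => φ (h + r • ((0, 1) : Hn n)) * (bt h.1 c.1 : ℂ)) := by
      funext r; simp
    exact k2.unique (this ▸ k1)
  simp only [hd] at e2
  unfold HD
  have s1 : ∀ h, φ h * fderiv ℝ f h (c.1, c.2 + bt h.1 c.1)
      = φ h * fderiv ℝ f h (c.1, c.2) + φ h * (bt h.1 c.1 : ℂ) * fderiv ℝ f h (0, 1) := by
    intro h; rw [fd_split]; ring
  have s2 : ∀ h, fderiv ℝ φ h (c.1, c.2 + bt h.1 c.1) * f h
      = fderiv ℝ φ h (c.1, c.2) * f h + fderiv ℝ φ h (0, 1) * (bt h.1 c.1 : ℂ) * f h := by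
    intro h; rw [fd_split]; ring
  simp only [s1, s2]
  have cf := hf.continuous
  have cφ := hφ.smooth.continuous
  have cv : ∀ v : Hn n, Continuous (fun h => fderiv ℝ f h v) := fun v =>
    (fd_smooth hf (v := fun _ => v) contDiff_const).continuous
  have cw : ∀ v : Hn n, Cs (fun h => fderiv ℝ φ h v) := fun v =>
    (Cs_fd hφ (v := fun _ => v) contDiff_const)
  rw [integral_add, integral_add, e1, e2]
  · ring
  · exact ((cw _).smooth.continuous.mul cf).integrable_of_hasCompactSupport (cw _).supp.mul_right
  · exact (((cw _).smooth.continuous.mul hb.continuous).mul cf).integrable_of_hasCompactSupport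
      (cw _).supp.mul_right.mul_right
  · exact (cφ.mul (cv _)).integrable_of_hasCompactSupport hφ.supp.mul_right
  · exact ((cφ.mul hb.continuous).mul (cv _)).integrable_of_hasCompactSupport
      hφ.supp.mul_right.mul_right

lemma slice_smooth {n : ℕ} {F : Sg n → ℂ} (hF : Sm F) {a : ℝ} (ha : 0 < a) :
    ContDiff ℝ (⊤ : ℕ∞) (fun h : Hn n => F (h, a)) := by
  have : ContDiffOn ℝ (⊤ : ℕ∞) (F ∘ fun h : Hn n => ((h, a) : Sg n)) univ :=
    hF.comp (t := Om n) (contDiff_id.prodMk contDiff_const).contDiffOn (fun h _ => ha)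
  exact contDiffOn_univ.1 this

lemma LD_slice {n : ℕ} {F : Sg n → ℂ} (hF : Sm F) (c : Hn n) (h : Hn n) {a : ℝ} (ha : 0 < a) :
    LD (c, 0) F (h, a) = HD c (fun h : Hn n => F (h, a)) h := by
  have h1 : HasFDerivAt (fun h : Hn n => ((h, a) : Sg n)) (ContinuousLinearMap.inl ℝ (Hn n) ℝ) h :=
    hasFDerivAt_prodMk_left h a
  have h2 := (hF.diffAt (p := (h, a)) ha).hasFDerivAt.comp h h1
  have h3 : fderiv ℝ (fun h : Hn n => F (h, a)) h
      = (fderiv ℝ F (h, a)).comp (ContinuousLinearMap.inl ℝ (Hn n) ℝ) := h2.fderiv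
  simp [HD, h3, LD, VF]

lemma wi_supp {n : ℕ} {φ : Hn n → ℂ} (hφ : HasCompactSupport φ) (w : Hn n) :
    HasCompactSupport (fun h => φ (wi w h)) :=
  hφ.comp_homeomorph (giHomeo w).symm

lemma wi_smooth {n : ℕ} (w : Hn n) : ContDiff ℝ (⊤ : ℕ∞) (wi w) := by
  unfold wi
  have : ContDiff ℝ (⊤ : ℕ∞) (fun h : Hn n => bt w.1 h.1) := bt_contDiff contDiff_const contDiff_fst
  fun_prop

lemma Cs_wi {n : ℕ} {φ : Hn n → ℂ} (hφ : Cs φ) (w : Hn n) : Cs (fun h => φ (wi w h)) :=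
  ⟨hφ.smooth.comp (wi_smooth w), wi_supp hφ.supp w⟩

lemma wi_fd {n : ℕ} (w h v : Hn n) :
    fderiv ℝ (wi w) h v = (-v.1, -v.2 - bt w.1 v.1) := by
  have h1 : HasDerivAt _ _ _ := ((wi_smooth w).differentiable (by simp) h).hasFDerivAt.hasLineDerivAt v
  have h2 : (fun t : ℝ => wi w (h + t • v)) = fun t : ℝ => wi w h + t • ((-v.1, -v.2 - bt w.1 v.1) : Hn n) := by
    funext t
    refine Prod.ext ?_ ?_
    · simp [wi]; abel
    · simp [wi, bt_add_right, bt_smul_right]; ring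
  rw [h2] at h1
  have h3 : HasDerivAt (fun t : ℝ => wi w h + t • ((-v.1, -v.2 - bt w.1 v.1) : Hn n))
      ((-v.1, -v.2 - bt w.1 v.1) : Hn n) 0 := by
    have := ((hasDerivAt_id (0:ℝ)).smul_const ((-v.1, -v.2 - bt w.1 v.1) : Hn n)).const_add (wi w h)
    rw [one_smul] at this
    exact this
  exact h1.unique h3

lemma HD_wi {n : ℕ} {φ : Hn n → ℂ} (hφ : Cs φ) (c w h : Hn n) :
    HD c (fun h => φ (wi w h)) h
      = -(RD c φ (wi w h) + 2 * (bt w.1 c.1 : ℂ) * fderiv ℝ φ (wi w h) (0, 1)) := by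
  have h1 := (hφ.smooth.differentiable (by simp) (wi w h)).hasFDerivAt.comp h
    ((wi_smooth w).differentiable (by simp) h).hasFDerivAt
  have h3 : fderiv ℝ (fun h : Hn n => φ (wi w h)) h
      = (fderiv ℝ φ (wi w h)).comp (fderiv ℝ (wi w) h) := h1.fderiv
  unfold HD RD
  rw [h3, ContinuousLinearMap.comp_apply, wi_fd]
  have e : ((-c.1, -(c.2 + bt h.1 c.1) - bt w.1 c.1) : Hn n)
      = -((c.1, (c.2 - bt (wi w h).1 c.1) + 2 * bt w.1 c.1) : Hn n) := by
    refine Prod.ext ?_ ?_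
    · simp
    · simp [wi, bt_sub_left]; ring
  rw [e, map_neg, fd_split]
  push_cast; ring

/-- M2. -/
lemma mol_LD {n : ℕ} {φ : Hn n → ℂ} (hφ : Cs φ) {F : Sg n → ℂ} (hF : Sm F) (c : Hn n) {p : Sg n}
    (hp : p ∈ Om n) :
    mol φ (LD (c, 0) F) p
      = mol (RD c φ) F p + 2 * (bt p.1.1 c.1 : ℂ) * mol (fun g => fderiv ℝ φ g (0, 1)) F p := by
  obtain ⟨w, a⟩ := p
  have ha : 0 < a := hp
  have hT := Cs_fd hφ (v := fun _ => (0, 1)) contDiff_const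
  have hR := Cs_RD hφ c
  have cF := (slice_smooth hF ha).continuous
  rw [mol_eq, mol_eq, mol_eq]
  simp only [LD_slice hF c _ ha]
  rw [ibp (Cs_wi hφ w) (slice_smooth hF ha) c, ← integral_neg]
  simp only [HD_wi hφ]
  rw [← integral_const_mul, ← integral_add]
  · congr 1; funext h; ring
  · exact ((Cs_wi hR w).smooth.continuous.mul cF).integrable_of_hasCompactSupport
      (Cs_wi hR w).supp.mul_right
  · exact (((Cs_wi hT w).smooth.continuous.mul cF).integrable_of_hasCompactSupport
      (Cs_wi hT w).supp.mul_right).const_mul _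

/-- bounded uniformly in `t` -/
def LBt {n : ℕ} (u : Sg n → ℂ) : Prop := ∀ R : ℝ, ∃ M, ∀ p ∈ Om n, ‖p.1.1‖ ≤ R → ‖u p‖ ≤ M

lemma LBt_of_bdd {n : ℕ} {F : Sg n → ℂ} {C : ℝ} (hC : ∀ p ∈ Om n, ‖F p‖ ≤ C)
    {φ : Hn n → ℂ} (hφ : Cs φ) : LBt (mol φ F) := fun R =>
  ⟨_, fun p hp _ => mol_norm hφ.cc hC hp⟩

lemma LBt_LD {n : ℕ} {F : Sg n → ℂ} (hF : Sm F) (hB : ∀ φ : Hn n → ℂ, Cs φ → LBt (mol φ F))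
    (c : Hn n) {φ : Hn n → ℂ} (hφ : Cs φ) : LBt (mol φ (LD (c, 0) F)) := by
  intro R
  have hT := Cs_fd hφ (v := fun _ => (0, 1)) contDiff_const
  have hR := Cs_RD hφ c
  obtain ⟨M1, h1⟩ := hB _ hR R
  obtain ⟨M2, h2⟩ := hB _ hT R
  obtain ⟨M3, h3⟩ := (isCompact_closedBall (0 : Fin n → ℂ) R).exists_bound_of_continuousOn
    (f := fun ζ => (bt ζ c.1 : ℂ)) (by
      apply Continuous.continuousOn
      have : Continuous (fun ζ : Fin n → ℂ => bt ζ c.1) := bt_continuous continuous_id continuous_const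
      fun_prop)
  refine ⟨M1 + 2 * M3 * M2, fun p hp hpR => ?_⟩
  rw [mol_LD hφ hF c hp]
  refine (norm_add_le _ _).trans ?_
  have a1 := h1 p hp hpR
  have a2 := h2 p hp hpR
  have a3 := h3 p.1.1 (by simpa using hpR)
  rw [norm_mul, norm_mul]
  have : (0:ℝ) ≤ M3 := (norm_nonneg _).trans a3
  gcongr
  simp

lemma mol_T_bdd {n : ℕ} {F : Sg n → ℂ} (hF : Sm F) {C : ℝ} (hC : ∀ p ∈ Om n, ‖F p‖ ≤ C)
    {φ : Hn n → ℂ} (hφ : Cs φ) : ∃ M, ∀ p ∈ Om n, ‖mol φ (LD (eTS n) F) p‖ ≤ M := by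
  refine ⟨C * ∫ g, ‖RD (eT n) φ g‖, fun p hp => ?_⟩
  unfold eTS
  rw [mol_LD hφ hF _ hp]
  simp only [eT, bt_zero_right]
  simp only [Complex.ofReal_zero, mul_zero, zero_mul, add_zero]
  exact mol_norm (Cs_RD hφ _).cc hC hp


/-! ### Boundary behaviour of mollifications -/

/-- extension of a boundary function, constant in `a` -/
def fS {n : ℕ} (f : Hn n → ℂ) : Sg n → ℂ := fun p => f p.1

lemma fS_Sm {n : ℕ} {f : Hn n → ℂ} (hf : ContDiff ℝ (⊤ : ℕ∞) f) : Sm (fS f) :=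
  (hf.comp contDiff_fst).contDiffOn

lemma wi_int_cont {n : ℕ} {φ : Hn n → ℂ} (hφ : Cc φ) (w0 : Hn n) :
    Tendsto (fun w => ∫ h, ‖φ (wi w h) - φ (wi w0 h)‖) (𝓝 w0) (𝓝 0) := by
  have hk : IsCompact ((fun x : Hn n × Hn n => giH x.1 x.2) ''
      (Metric.closedBall w0 1 ×ˢ tsupport φ)) :=
    ((isCompact_closedBall w0 1).prod hφ.supp).image giH_cont
  have hz : ∀ w ∈ Metric.closedBall w0 1, ∀ h, h ∉ ((fun x : Hn n × Hn n => giH x.1 x.2) ''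
      (Metric.closedBall w0 1 ×ˢ tsupport φ)) → φ (wi w h) = 0 := by
    intro w hw h hh
    apply image_eq_zero_of_notMem_tsupport
    intro hmem
    exact hh ⟨(w, wi w h), ⟨hw, hmem⟩, giH_wi w h⟩
  have hw0 : w0 ∈ Metric.closedBall w0 1 := Metric.mem_closedBall_self zero_le_one
  have hc : ContinuousOn (fun w => ∫ h, ‖φ (wi w h) - φ (wi w0 h)‖) (Metric.closedBall w0 1) := by
    refine continuousOn_integral_of_compact_support hk ?_ ?_
    · apply Continuous.continuousOn
      have h1 : Continuous (fun x : Hn n × Hn n => φ (wi x.1 x.2)) := hφ.cont.comp wi_cont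
      have h2 : Continuous (fun x : Hn n × Hn n => φ (wi w0 x.2)) :=
        hφ.cont.comp (wi_cont.comp (continuous_const.prodMk continuous_snd))
      exact (h1.sub h2).norm
    · intro w h hw hh
      rw [hz w hw h hh, hz w0 hw0 h hh]; simp
  have := (hc.continuousAt (Metric.closedBall_mem_nhds w0 one_pos)).tendsto
  simpa using this

lemma mol_bdry {n : ℕ} {φ : Hn n → ℂ} (hφ : Cc φ) {F : Sg n → ℂ} (hF : ContinuousOn F (Om n)) {C : ℝ}
    (hC : ∀ p ∈ Om n, ‖F p‖ ≤ C) {f : Hn n → ℂ} (hbv : IsBoundaryValue n F f) (w0 : Hn n) :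
    Tendsto (mol φ F) (𝓝[Om n] (w0, 0)) (𝓝 (mol φ (fS f) (w0, 1))) := by
  have hwc : ∀ w : Hn n, Integrable (fun h => φ (wi w h)) := fun w =>
    Continuous.integrable_of_hasCompactSupport
      (hφ.cont.comp (wi_cont.comp (continuous_const.prodMk continuous_id))) (wi_supp hφ.supp w)
  have hFa : ∀ w : Hn n, ∀ a : ℝ, 0 < a → Integrable (fun h => φ (wi w h) * F (h, a)) := by
    intro w a ha
    refine Continuous.integrable_of_hasCompactSupport ?_ (wi_supp hφ.supp w).mul_right
    refine (hφ.cont.comp (wi_cont.comp (continuous_const.prodMk continuous_id))).mul ?_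
    exact hF.comp_continuous (by fun_prop) (fun h => ha)
  have ha : Tendsto (fun p : Sg n => p.2) (𝓝[Om n] (w0, 0)) (𝓝[>] 0) := by
    refine tendsto_nhdsWithin_iff.2 ⟨?_, ?_⟩
    · exact (continuous_snd.tendsto ((w0, 0) : Sg n)).mono_left nhdsWithin_le_nhds
    · filter_upwards [self_mem_nhdsWithin] with p hp using hp
  have h1 := (hbv _ (hwc w0)).comp ha
  have h2 : Tendsto (fun p : Sg n => C * ∫ h, ‖φ (wi p.1 h) - φ (wi w0 h)‖) (𝓝[Om n] (w0, 0)) (𝓝 0) := by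
    have hc : Tendsto (fun p : Sg n => p.1) (𝓝[Om n] (w0, 0)) (𝓝 w0) :=
      (continuous_fst.tendsto ((w0, 0) : Sg n)).mono_left nhdsWithin_le_nhds
    simpa using ((wi_int_cont hφ w0).comp hc).const_mul C
  have h3 : Tendsto (fun p : Sg n => mol φ F p - ∫ w, F (w, p.2) * φ (wi w0 w)) (𝓝[Om n] (w0, 0))
      (𝓝 0) := by
    refine squeeze_zero_norm' ?_ h2
    filter_upwards [self_mem_nhdsWithin] with p hp
    have hp' : 0 < p.2 := hp
    have e : mol φ F p = ∫ h, φ (wi p.1 h) * F (h, p.2) := mol_eq φ F p.1 p.2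
    have e2 : ∫ w, F (w, p.2) * φ (wi w0 w) = ∫ h, φ (wi w0 h) * F (h, p.2) := by
      congr 1; funext h; ring
    rw [e, e2, ← integral_sub (hFa _ _ hp') (hFa _ _ hp'), ← integral_const_mul]
    refine norm_integral_le_of_norm_le (((hwc _).sub (hwc _)).norm.const_mul C)
      (Eventually.of_forall fun h => ?_)
    rw [← sub_mul, norm_mul, mul_comm]
    gcongr
    exact hC (h, p.2) hp
  have h4 := h3.add h1
  have e : mol φ (fS f) (w0, 1) = ∫ w, f w * φ (wi w0 w) := by
    rw [mol_eq]; congr 1; funext h; simp [fS]; ring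
  rw [e]
  simpa using h4

/-! ### A continuous function with vanishing mollifications vanishes -/

lemma cont_zero {n : ℕ} {u : Hn n → ℂ} (hu : Continuous u)
    (h : ∀ φ : Hn n → ℂ, Cs φ → ∫ g, φ g * u g = 0) (g : Hn n) : u g = 0 := by
  have := Hn_haar n
  have h1 : ∀ᵐ x ∂(volume : Measure (Hn n)), u x = 0 := by
    refine ae_eq_zero_of_integral_contDiff_smul_eq_zero hu.locallyIntegrable ?_
    intro φ hφ hs
    have := h (fun g => (φ g : ℂ)) ⟨Complex.ofRealCLM.contDiff.comp hφ,
      hs.comp_left (g := fun x : ℝ => (x : ℂ)) Complex.ofReal_zero⟩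
    simpa [Complex.real_smul] using this
  have h2 : u =ᵐ[volume] (fun _ => 0) := h1
  exact congrFun (Continuous.ae_eq_iff_eq volume hu continuous_const |>.1 h2) g

lemma mol_zero {n : ℕ} {F : Sg n → ℂ} (hF : Sm F)
    (h : ∀ φ : Hn n → ℂ, Cs φ → ∀ p ∈ Om n, mol φ F p = 0) {p : Sg n} (hp : p ∈ Om n) : F p = 0 := by
  have h1 := cont_zero (u := fun g => F (gi g p)) (Fgi_cont hF.continuousOn hp)
    (fun φ hφ => h φ hφ p hp) 0
  have h2 : gi 0 p = p := by simp [gi, bt_zero_right]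
  rwa [h2] at h1

/-! ### Relation of the operators on the group with those on the extension -/

lemma XH_eq {n : ℕ} (j : Fin n) : XH n j = HD (eX n j) := by
  funext f h
  have : (((eX n j).1, (eX n j).2 + bt h.1 (eX n j).1) : Hn n) = eX n j + (2 * (h.1 j).im) • eT n := by
    simp [eX, eT, bt]; simp [apply_ite]
  simp [XH, HD, this, dirD]

lemma YH_eq {n : ℕ} (j : Fin n) : YH n j = HD (eY n j) := by
  funext f h
  have : (((eY n j).1, (eY n j).2 + bt h.1 (eY n j).1) : Hn n) = eY n j - (2 * (h.1 j).re) • eT n := by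
    simp [eY, eT, bt]; simp [apply_ite]
  simp [YH, HD, this, dirD]

lemma TH_eq {n : ℕ} : TH n = HD (eT n) := by
  funext f h
  simp [TH, HD, dirD, eT, bt_zero_right]

lemma HD_smooth {n : ℕ} {f : Hn n → ℂ} (hf : ContDiff ℝ (⊤ : ℕ∞) f) (c : Hn n) :
    ContDiff ℝ (⊤ : ℕ∞) (HD c f) := fd_smooth hf (HDv_smooth c)

lemma LD_fS {n : ℕ} {f : Hn n → ℂ} (hf : ContDiff ℝ (⊤ : ℕ∞) f) (c : Hn n) {p : Sg n} (hp : p ∈ Om n) :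
    LD (c, 0) (fS f) p = fS (HD c f) p :=
  LD_slice (fS_Sm hf) c p.1 (a := p.2) hp

lemma LD2_fS {n : ℕ} {f : Hn n → ℂ} (hf : ContDiff ℝ (⊤ : ℕ∞) f) (c : Hn n) {p : Sg n} (hp : p ∈ Om n) :
    LD (c, 0) (LD (c, 0) (fS f)) p = fS (HD c (HD c f)) p := by
  rw [LD_congr (fun q hq => LD_fS hf c hq) hp, LD_fS (HD_smooth hf c) c hp]

lemma LD_A_fS {n : ℕ} {f : Hn n → ℂ} (hf : ContDiff ℝ (⊤ : ℕ∞) f) {p : Sg n} (hp : p ∈ Om n) :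
    LD (eA n) (fS f) p = 0 := by
  have h1 := hasDerivAt_line (c := eA n) (fS_Sm hf) (p := p) (s := 0) (by simpa using hp)
  have h2 : (fun r : ℝ => fS f (p + r • VF (eA n) p)) = fun _ => fS f p := by
    funext r
    have : (p + r • VF (eA n) p).1 = p.1 := by
      refine Prod.ext ?_ ?_ <;> simp [VF, eA, bt_zero_right]
    simp [fS, this]
  rw [h2] at h1
  simpa using h1.unique (hasDerivAt_const _ _)

lemma LH_fS {n : ℕ} {f : Hn n → ℂ} (hf : ContDiff ℝ (⊤ : ℕ∞) f) {p : Sg n} (hp : p ∈ Om n) :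
    LH n (-(n:ℝ)) f p.1 = -(Qo (fS f) p + Complex.I * n * LD (eTS n) (fS f) p) := by
  unfold LH Qo
  rw [LD_A_fS hf hp]
  unfold eXS eYS eTS
  simp only [LD2_fS hf _ hp, LD_fS hf _ hp, XH_eq, YH_eq, TH_eq, fS]
  push_cast; ring

/-! ### The forward direction -/

lemma forward {n : ℕ} {F : Sg n → ℂ} (hF : Sm F) {f : Hn n → ℂ} (hf : ContDiff ℝ (⊤ : ℕ∞) f)
    (hbv : IsBoundaryValue n F f) (hA : IsAntiHolo n F) (w : Hn n) : LH n (-(n:ℝ)) f w = 0 := by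
  have hA' := (antiHolo_iff hF).1 hA
  -- limits of derivatives
  have hlim : ∀ φ : Hn n → ℂ, Cs φ → ∀ c : Hn n,
      Tendsto (fun a : ℝ => ∫ h, φ h * LD (c, 0) F (h, a)) (𝓝[>] 0) (𝓝 (∫ h, φ h * HD c f h)) := by
    intro φ hφ c
    have h1 := (hbv _ (Cs_HD hφ c).cc.int).neg
    have e : ∫ h, φ h * HD c f h = -∫ h, f h * HD c φ h := by
      rw [ibp hφ hf]; congr 1; congr 1; funext h; ring
    rw [e]
    refine h1.congr' ?_
    filter_upwards [self_mem_nhdsWithin] with a ha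
    have ha' : 0 < a := ha
    simp only [LD_slice hF c _ ha']
    rw [ibp hφ (slice_smooth hF ha')]; congr 1; congr 1; funext h; ring
  have hZ : ∀ j : Fin n, ∀ h, HD (eX n j) f h - Complex.I * HD (eY n j) f h = 0 := by
    intro j
    apply cont_zero
    · exact (HD_smooth hf _).continuous.sub (continuous_const.mul (HD_smooth hf _).continuous)
    · intro φ hφ
      have l1 := hlim φ hφ (eX n j)
      have l2 := (hlim φ hφ (eY n j)).const_mul Complex.I
      have l3 : Tendsto (fun a : ℝ => ∫ h, φ h * LD (eX n j, 0) F (h, a)) (𝓝[>] 0)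
          (𝓝 (Complex.I * ∫ h, φ h * HD (eY n j) f h)) := by
        refine l2.congr' ?_
        filter_upwards [self_mem_nhdsWithin] with a ha
        rw [← integral_const_mul]
        congr 1; funext h
        have := (hA' (h, a) ha).1 j
        unfold eXS eYS at this
        rw [this]; ring
      have l4 := tendsto_nhds_unique l1 l3
      have i1 : Integrable (fun h => φ h * HD (eX n j) f h) :=
        (hφ.smooth.continuous.mul (HD_smooth hf _).continuous).integrable_of_hasCompactSupport
          hφ.supp.mul_right
      have i2 : Integrable (fun h => φ h * HD (eY n j) f h) :=
        (hφ.smooth.continuous.mul (HD_smooth hf _).continuous).integrable_of_hasCompactSupport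
          hφ.supp.mul_right
      have : ∀ h, φ h * (HD (eX n j) f h - Complex.I * HD (eY n j) f h)
          = φ h * HD (eX n j) f h - Complex.I * (φ h * HD (eY n j) f h) := by intro h; ring
      simp only [this]
      rw [integral_sub i1 (i2.const_mul _), integral_const_mul, l4, sub_self]
  have hp : ((w, 1) : Sg n) ∈ Om n := (one_pos : (0:ℝ) < 1)
  have := LH_fS hf hp
  simp only at this
  rw [this, Qo_eq_ZbZ (fS_Sm hf) hp, LD_A_fS hf hp]
  have hz0 : ∀ j : Fin n, ∀ q ∈ Om n, Zo j (fS f) q = 0 := by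
    intro j q hq
    have := hZ j q.1
    unfold Zo eXS eYS
    rw [LD_fS hf _ hq, LD_fS hf _ hq]
    simp only [fS, this, mul_zero]
  have hz1 : ∀ j : Fin n, Zbo j (Zo j (fS f)) (w, 1) = 0 := by
    intro j
    unfold Zbo
    rw [LD_congr (G := fun _ => 0) (hz0 j) hp, LD_congr (G := fun _ => 0) (hz0 j) hp]
    simp [LD_const]
  simp [hz1]


/-! ### Gaussian regularisation in the central variable -/

/-- The complex Gaussian. -/
def gam (β : ℝ) (z : ℂ) : ℂ := ((β / √Real.pi : ℝ) : ℂ) * Complex.exp (-(β : ℂ) ^ 2 * z ^ 2)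

lemma gam_norm {β : ℝ} (hβ : 0 < β) (z : ℂ) :
    ‖gam β z‖ = β / √Real.pi * Real.exp (-β ^ 2 * z.re ^ 2) * Real.exp (β ^ 2 * z.im ^ 2) := by
  unfold gam
  rw [norm_mul, Complex.norm_exp, mul_assoc, ← Real.exp_add, Complex.norm_real, Real.norm_of_nonneg (by positivity)]
  congr 2
  have : -(β : ℂ) ^ 2 * z ^ 2 = ((-β ^ 2 : ℝ) : ℂ) * z ^ 2 := by push_cast; ring
  rw [this, Complex.re_ofReal_mul, pow_two z, Complex.mul_re]; ring

lemma gam_cont (β : ℝ) : Continuous (gam β) := by unfold gam; fun_prop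

lemma gauss_integrable {β : ℝ} (hβ : 0 < β) :
    Integrable (fun s : ℝ => β / √Real.pi * Real.exp (-β ^ 2 * s ^ 2)) := by
  refine Integrable.const_mul ?_ _
  have := integrable_exp_neg_mul_sq (b := β ^ 2) (by positivity)
  simpa using this

lemma gauss_int {β : ℝ} (hβ : 0 < β) :
    ∫ s : ℝ, β / √Real.pi * Real.exp (-β ^ 2 * s ^ 2) = 1 := by
  rw [integral_const_mul]
  have := integral_gaussian (β ^ 2)
  rw [this, Real.sqrt_div Real.pi_pos.le, Real.sqrt_sq hβ.le]
  have : √Real.pi ≠ 0 := (Real.sqrt_pos.2 Real.pi_pos).ne'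
  field_simp

lemma gauss_int_abs : ∃ K : ℝ, 0 ≤ K ∧ ∀ β : ℝ, 0 < β →
    Integrable (fun s : ℝ => β / √Real.pi * Real.exp (-β ^ 2 * s ^ 2) * |s|) ∧
    ∫ s : ℝ, β / √Real.pi * Real.exp (-β ^ 2 * s ^ 2) * |s| = K / β := by
  have h1 : Integrable (fun x : ℝ => 1 / √Real.pi * (Real.exp (-x ^ 2) * |x|)) := by
    refine Integrable.const_mul ?_ _
    have := (integrable_mul_exp_neg_mul_sq (b := 1) one_pos).norm
    refine this.congr (Eventually.of_forall fun x => ?_)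
    simp [abs_mul, mul_comm]
  refine ⟨∫ x : ℝ, 1 / √Real.pi * (Real.exp (-x ^ 2) * |x|), ?_, ?_⟩
  · apply integral_nonneg; intro x; positivity
  · intro β hβ
    have e : (fun s : ℝ => β / √Real.pi * Real.exp (-β ^ 2 * s ^ 2) * |s|)
       = fun s => (fun x : ℝ => 1 / √Real.pi * (Real.exp (-x ^ 2) * |x|)) (β * s) := by
      funext s
      simp only [abs_mul, abs_of_pos hβ]
      rw [show -(β * s) ^ 2 = -β ^ 2 * s ^ 2 by ring]; ring
    rw [e]
    refine ⟨h1.comp_mul_left' hβ.ne', ?_⟩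
    rw [Measure.integral_comp_mul_left (fun x : ℝ => 1 / √Real.pi * (Real.exp (-x ^ 2) * |x|)) β,
      abs_of_pos (inv_pos.2 hβ), smul_eq_mul]
    exact (div_eq_inv_mul _ _).symm

/-- Convolution with the Gaussian at a complex point. -/
def gg (β : ℝ) (k : ℝ → ℂ) (z : ℂ) : ℂ := ∫ s : ℝ, gam β (z - s) * k s

lemma gg_diff {β : ℝ} (hβ : 0 < β) {k : ℝ → ℂ} (hk : Continuous k) {M : ℝ} (hM : ∀ s, ‖k s‖ ≤ M) :
    Differentiable ℂ (gg β k) := by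
  intro z0
  set R : ℝ := ‖z0‖ + 1 with hR
  have hRn : 0 ≤ R := by positivity
  have hM0 : 0 ≤ M := (norm_nonneg _).trans (hM 0)
  have hc1 : ∀ z : ℂ, Continuous (fun s : ℝ => gam β (z - s) * k s) := fun z =>
    ((gam_cont β).comp (by fun_prop)).mul hk
  have hest : ∀ z ∈ Metric.ball z0 1, ∀ s : ℝ,
      ‖gam β (z - s)‖ ≤ (β / √Real.pi * Real.exp (β ^ 2 * R ^ 2) * Real.exp (β ^ 2 * R ^ 2))
        * Real.exp (-(β ^ 2 / 2) * s ^ 2) := by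
    intro z hz s
    have hzn : ‖z‖ ≤ R := by
      have : ‖z - z0‖ < 1 := by simpa [dist_eq_norm] using hz
      have h2 : ‖z‖ ≤ ‖z - z0‖ + ‖z0‖ := by simpa using norm_add_le (z - z0) z0
      linarith
    have h1 : |z.re| ≤ R := (Complex.abs_re_le_norm z).trans hzn
    have h2 : |z.im| ≤ R := (Complex.abs_im_le_norm z).trans hzn
    have h1' : z.re ^ 2 ≤ R ^ 2 := sq_le_sq' (by linarith [(abs_le.1 h1).1]) (abs_le.1 h1).2
    have h2' : z.im ^ 2 ≤ R ^ 2 := sq_le_sq' (by linarith [(abs_le.1 h2).1]) (abs_le.1 h2).2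
    rw [gam_norm hβ]
    simp only [Complex.sub_re, Complex.ofReal_re, Complex.sub_im, Complex.ofReal_im, sub_zero]
    rw [mul_assoc, mul_assoc, mul_assoc, ← Real.exp_add, ← Real.exp_add, ← Real.exp_add]
    refine mul_le_mul_of_nonneg_left (Real.exp_le_exp.2 ?_) (by positivity)
    have h3 : s ^ 2 / 2 - z.re ^ 2 ≤ (z.re - s) ^ 2 := by nlinarith [sq_nonneg (2 * z.re - s)]
    have hb : 0 < β ^ 2 := by positivity
    nlinarith [mul_le_mul_of_nonneg_left h3 hb.le, mul_le_mul_of_nonneg_left h1' hb.le,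
      mul_le_mul_of_nonneg_left h2' hb.le]
  have hgi : Integrable (fun s : ℝ => Real.exp (-(β ^ 2 / 2) * s ^ 2)) :=
    integrable_exp_neg_mul_sq (by positivity)
  have hgi2 : Integrable (fun s : ℝ => |s| * Real.exp (-(β ^ 2 / 2) * s ^ 2)) := by
    have := (integrable_mul_exp_neg_mul_sq (b := β ^ 2 / 2) (by positivity)).norm
    refine this.congr (Eventually.of_forall fun x => ?_)
    simp [abs_mul]
  have hder : ∀ z : ℂ, ∀ s : ℝ, HasDerivAt (fun z : ℂ => gam β (z - s) * k s)
      (-2 * (β:ℂ) ^ 2 * (z - s) * gam β (z - s) * k s) z := by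
    intro z s
    unfold gam
    have h1 : HasDerivAt (fun z : ℂ => -(β : ℂ) ^ 2 * (z - s) ^ 2) (-(β : ℂ) ^ 2 * (2 * (z - s))) z := by
      have := (((hasDerivAt_id z).sub_const (s:ℂ)).pow 2).const_mul (-(β : ℂ) ^ 2)
      simpa using this
    have h2 := (h1.cexp.const_mul ((β / √Real.pi : ℝ) : ℂ)).mul_const (k s)
    exact h2.congr_deriv (by ring)
  set A := (β / √Real.pi * Real.exp (β ^ 2 * R ^ 2) * Real.exp (β ^ 2 * R ^ 2)) with hA
  have hA0 : 0 ≤ A := by positivity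
  have := (hasDerivAt_integral_of_dominated_loc_of_deriv_le (s := Metric.ball z0 1) (μ := volume)
    (bound := fun s : ℝ => 2 * β ^ 2 * A * M * (R * Real.exp (-(β ^ 2 / 2) * s ^ 2)
      + |s| * Real.exp (-(β ^ 2 / 2) * s ^ 2)))
    (F := fun (z : ℂ) (s : ℝ) => gam β (z - s) * k s)
    (F' := fun (z : ℂ) (s : ℝ) => -2 * (β:ℂ) ^ 2 * (z - s) * gam β (z - s) * k s)
    (Metric.ball_mem_nhds z0 one_pos) ?_ ?_ ?_ ?_ ?_ ?_).2
  · exact this.differentiableAt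
  · exact Eventually.of_forall fun z => (hc1 z).aestronglyMeasurable
  · refine Integrable.mono' (g := fun s => A * Real.exp (-(β ^ 2 / 2) * s ^ 2) * M)
      ((hgi.const_mul A).mul_const M) (hc1 z0).aestronglyMeasurable (Eventually.of_forall fun s => ?_)
    rw [norm_mul]
    gcongr
    · exact hest z0 (Metric.mem_ball_self one_pos) s
    · exact hM s
  · apply Continuous.aestronglyMeasurable
    have : Continuous (fun s : ℝ => gam β (z0 - s)) := (gam_cont β).comp (by fun_prop)
    fun_prop
  · refine Eventually.of_forall fun s z hz => ?_
    have hzn : ‖z‖ ≤ R := by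
      have : ‖z - z0‖ < 1 := by simpa [dist_eq_norm] using hz
      have h2 : ‖z‖ ≤ ‖z - z0‖ + ‖z0‖ := by simpa using norm_add_le (z - z0) z0
      linarith
    have h1 : ‖z - s‖ ≤ R + |s| := (norm_sub_le _ _).trans (by
      rw [Complex.norm_real, Real.norm_eq_abs]; linarith)
    have h2 := hest z hz s
    have h3 := hM s
    calc ‖-2 * (β:ℂ) ^ 2 * (z - s) * gam β (z - s) * k s‖
        = 2 * β ^ 2 * ‖z - s‖ * ‖gam β (z - s)‖ * ‖k s‖ := by
          simp [abs_of_pos hβ]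
      _ ≤ 2 * β ^ 2 * (R + |s|) * (A * Real.exp (-(β ^ 2 / 2) * s ^ 2)) * M := by gcongr
      _ = _ := by ring
  · exact ((hgi.const_mul R).add hgi2).const_mul _
  · exact Eventually.of_forall fun s z _ => hder z s

/-- Continuous, bounded uniformly in the central variable. -/
structure NB {n : ℕ} (v : Hn n → ℂ) : Prop where
  cont : Continuous v
  bdd : ∀ R : ℝ, ∃ M, ∀ w : Hn n, ‖w.1‖ ≤ R → ‖v w‖ ≤ M

/-- The regularised extension. -/
def Gb {n : ℕ} (β : ℝ) (v : Hn n → ℂ) (p : Sg n) : ℂ :=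
  ∫ s : ℝ, gam β (s - Complex.I * p.2) * v (p.1.1, p.1.2 - s)

lemma Gb_eq_gg {n : ℕ} (β : ℝ) (v : Hn n → ℂ) (p : Sg n) :
    Gb β v p = gg β (fun s => v (p.1.1, s)) (p.1.2 - Complex.I * p.2) := by
  unfold Gb gg
  rw [← integral_sub_left_eq_self _ volume p.1.2]
  congr 1; funext s
  push_cast
  congr 2
  · ring
  · simp

lemma gam_norm_sI {β : ℝ} (hβ : 0 < β) (s a : ℝ) :
    ‖gam β (s - Complex.I * a)‖ = β / √Real.pi * Real.exp (-β ^ 2 * s ^ 2) * Real.exp (β ^ 2 * a ^ 2) := by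
  rw [gam_norm hβ]; simp

lemma Gb_int {n : ℕ} {β : ℝ} (hβ : 0 < β) {v : Hn n → ℂ} (hv : NB v) (p : Sg n) :
    Integrable (fun s : ℝ => gam β (s - Complex.I * p.2) * v (p.1.1, p.1.2 - s)) := by
  obtain ⟨M, hM⟩ := hv.bdd ‖p.1.1‖
  refine Integrable.mono' (g := fun s => β / √Real.pi * Real.exp (-β ^ 2 * s ^ 2) *
    Real.exp (β ^ 2 * p.2 ^ 2) * M) (((gauss_integrable hβ).mul_const _).mul_const _) ?_
    (Eventually.of_forall fun s => ?_)
  · apply Continuous.aestronglyMeasurable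
    exact ((gam_cont β).comp (by fun_prop)).mul (hv.cont.comp (by fun_prop))
  · rw [norm_mul, gam_norm_sI hβ]
    gcongr
    exact hM _ le_rfl

lemma Gb_cont {n : ℕ} {β : ℝ} (hβ : 0 < β) {v : Hn n → ℂ} (hv : NB v) : Continuous (Gb β v) := by
  rw [continuous_iff_continuousAt]
  intro p0
  obtain ⟨M, hM⟩ := hv.bdd (‖p0‖ + 1)
  have hball : ∀ᶠ p : Sg n in 𝓝 p0, ‖p‖ < ‖p0‖ + 1 :=
    continuous_norm.continuousAt.eventually_lt_const (by linarith)
  refine continuousAt_of_dominated (bound := fun s => β / √Real.pi * Real.exp (-β ^ 2 * s ^ 2) *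
    Real.exp (β ^ 2 * (‖p0‖ + 1) ^ 2) * M) ?_ ?_ ?_ ?_
  · exact Eventually.of_forall fun p => (Gb_int hβ hv p).aestronglyMeasurable
  · filter_upwards [hball] with p hp
    refine Eventually.of_forall fun s => ?_
    rw [norm_mul, gam_norm_sI hβ]
    have h1 : ‖p.1.1‖ ≤ ‖p0‖ + 1 := ((norm_fst_le p.1).trans (norm_fst_le p)).trans hp.le
    have h2 : |p.2| ≤ ‖p0‖ + 1 := (norm_snd_le p).trans hp.le
    have h3 : p.2 ^ 2 ≤ (‖p0‖ + 1) ^ 2 := sq_le_sq' (by linarith [(abs_le.1 h2).1]) (abs_le.1 h2).2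
    gcongr
    exact hM _ h1
  · exact ((gauss_integrable hβ).mul_const _).mul_const _
  · refine Eventually.of_forall fun s => Continuous.continuousAt ?_
    exact ((gam_cont β).comp (by fun_prop)).mul (hv.cont.comp (by fun_prop))

/-- derivatives along the left invariant fields pass to the regularisation -/
lemma Gb_hasDerivAt {n : ℕ} {β : ℝ} (hβ : 0 < β) {v v' : Hn n → ℂ} (hv : NB v) (hv' : NB v') (c : Hn n)
    (hd : ∀ (w : Hn n) (s : ℝ), HasDerivAt (fun r : ℝ => v (w + r • ((c.1, c.2 + bt w.1 c.1) : Hn n)))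
      (v' (w + s • ((c.1, c.2 + bt w.1 c.1) : Hn n))) s) (p : Sg n) (s : ℝ) :
    HasDerivAt (fun r : ℝ => Gb β v (p + r • VF (c, 0) p)) (Gb β v' (p + s • VF (c, 0) p)) s := by
  have hpt : ∀ r x : ℝ, (((p + r • VF (c, 0) p).1.1, (p + r • VF (c, 0) p).1.2 - x) : Hn n)
      = ((p.1.1, p.1.2 - x) : Hn n) + r • ((c.1, c.2 + bt p.1.1 c.1) : Hn n) := by
    intro r x
    refine Prod.ext ?_ ?_
    · simp [VF]
    · simp [VF]; ring
  have hp2 : ∀ r : ℝ, (p + r • VF (c, 0) p).2 = p.2 := by intro r; simp [VF]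
  have hlc : Continuous (fun r : ℝ => (p + r • VF (c, 0) p).1.1) := by fun_prop
  obtain ⟨R, hR⟩ : ∃ R, ∀ r ∈ Metric.closedBall s 1, ‖(p + r • VF (c, 0) p).1.1‖ ≤ R :=
    (isCompact_closedBall s 1).exists_bound_of_continuousOn hlc.continuousOn
  obtain ⟨M, hM⟩ := hv'.bdd R
  refine (hasDerivAt_integral_of_dominated_loc_of_deriv_le (s := Metric.ball s 1) (μ := volume)
    (bound := fun x : ℝ => β / √Real.pi * Real.exp (-β ^ 2 * x ^ 2) *
    Real.exp (β ^ 2 * p.2 ^ 2) * M)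
    (F := fun r (x : ℝ) => gam β (x - Complex.I * (p + r • VF (c, 0) p).2) *
      v ((p + r • VF (c, 0) p).1.1, (p + r • VF (c, 0) p).1.2 - x))
    (F' := fun r (x : ℝ) => gam β (x - Complex.I * (p + r • VF (c, 0) p).2) *
      v' ((p + r • VF (c, 0) p).1.1, (p + r • VF (c, 0) p).1.2 - x))
    (Metric.ball_mem_nhds s one_pos) ?_ ?_ ?_ ?_ ?_ ?_).2
  · exact Eventually.of_forall fun r => (Gb_int hβ hv _).aestronglyMeasurable
  · exact Gb_int hβ hv _
  · exact (Gb_int hβ hv' _).aestronglyMeasurable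
  · refine Eventually.of_forall fun x r hr => ?_
    rw [norm_mul, gam_norm_sI hβ, hp2]
    gcongr
    exact hM _ (hR r (Metric.ball_subset_closedBall hr))
  · exact ((gauss_integrable hβ).mul_const _).mul_const _
  · refine Eventually.of_forall fun x r hr => ?_
    simp only [hpt, hp2]
    exact (hd (p.1.1, p.1.2 - x) r).const_mul _

lemma Gb_norm {n : ℕ} {β : ℝ} (hβ : 0 < β) {v : Hn n → ℂ} {M : ℝ} (hM : ∀ w, ‖v w‖ ≤ M) (p : Sg n) :
    ‖Gb β v p‖ ≤ M * Real.exp (β ^ 2 * p.2 ^ 2) := by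
  have : M * Real.exp (β ^ 2 * p.2 ^ 2) = ∫ s : ℝ, β / √Real.pi * Real.exp (-β ^ 2 * s ^ 2) *
      Real.exp (β ^ 2 * p.2 ^ 2) * M := by
    rw [integral_mul_const, integral_mul_const, gauss_int hβ]; ring
  rw [this]
  refine norm_integral_le_of_norm_le (((gauss_integrable hβ).mul_const _).mul_const _)
    (Eventually.of_forall fun s => ?_)
  rw [norm_mul, gam_norm_sI hβ]
  gcongr
  exact hM _

lemma Gb_approx {n : ℕ} {β : ℝ} (hβ : 0 < β) {v : Hn n → ℂ} (hv : NB v) {L K : ℝ}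
    (hL : ∀ (ζ : Fin n → ℂ) (t s : ℝ), ‖v (ζ, t - s) - v (ζ, t)‖ ≤ L * |s|)
    (hK1 : Integrable (fun s : ℝ => β / √Real.pi * Real.exp (-β ^ 2 * s ^ 2) * |s|))
    (hK : ∫ s : ℝ, β / √Real.pi * Real.exp (-β ^ 2 * s ^ 2) * |s| = K / β) (w : Hn n) :
    ‖Gb β v (w, 0) - v w‖ ≤ L * (K / β) := by
  have h1 : v w = ∫ s : ℝ, gam β (s - Complex.I * ((0:ℝ):ℂ)) * v w := by
    rw [integral_mul_const]
    have : ∀ s : ℝ, gam β (s - Complex.I * ((0:ℝ):ℂ))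
        = ((β / √Real.pi * Real.exp (-β ^ 2 * s ^ 2) : ℝ) : ℂ) := by
      intro s; unfold gam; push_cast; simp
    simp only [this]
    rw [integral_complex_ofReal, gauss_int hβ]; simp
  have i1 := Gb_int hβ hv (w, 0)
  have i2 : Integrable (fun s : ℝ => gam β (s - Complex.I * ((0:ℝ):ℂ)) * v w) := by
    refine Integrable.mul_const ?_ _
    refine Integrable.mono' (gauss_integrable hβ) ?_ (Eventually.of_forall fun s => ?_)
    · apply Continuous.aestronglyMeasurable
      exact (gam_cont β).comp (by fun_prop)
    · rw [gam_norm_sI hβ]; simp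
  rw [← hK, ← integral_const_mul]
  have e : Gb β v (w, 0) - v w = ∫ s : ℝ, (gam β (s - Complex.I * ((0:ℝ):ℂ)) * v (w.1, w.2 - s)
      - gam β (s - Complex.I * ((0:ℝ):ℂ)) * v w) := by
    rw [integral_sub i1 i2, ← h1]; rfl
  rw [e]
  refine norm_integral_le_of_norm_le (hK1.const_mul L) (Eventually.of_forall fun s => ?_)
  rw [← mul_sub, norm_mul, gam_norm_sI hβ]
  have := hL w.1 w.2 s
  calc _ ≤ β / √Real.pi * Real.exp (-β ^ 2 * s ^ 2) * Real.exp (β ^ 2 * 0 ^ 2) * (L * |s|) := by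
        gcongr
    _ = _ := by simp; ring


/-! ### Line data for the operators -/

/-- `U` has second order line data at `p` with `Q`-value `q` and `(∂_a² + T²)`-value `l`. -/
def LQ {n : ℕ} (U : Sg n → ℂ) (p : Sg n) (q l : ℂ) : Prop :=
  ∃ (x1 x2 y1 y2 : Fin n → ℂ) (t1 t2 a1 a2 : ℂ),
    (∀ j, HL2 (fun r => U (p + r • VF (eXS n j) p)) (x1 j) (x2 j)) ∧
    (∀ j, HL2 (fun r => U (p + r • VF (eYS n j) p)) (y1 j) (y2 j)) ∧
    HL2 (fun r => U (p + r • VF (eTS n) p)) t1 t2 ∧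
    HL2 (fun r => U (p + r • VF (eA n) p)) a1 a2 ∧
    q = (1/4) * ∑ j, (x2 j + y2 j) - n * a1 ∧ l = a2 + t2

lemma LQ_add {n : ℕ} {U V : Sg n → ℂ} {p : Sg n} {q l q' l' : ℂ} (h : LQ U p q l) (h' : LQ V p q' l') :
    LQ (fun x => U x + V x) p (q + q') (l + l') := by
  obtain ⟨x1, x2, y1, y2, t1, t2, a1, a2, hx, hy, ht, ha, hq, hl⟩ := h
  obtain ⟨x1', x2', y1', y2', t1', t2', a1', a2', hx', hy', ht', ha', hq', hl'⟩ := h'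
  refine ⟨_, _, _, _, _, _, _, _, fun j => (hx j).add (hx' j), fun j => (hy j).add (hy' j),
    ht.add ht', ha.add ha', ?_, ?_⟩
  · rw [hq, hq']
    have : ∑ j, (x2 j + x2' j + (y2 j + y2' j)) = ∑ j, (x2 j + y2 j) + ∑ j, (x2' j + y2' j) := by
      rw [← Finset.sum_add_distrib]; congr 1; funext j; ring
    rw [this]; ring
  · rw [hl, hl']; ring

lemma LQ_cmul {n : ℕ} {U : Sg n → ℂ} {p : Sg n} {q l : ℂ} (k : ℂ) (h : LQ U p q l) :
    LQ (fun x => k * U x) p (k * q) (k * l) := by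
  obtain ⟨x1, x2, y1, y2, t1, t2, a1, a2, hx, hy, ht, ha, hq, hl⟩ := h
  refine ⟨_, _, _, _, _, _, _, _, fun j => (hx j).cmul k, fun j => (hy j).cmul k,
    ht.cmul k, ha.cmul k, ?_, ?_⟩
  · rw [hq]
    have : ∑ j, (k * x2 j + k * y2 j) = k * ∑ j, (x2 j + y2 j) := by
      rw [Finset.mul_sum]; congr 1; funext j; ring
    rw [this]; ring
  · rw [hl]; ring

lemma LQ_of_Sm {n : ℕ} {F : Sg n → ℂ} (hF : Sm F) {p : Sg n} (hp : p ∈ Om n) :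
    LQ F p (Qo F p) (LD (eA n) (LD (eA n) F) p + LD (eTS n) (LD (eTS n) F) p) :=
  ⟨_, _, _, _, _, _, _, _, fun j => HL2_of_Sm hF _ hp, fun j => HL2_of_Sm hF _ hp,
    HL2_of_Sm hF _ hp, HL2_of_Sm hF _ hp, rfl, rfl⟩

lemma LQ_localMax {n : ℕ} {U : Sg n → ℂ} {p : Sg n} {q l : ℂ} (h : LQ U p q l)
    (hm : IsLocalMax (fun x => (U x).re) p) : q.re ≤ 0 ∧ l.re ≤ 0 := by
  obtain ⟨x1, x2, y1, y2, t1, t2, a1, a2, hx, hy, ht, ha, hq, hl⟩ := h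
  have kx := fun j => (hx j).localMax (line_localMax hm _)
  have ky := fun j => (hy j).localMax (line_localMax hm _)
  have kt := ht.localMax (line_localMax hm _)
  have ka := ha.localMax (line_localMax hm _)
  constructor
  · rw [hq]
    have h1 : (∑ j, (x2 j + y2 j)).re ≤ 0 := by
      rw [Complex.re_sum]
      apply Finset.sum_nonpos
      intro j _
      rw [Complex.add_re]
      linarith [(kx j).2, (ky j).2]
    have e1 : ((1/4 : ℂ) * ∑ j, (x2 j + y2 j)).re = (1/4) * (∑ j, (x2 j + y2 j)).re := by
      rw [show (1/4 : ℂ) = ((1/4 : ℝ) : ℂ) by push_cast; rfl, Complex.re_ofReal_mul]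
    have e2 : ((n : ℂ) * a1).re = n * a1.re := by
      rw [show (n : ℂ) = ((n : ℝ) : ℂ) by push_cast; rfl, Complex.re_ofReal_mul]
    rw [Complex.sub_re, e1, e2, ka.1]; linarith
  · rw [hl, Complex.add_re]; linarith [kt.2, ka.2]

lemma LQ_psi {n : ℕ} {p : Sg n} (hp : p ∈ Om n) : LQ (fun p : Sg n => (psi p : ℂ)) p 0 0 := by
  have := LQ_of_Sm (psi_Sm (n := n)) hp
  rwa [Qo_psi hp, lap_psi hp] at this

lemma LQ_fa {n : ℕ} {g : ℝ → ℝ} (hg : ContDiff ℝ (⊤ : ℕ∞) g) {p : Sg n} (hp : p ∈ Om n) :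
    LQ (fun p : Sg n => ((g p.2 : ℝ) : ℂ)) p ((-(n * deriv g p.2) : ℝ) : ℂ)
      ((deriv (deriv g) p.2 : ℝ) : ℂ) := by
  have := LQ_of_Sm (fa_Sm (n := n) hg) hp
  rw [Qo_fa hg] at this
  convert this using 1
  have h1 : LD (eA n) (fun p : Sg n => ((g p.2 : ℝ) : ℂ)) = fun p : Sg n => ((deriv g p.2 : ℝ) : ℂ) := by
    funext q; rw [LD_fa hg]; simp [eA]
  have hg' : ContDiff ℝ (⊤ : ℕ∞) (deriv g) := ContDiff.deriv' (n := (⊤ : ℕ∞)) (by simpa using hg)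
  rw [h1, LD_fa_zero hg (eTS n) rfl, LD_fa hg', LD_const]
  simp [eA]

lemma norm_le_of_rot {z : ℂ} {M : ℝ} (h : ∀ k : ℂ, ‖k‖ ≤ 1 → (k * z).re ≤ M) : ‖z‖ ≤ M := by
  rcases eq_or_ne z 0 with rfl | hz
  · simpa using h 0 (by simp)
  · have hz' : ‖z‖ ≠ 0 := norm_ne_zero_iff.2 hz
    have := h ((starRingEnd ℂ) z / (‖z‖ : ℂ)) (by simp [hz'])
    have e : (starRingEnd ℂ) z / (‖z‖ : ℂ) * z = ((‖z‖ : ℝ) : ℂ) := by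
      rw [div_mul_eq_mul_div, mul_comm, Complex.mul_conj, Complex.normSq_eq_norm_sq]
      push_cast
      field_simp
    rw [e, Complex.ofReal_re] at this
    exact this

/-- The maximum principle in the form we use. -/
lemma mp_gen {n : ℕ} {U : Sg n → ℂ} {h : ℝ → ℝ} (hh : ContDiff ℝ (⊤ : ℕ∞) h) (hh0 : ∀ a, 0 ≤ a → 0 ≤ h a)
    {m : ℝ} (hU : ContinuousOn U (Om n))
    (hbd : ∀ w : Hn n, ∀ κ > 0, ∀ᶠ p in 𝓝[Om n] ((w, 0) : Sg n), (U p).re < m + κ)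
    (hgrow : ∀ δ > 0, ∃ K, ∀ p ∈ Om n, (U p).re - δ * h p.2 ≤ K)
    (hL : ∀ p ∈ Om n, ∃ (q l : ℂ) (A B : ℝ), LQ U p q l ∧ 0 ≤ A ∧ 0 ≤ B ∧ (A : ℂ) * q + (B : ℂ) * l = 0 ∧
      A * (-(n * deriv h p.2)) + B * deriv (deriv h) p.2 < 0) :
    ∀ p ∈ Om n, (U p).re ≤ m := by
  intro p hp
  have main : ∀ ε > 0, (U p).re - ε * psi p - ε * h p.2 ≤ m := by
    intro ε hε
    refine max_principle (u := fun p => (U p).re - ε * psi p - ε * h p.2) ?_ ?_ ?_ ?_ p hp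
    · refine ContinuousOn.sub (ContinuousOn.sub (Complex.continuous_re.comp_continuousOn hU) ?_) ?_
      · exact continuousOn_const.mul psi_contOn
      · exact (continuous_const.mul (hh.continuous.comp continuous_snd)).continuousOn
    · intro w κ hκ
      filter_upwards [hbd w κ hκ, self_mem_nhdsWithin] with x hx hxo
      have hx0 : 0 < x.2 := hxo
      have := mul_nonneg hε.le (psi_nonneg hx0.le)
      have := mul_nonneg hε.le (hh0 x.2 hx0.le)
      linarith
    · obtain ⟨K, hK⟩ := hgrow ε hε
      refine ⟨Real.exp ((K - m) / ε), fun x hx hxm => ?_⟩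
      have hx0 : 0 < x.2 := hx
      refine (norm_le_exp_psi hx0.le).trans (Real.exp_le_exp.2 ?_)
      rw [le_div_iff₀ hε]
      have := hK x hx
      linarith
    · intro x hx _ hmax
      obtain ⟨q, l, A, B, hLQ, hA, hB, hAB, hneg⟩ := hL x hx
      have h1 := LQ_add hLQ (LQ_cmul (-(ε : ℂ)) (LQ_add (LQ_psi hx) (LQ_fa hh hx)))
      have h2 : IsLocalMax (fun x => ((U x) + -(ε : ℂ) * ((psi x : ℂ) + ((h x.2 : ℝ) : ℂ))).re) x := by
        convert hmax using 2 with y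
        rw [Complex.add_re, neg_mul, Complex.neg_re, Complex.re_ofReal_mul, ← Complex.ofReal_add,
          Complex.ofReal_re]
        ring
      obtain ⟨k1, k2⟩ := LQ_localMax h1 h2
      have e := congrArg Complex.re hAB
      rw [Complex.add_re, Complex.re_ofReal_mul, Complex.re_ofReal_mul, Complex.zero_re] at e
      rw [Complex.add_re, neg_mul, Complex.neg_re, Complex.re_ofReal_mul, zero_add, Complex.ofReal_re] at k1 k2
      nlinarith [mul_le_mul_of_nonneg_left k1 hA, mul_le_mul_of_nonneg_left k2 hB,
        mul_pos hε (neg_pos.2 hneg)]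
  have hp0 : 0 < p.2 := hp
  have c0 : 0 ≤ psi p + h p.2 := add_nonneg (psi_nonneg hp0.le) (hh0 _ hp0.le)
  have hlim : Tendsto (fun ε : ℝ => (U p).re - ε * psi p - ε * h p.2) (𝓝[>] 0) (𝓝 (U p).re) := by
    have : Continuous (fun ε : ℝ => (U p).re - ε * psi p - ε * h p.2) := by fun_prop
    have h2 := this.tendsto 0
    simp only [zero_mul, sub_zero] at h2
    exact h2.mono_left nhdsWithin_le_nhds
  refine le_of_tendsto hlim ?_
  filter_upwards [self_mem_nhdsWithin] with ε hε using main ε hε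

/-! ### Line data of mollifications -/

lemma LQ_mol {n : ℕ} {φ : Hn n → ℂ} (hφ : Cc φ) {F : Sg n → ℂ} (hF : Sm F) {α : ℝ}
    (hL : ∀ p ∈ Om n, Lalpha n α F p = 0) {p : Sg n} (hp : p ∈ Om n) :
    ∃ q l, LQ (mol φ F) p q l ∧ ((α * p.2 : ℝ) : ℂ) * q + ((p.2 ^ 2 : ℝ) : ℂ) * l = 0 := by
  refine ⟨_, _, ⟨_, _, _, _, _, _, _, _, fun j => mol_HL2 hφ hF _ hp, fun j => mol_HL2 hφ hF _ hp,
    mol_HL2 hφ hF _ hp, mol_HL2 hφ hF _ hp, rfl, rfl⟩, ?_⟩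
  have hX := fun j => (hF.LD (eXS n j)).LD (eXS n j)
  have hY := fun j => (hF.LD (eYS n j)).LD (eYS n j)
  have hA := (hF.LD (eA n)).LD (eA n)
  have hT := (hF.LD (eTS n)).LD (eTS n)
  have e1 : ∑ j, (mol φ (LD (eXS n j) (LD (eXS n j) F)) p + mol φ (LD (eYS n j) (LD (eYS n j) F)) p)
      = mol φ (fun q => ∑ j, (LD (eXS n j) (LD (eXS n j) F) q + LD (eYS n j) (LD (eYS n j) F) q)) p := by
    rw [mol_sum _ hφ (fun j => (hX j).add (hY j)) hp]
    exact Finset.sum_congr rfl fun j _ => (mol_add hφ (hX j) (hY j) hp).symm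
  have hS : Sm (fun q => ∑ j, (LD (eXS n j) (LD (eXS n j) F) q + LD (eYS n j) (LD (eYS n j) F) q)) :=
    Sm.sum (fun j _ => (hX j).add (hY j))
  rw [e1, ← mol_add hφ hA hT hp]
  have e2 : (1/4 : ℂ) * mol φ (fun q => ∑ j, (LD (eXS n j) (LD (eXS n j) F) q + LD (eYS n j) (LD (eYS n j) F) q)) p
      - n * mol φ (LD (eA n) F) p = mol φ (Qo F) p := by
    have h1 := mol_add hφ (hS.cmul (1/4)) ((hF.LD (eA n)).cmul (-(n:ℂ))) hp
    rw [mol_cmul, mol_cmul] at h1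
    have h2 : mol φ (Qo F) p = _ := (mol_congr φ (fun q _ => by unfold Qo; ring) hp).trans h1
    rw [h2]; ring
  rw [e2, ← mol_cmul, ← mol_cmul, ← mol_add hφ (hF.Qo.cmul _) ((hA.add hT).cmul _) hp]
  unfold mol
  rw [integral_eq_zero_of_ae]
  refine Eventually.of_forall fun g => ?_
  have := hL (gi g p) (gi_mem hp)
  rw [Lalpha_eq, gi_snd] at this
  simp only [Pi.zero_apply]
  push_cast
  rw [this, mul_zero]

/-! ### Line data of the regularisation -/

lemma HL2_entire {g : ℂ → ℂ} (hg : Differentiable ℂ g) (z κ : ℂ) :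
    HL2 (fun r : ℝ => g (z + r * κ)) (κ * deriv g z) (κ ^ 2 * deriv (deriv g) z) := by
  have hg' : Differentiable ℂ (deriv g) := by
    have := (hg.differentiableOn (s := univ)).deriv isOpen_univ
    exact differentiableOn_univ.1 this
  have hl : ∀ r : ℝ, HasDerivAt (fun r : ℝ => z + r * κ) κ r := by
    intro r
    simpa using ((Complex.ofRealCLM.hasDerivAt (x := r)).mul_const κ).const_add z
  refine ⟨fun r => κ * deriv g (z + r * κ), Eventually.of_forall fun r => ?_, by simp, ?_⟩
  · have := (hg (z + r * κ)).hasDerivAt.comp r (hl r)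
    exact this.congr_deriv (mul_comm _ _)
  · have := ((hg' (z + (0:ℝ) * κ)).hasDerivAt.comp (0:ℝ) (hl 0)).const_mul κ
    simp only [Complex.ofReal_zero, zero_mul, add_zero] at this
    exact this.congr_deriv (by ring)

lemma Gb_sum {n : ℕ} {β : ℝ} (hβ : 0 < β) {ι : Type} (S : Finset ι) {v : ι → Hn n → ℂ}
    (hv : ∀ i, NB (v i)) (p : Sg n) : Gb β (fun w => ∑ i ∈ S, v i w) p = ∑ i ∈ S, Gb β (v i) p := by
  unfold Gb
  rw [← integral_finsetSum _ fun i _ => Gb_int hβ (hv i) p]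
  congr 1; funext g; rw [Finset.mul_sum]

lemma Gb_add {n : ℕ} {β : ℝ} (hβ : 0 < β) {v v' : Hn n → ℂ}
    (hv : NB v) (hv' : NB v') (p : Sg n) : Gb β (fun w => v w + v' w) p = Gb β v p + Gb β v' p := by
  unfold Gb
  rw [← integral_add (Gb_int hβ hv p) (Gb_int hβ hv' p)]
  congr 1; funext g; ring

lemma Gb_cmul {n : ℕ} {β : ℝ} (k : ℂ) (v : Hn n → ℂ) (p : Sg n) :
    Gb β (fun w => k * v w) p = k * Gb β v p := by
  unfold Gb
  rw [← integral_const_mul]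
  congr 1; funext g; ring

/-- boundary restriction of a mollification -/
def vF {n : ℕ} (φ : Hn n → ℂ) (E : Sg n → ℂ) (w : Hn n) : ℂ := mol φ E (w, 1)

lemma one_Om {n : ℕ} (w : Hn n) : ((w, 1) : Sg n) ∈ Om n := (one_pos : (0:ℝ) < 1)

lemma NB_vF {n : ℕ} {φ : Hn n → ℂ} (hφ : Cc φ) {E : Sg n → ℂ} (hE : Sm E) (hB : LBt (mol φ E)) :
    NB (vF φ E) := by
  refine ⟨?_, fun R => ?_⟩
  · exact (mol_continuousOn hφ hE.continuousOn).comp_continuous (by fun_prop) one_Om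
  · obtain ⟨M, hM⟩ := hB R
    exact ⟨M, fun w hw => hM (w, 1) (one_Om w) hw⟩

lemma vF_hasDerivAt {n : ℕ} {φ : Hn n → ℂ} (hφ : Cc φ) {E : Sg n → ℂ} (hE : Sm E) (c w : Hn n) (s : ℝ) :
    HasDerivAt (fun r : ℝ => vF φ E (w + r • ((c.1, c.2 + bt w.1 c.1) : Hn n)))
      (vF φ (LD (c, 0) E) (w + s • ((c.1, c.2 + bt w.1 c.1) : Hn n))) s := by
  have e : ∀ r : ℝ, ((w, 1) : Sg n) + r • VF (c, 0) (w, 1)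
      = (w + r • ((c.1, c.2 + bt w.1 c.1) : Hn n), 1) := by
    intro r
    refine Prod.ext ?_ ?_
    · simp [VF]
    · simp [VF]
  have := mol_hasDerivAt hφ hE (c := (c, 0)) (p := (w, 1)) (s := s) (by rw [e]; exact one_Om _)
  simp only [e] at this
  exact this

lemma LQ_Gb {n : ℕ} {f : Hn n → ℂ} (hf : ContDiff ℝ (⊤ : ℕ∞) f) {C : ℝ} (hC : ∀ w, ‖f w‖ ≤ C)
    (hL : ∀ w, LH n (-(n:ℝ)) f w = 0) {φ : Hn n → ℂ} (hφ : Cs φ) {β : ℝ} (hβ : 0 < β) {p : Sg n}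
    (hp : p ∈ Om n) : LQ (Gb β (vF φ (fS f))) p 0 0 := by
  have hS := fS_Sm hf
  have hB0 : ∀ φ : Hn n → ℂ, Cs φ → LBt (mol φ (fS f)) := fun φ hφ =>
    LBt_of_bdd (C := C) (fun p _ => hC p.1) hφ
  have hB1 : ∀ c : Hn n, ∀ φ : Hn n → ℂ, Cs φ → LBt (mol φ (LD (c, 0) (fS f))) := fun c φ hφ =>
    LBt_LD hS hB0 c hφ
  have hB2 : ∀ c : Hn n, ∀ φ : Hn n → ℂ, Cs φ → LBt (mol φ (LD (c, 0) (LD (c, 0) (fS f)))) :=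
    fun c φ hφ => LBt_LD (hS.LD _) (hB1 c) c hφ
  have N0 := NB_vF hφ.cc hS (hB0 φ hφ)
  have N1 : ∀ c : Hn n, NB (vF φ (LD (c, 0) (fS f))) := fun c => NB_vF hφ.cc (hS.LD _) (hB1 c φ hφ)
  have N2 : ∀ c : Hn n, NB (vF φ (LD (c, 0) (LD (c, 0) (fS f)))) := fun c =>
    NB_vF hφ.cc ((hS.LD _).LD _) (hB2 c φ hφ)
  have D1 : ∀ (c : Hn n) (s : ℝ), HasDerivAt (fun r : ℝ => Gb β (vF φ (fS f)) (p + r • VF (c, 0) p))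
      (Gb β (vF φ (LD (c, 0) (fS f))) (p + s • VF (c, 0) p)) s := fun c s =>
    Gb_hasDerivAt hβ N0 (N1 c) c (vF_hasDerivAt hφ.cc hS c) p s
  have D2 : ∀ (c : Hn n) (s : ℝ), HasDerivAt (fun r : ℝ => Gb β (vF φ (LD (c, 0) (fS f))) (p + r • VF (c, 0) p))
      (Gb β (vF φ (LD (c, 0) (LD (c, 0) (fS f)))) (p + s • VF (c, 0) p)) s := fun c s =>
    Gb_hasDerivAt hβ (N1 c) (N2 c) c (vF_hasDerivAt hφ.cc (hS.LD _) c) p s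
  have H : ∀ c : Hn n, HL2 (fun r => Gb β (vF φ (fS f)) (p + r • VF (c, 0) p))
      (Gb β (vF φ (LD (c, 0) (fS f))) p) (Gb β (vF φ (LD (c, 0) (LD (c, 0) (fS f)))) p) := by
    intro c
    refine ⟨fun r => Gb β (vF φ (LD (c, 0) (fS f))) (p + r • VF (c, 0) p),
      Eventually.of_forall fun r => D1 c r, by simp, ?_⟩
    have := D2 c 0
    simpa using this
  -- the slice function
  obtain ⟨M, hM⟩ := N0.bdd ‖p.1.1‖
  set g : ℂ → ℂ := gg β (fun s => vF φ (fS f) (p.1.1, s)) with hgdef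
  have hg : Differentiable ℂ g := gg_diff hβ (N0.cont.comp (by fun_prop)) (M := M)
    (fun s => hM _ le_rfl)
  have eT' : ∀ r : ℝ, Gb β (vF φ (fS f)) (p + r • VF (eTS n) p)
      = g ((p.1.2 - Complex.I * p.2) + r * 1) := by
    intro r
    rw [Gb_eq_gg, hgdef]
    simp [VF, eTS, eT, bt_zero_right]
    congr 1; ring
  have eA' : ∀ r : ℝ, Gb β (vF φ (fS f)) (p + r • VF (eA n) p)
      = g ((p.1.2 - Complex.I * p.2) + r * (-Complex.I)) := by
    intro r
    rw [Gb_eq_gg, hgdef]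
    simp [VF, eA, bt_zero_right]
    congr 1; ring
  have HT := HL2_entire hg (p.1.2 - Complex.I * p.2) 1
  have HA := HL2_entire hg (p.1.2 - Complex.I * p.2) (-Complex.I)
  simp only [← eT'] at HT
  simp only [← eA'] at HA
  refine ⟨_, _, _, _, _, _, _, _, fun j => H (eX n j), fun j => H (eY n j), HT, HA, ?_, ?_⟩
  · have u : Gb β (vF φ (LD (eTS n) (fS f))) p = 1 * deriv g (p.1.2 - Complex.I * p.2) :=
      ((H (eT n)).unique HT).1
    have s1 : ∀ w, ∑ j, (vF φ (LD (eX n j, 0) (LD (eX n j, 0) (fS f))) w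
        + vF φ (LD (eY n j, 0) (LD (eY n j, 0) (fS f))) w)
        = (-4 * Complex.I * n) * vF φ (LD (eTS n) (fS f)) w := by
      intro w
      have hX := fun j => (hS.LD (eXS n j)).LD (eXS n j)
      have hY := fun j => (hS.LD (eYS n j)).LD (eYS n j)
      have e1 : ∑ j, (vF φ (LD (eX n j, 0) (LD (eX n j, 0) (fS f))) w
        + vF φ (LD (eY n j, 0) (LD (eY n j, 0) (fS f))) w)
          = mol φ (fun q => ∑ j, (LD (eXS n j) (LD (eXS n j) (fS f)) q + LD (eYS n j) (LD (eYS n j) (fS f)) q)) (w, 1) := by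
        rw [mol_sum _ hφ.cc (fun j => (hX j).add (hY j)) (one_Om w)]
        exact Finset.sum_congr rfl fun j _ => (mol_add hφ.cc (hX j) (hY j) (one_Om w)).symm
      rw [e1]
      unfold vF
      rw [← mol_cmul]
      refine mol_congr φ (fun q hq => ?_) (one_Om w)
      have h1 := LH_fS hf hq
      rw [hL q.1] at h1
      unfold Qo at h1
      rw [LD_A_fS hf hq] at h1
      linear_combination (4) * h1
    have s2 : ∑ j, (Gb β (vF φ (LD (eX n j, 0) (LD (eX n j, 0) (fS f)))) p
        + Gb β (vF φ (LD (eY n j, 0) (LD (eY n j, 0) (fS f)))) p)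
        = (-4 * Complex.I * n) * Gb β (vF φ (LD (eTS n) (fS f))) p := by
      rw [← Gb_cmul]
      simp only [← s1]
      rw [Gb_sum hβ]
      · exact Finset.sum_congr rfl fun j _ => (Gb_add hβ (N2 _) (N2 _) p).symm
      · intro j
        refine ⟨(N2 _).cont.add (N2 _).cont, fun R => ?_⟩
        obtain ⟨M1, h1⟩ := (N2 (eX n j)).bdd R
        obtain ⟨M2, h2⟩ := (N2 (eY n j)).bdd R
        exact ⟨M1 + M2, fun w hw => (norm_add_le _ _).trans (add_le_add (h1 w hw) (h2 w hw))⟩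
    rw [s2, u]; ring
  · ring_nf; simp


/-! ### The backward direction -/

lemma vF_lip {n : ℕ} {φ : Hn n → ℂ} (hφ : Cc φ) {E : Sg n → ℂ} (hE : Sm E) {L : ℝ}
    (hL : ∀ p ∈ Om n, ‖mol φ (LD (eTS n) E) p‖ ≤ L) (ζ : Fin n → ℂ) (t s : ℝ) :
    ‖vF φ E (ζ, t - s) - vF φ E (ζ, t)‖ ≤ L * |s| := by
  have h := fun r : ℝ => vF_hasDerivAt hφ hE (eT n) (ζ, t) r
  have e : ∀ r : ℝ, ((ζ, t) : Hn n) + r • (((eT n).1, (eT n).2 + bt ζ (eT n).1) : Hn n) = (ζ, t + r) := by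
    intro r
    refine Prod.ext ?_ ?_
    · simp [eT]
    · simp [eT, bt_zero_right]
  have h' : ∀ r : ℝ, HasDerivAt (fun r : ℝ => vF φ E (ζ, t + r)) (vF φ (LD (eTS n) E) (ζ, t + r)) r := by
    intro r
    have := h r
    simp only [e] at this
    exact this
  have := Convex.norm_image_sub_le_of_norm_hasDerivWithin_le (s := univ) (C := L)
    (fun x _ => (h' x).hasDerivWithinAt) (fun x _ => hL _ (one_Om _)) convex_univ
    (mem_univ (0:ℝ)) (mem_univ (-s))
  simpa [sub_eq_add_neg] using this

lemma re_cmul_le {k z : ℂ} (hk : ‖k‖ ≤ 1) : (k * z).re ≤ ‖z‖ := by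
  refine (Complex.re_le_norm _).trans ?_
  rw [norm_mul]
  exact mul_le_of_le_one_left (norm_nonneg _) hk

lemma expsq_deriv (β a : ℝ) : HasDerivAt (fun a : ℝ => Real.exp (2 * β ^ 2 * a ^ 2))
    (Real.exp (2 * β ^ 2 * a ^ 2) * (4 * β ^ 2 * a)) a := by
  have := ((hasDerivAt_pow 2 a).const_mul (2 * β ^ 2)).exp
  refine this.congr_deriv ?_
  push_cast
  ring

lemma Gb_le {n : ℕ} (hn : 1 ≤ n) {β : ℝ} (hβ : 0 < β) {v : Hn n → ℂ} (hv : NB v) {M : ℝ}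
    (hM : ∀ w, ‖v w‖ ≤ M) (hL : ∀ p ∈ Om n, LQ (Gb β v) p 0 0) :
    ∀ p ∈ Om n, ‖Gb β v p‖ ≤ M := by
  intro p hp
  refine norm_le_of_rot fun k hk => ?_
  have hM0 : 0 ≤ M := (norm_nonneg _).trans (hM 0)
  refine mp_gen (U := fun p => k * Gb β v p) (h := fun a => Real.exp (2 * β ^ 2 * a ^ 2)) ?_ ?_ ?_ ?_ ?_ ?_ p hp
  · exact Real.contDiff_exp.comp (contDiff_const.mul (contDiff_id.pow 2))
  · intro a _; positivity
  · exact (continuous_const.mul (Gb_cont hβ hv)).continuousOn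
  · intro w κ hκ
    have h1 : Continuous (fun p => (k * Gb β v p).re) :=
      Complex.continuous_re.comp (continuous_const.mul (Gb_cont hβ hv))
    have h2 : (k * Gb β v (w, 0)).re < M + κ := by
      have := Gb_norm hβ hM ((w, 0) : Sg n)
      simp at this
      linarith [re_cmul_le (z := Gb β v (w, 0)) hk]
    exact (h1.continuousAt.eventually_lt_const h2).filter_mono nhdsWithin_le_nhds
  · intro δ hδ
    refine ⟨M ^ 2 / (4 * δ), fun q _ => ?_⟩
    have h1 := (re_cmul_le (z := Gb β v q) hk).trans (Gb_norm hβ hM q)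
    have h2 : Real.exp (2 * β ^ 2 * q.2 ^ 2) = Real.exp (β ^ 2 * q.2 ^ 2) ^ 2 := by
      rw [← Real.exp_nat_mul]; congr 1; push_cast; ring
    simp only [h2]
    set x := Real.exp (β ^ 2 * q.2 ^ 2)
    rw [le_div_iff₀ (by positivity)]
    nlinarith [sq_nonneg (M - 2 * δ * x), mul_le_mul_of_nonneg_left h1 hδ.le]
  · intro q hq
    refine ⟨_, _, 1, 0, LQ_cmul k (hL q hq), zero_le_one, le_rfl, by simp, ?_⟩
    rw [(expsq_deriv β q.2).deriv]
    have hq0 : 0 < q.2 := hq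
    have hn0 : (0:ℝ) < n := by exact_mod_cast hn
    have : 0 < n * (Real.exp (2 * β ^ 2 * q.2 ^ 2) * (4 * β ^ 2 * q.2)) := by positivity
    linarith

lemma mol_sub_Gb {n : ℕ} (hn : 1 ≤ n) {α : ℝ} (hα : 0 < α) {F : Sg n → ℂ} (hF : Sm F) {C : ℝ}
    (hC : ∀ p ∈ Om n, ‖F p‖ ≤ C) (hharm : ∀ p ∈ Om n, Lalpha n α F p = 0)
    {f : Hn n → ℂ} (hbv : IsBoundaryValue n F f) {φ : Hn n → ℂ} (hφ : Cc φ) {β : ℝ} (hβ : 0 < β)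
    (hv : NB (vF φ (fS f))) {M : ℝ} (hM : ∀ w, ‖vF φ (fS f) w‖ ≤ M)
    (hL : ∀ p ∈ Om n, LQ (Gb β (vF φ (fS f))) p 0 0) {m : ℝ}
    (hm : ∀ w, ‖Gb β (vF φ (fS f)) (w, 0) - vF φ (fS f) w‖ ≤ m) :
    ∀ p ∈ Om n, ‖mol φ F p - Gb β (vF φ (fS f)) p‖ ≤ m := by
  intro p hp
  refine norm_le_of_rot fun k hk => ?_
  have e : ∀ q, k * (mol φ F q - Gb β (vF φ (fS f)) q)
      = k * (mol φ F q + (-1) * Gb β (vF φ (fS f)) q) := fun q => by ring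
  have hG := Gb_le hn hβ hv hM hL
  rw [e]
  refine mp_gen (U := fun q => k * (mol φ F q + (-1) * Gb β (vF φ (fS f)) q)) (h := fun a => a)
    contDiff_id (fun a ha => ha) ?_ ?_ ?_ ?_ p hp
  · exact continuousOn_const.mul ((mol_continuousOn hφ hF.continuousOn).add
      (continuous_const.mul (Gb_cont hβ hv)).continuousOn)
  · intro w κ hκ
    have h1 := mol_bdry hφ hF.continuousOn hC hbv w
    have h2 : Tendsto (Gb β (vF φ (fS f))) (𝓝[Om n] (w, 0)) (𝓝 (Gb β (vF φ (fS f)) (w, 0))) :=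
      (Gb_cont hβ hv).continuousAt.tendsto.mono_left nhdsWithin_le_nhds
    have h3 := (Complex.continuous_re.tendsto _).comp ((h1.add (h2.const_mul (-1))).const_mul k)
    refine h3.eventually_lt_const ?_
    have h4 := hm w
    rw [norm_sub_rev] at h4
    have h5 := re_cmul_le (z := vF φ (fS f) w - Gb β (vF φ (fS f)) (w, 0)) hk
    have e2 : k * (mol φ (fS f) (w, 1) + (-1) * Gb β (vF φ (fS f)) (w, 0))
        = k * (vF φ (fS f) w - Gb β (vF φ (fS f)) (w, 0)) := by unfold vF; ring
    rw [e2]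
    linarith
  · intro δ hδ
    refine ⟨C * (∫ g, ‖φ g‖) + M, fun q hq => ?_⟩
    have hq0 : 0 < q.2 := hq
    have h1 := mol_norm hφ hC hq
    have h2 := hG q hq
    rw [← e]
    have h3 := re_cmul_le (z := mol φ F q - Gb β (vF φ (fS f)) q) hk
    have h4 := norm_sub_le (mol φ F q) (Gb β (vF φ (fS f)) q)
    have := mul_pos hδ hq0
    linarith
  · intro q hq
    have hq0 : 0 < q.2 := hq
    obtain ⟨q1, l1, hLQ, heq⟩ := LQ_mol hφ hF hharm hq
    refine ⟨_, _, α * q.2, q.2 ^ 2, LQ_cmul k (LQ_add hLQ (LQ_cmul (-1) (hL q hq))),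
      by positivity, by positivity, ?_, ?_⟩
    · linear_combination k * heq
    · have hn0 : (0:ℝ) < n := by exact_mod_cast hn
      have h1 : deriv (fun a : ℝ => a) = fun _ => 1 := by funext x; exact deriv_id x
      rw [h1]
      simp
      positivity

lemma slice_CR {n : ℕ} {φ : Hn n → ℂ} (hφ : Cc φ) {F : Sg n → ℂ} (hF : Sm F) {v : Hn n → ℂ}
    (hv : NB v) {L : ℝ} (happ : ∀ β > 0, ∀ p ∈ Om n, ‖mol φ F p - Gb β v p‖ ≤ L / β) {p : Sg n}
    (hp : p ∈ Om n) : mol φ (LD (eA n) F) p = -Complex.I * mol φ (LD (eTS n) F) p := by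
  set H : ℂ → ℂ := fun z => mol φ F ((p.1.1, z.re), -z.im) with hH
  set V : Set ℂ := {z | z.im < 0} with hV
  have hVo : IsOpen V := isOpen_lt Complex.continuous_im continuous_const
  have hp0 : 0 < p.2 := hp
  set z0 : ℂ := p.1.2 - Complex.I * p.2 with hz0
  have hz0V : z0 ∈ V := by simp [hV, hz0, hp0]
  obtain ⟨M, hM⟩ := hv.bdd ‖p.1.1‖
  have hu : TendstoUniformlyOn (fun (m : ℕ) z => gg ((m:ℝ) + 1) (fun s => v (p.1.1, s)) z) H atTop V := by
    rw [Metric.tendstoUniformlyOn_iff]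
    intro ε hε
    have hlim : Tendsto (fun m : ℕ => L / ((m:ℝ) + 1)) atTop (𝓝 0) :=
      tendsto_const_nhds.div_atTop (tendsto_atTop_add_const_right _ _ tendsto_natCast_atTop_atTop)
    filter_upwards [hlim.eventually_lt_const hε] with m hm z hz
    have hz' : z.im < 0 := hz
    have h1 := happ ((m:ℝ) + 1) (by positivity) ((p.1.1, z.re), -z.im) (by simpa [Om] using hz')
    rw [Gb_eq_gg] at h1
    have e : (((z.re : ℝ) : ℂ) - Complex.I * ((-z.im : ℝ) : ℂ)) = z := by
      apply Complex.ext <;> simp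
    simp only [e] at h1
    rw [dist_eq_norm]
    exact h1.trans_lt hm
  have hgd : ∀ m : ℕ, Differentiable ℂ (gg ((m:ℝ) + 1) (fun s => v (p.1.1, s))) := fun m =>
    gg_diff (by positivity) (hv.cont.comp (by fun_prop : Continuous fun s : ℝ => ((p.1.1, s) : Hn n)))
      (M := M) (fun s => hM _ le_rfl)
  have hd : DifferentiableOn ℂ H V :=
    hu.tendstoLocallyUniformlyOn.differentiableOn (Eventually.of_forall fun m =>
      (hgd m).differentiableOn) hVo
  have hdz := (hd.differentiableAt (hVo.mem_nhds hz0V)).hasDerivAt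
  have hl : ∀ κ : ℂ, HasDerivAt (fun r : ℝ => z0 + r * κ) κ 0 := by
    intro κ
    simpa using ((Complex.ofRealCLM.hasDerivAt (x := (0:ℝ))).mul_const κ).const_add z0
  have hc : ∀ κ : ℂ, HasDerivAt (fun r : ℝ => H (z0 + r * κ)) (deriv H z0 * κ) 0 := by
    intro κ
    have h0 : z0 + ((0:ℝ):ℂ) * κ = z0 := by simp
    exact HasDerivAt.comp (0:ℝ) (by rw [h0]; exact hdz) (hl κ)
  have kT := mol_hasDerivAt hφ hF (c := eTS n) (p := p) (s := 0) (by simpa using hp)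
  have kA := mol_hasDerivAt hφ hF (c := eA n) (p := p) (s := 0) (by simpa using hp)
  have eT' : ∀ r : ℝ, mol φ F (p + r • VF (eTS n) p) = H (z0 + r * 1) := by
    intro r
    rw [hH, hz0]
    refine congrArg (mol φ F) (Prod.ext (Prod.ext ?_ ?_) ?_) <;> simp [VF, eTS, eT, bt_zero_right]
  have eA' : ∀ r : ℝ, mol φ F (p + r • VF (eA n) p) = H (z0 + r * (-Complex.I)) := by
    intro r
    rw [hH, hz0]
    refine congrArg (mol φ F) (Prod.ext (Prod.ext ?_ ?_) ?_) <;> simp [VF, eA, bt_zero_right]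
    try ring
  simp only [eT', zero_smul, add_zero] at kT
  simp only [eA', zero_smul, add_zero] at kA
  have u1 := kT.unique (hc 1)
  have u2 := kA.unique (hc (-Complex.I))
  rw [u1, u2]; ring

lemma backward {n : ℕ} (hn : 1 ≤ n) {α : ℝ} (hα : 0 < α) {F : Sg n → ℂ} (hF : Sm F) {C : ℝ}
    (hC : ∀ p ∈ Om n, ‖F p‖ ≤ C) (hharm : ∀ p ∈ Om n, Lalpha n α F p = 0)
    {f : Hn n → ℂ} (hf : ContDiff ℝ (⊤ : ℕ∞) f) {C' : ℝ} (hC' : ∀ w, ‖f w‖ ≤ C')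
    (hbv : IsBoundaryValue n F f) (hL : ∀ w, LH n (-(n:ℝ)) f w = 0) : IsAntiHolo n F := by
  have hS := fS_Sm hf
  have hCS : ∀ p ∈ Om n, ‖fS f p‖ ≤ C' := fun p _ => hC' p.1
  have hmol : ∀ φ : Hn n → ℂ, Cs φ → ∀ p ∈ Om n,
      mol φ (LD (eA n) F) p = -Complex.I * mol φ (LD (eTS n) F) p := by
    intro φ hφ p hp
    have hv : NB (vF φ (fS f)) := NB_vF hφ.cc hS (LBt_of_bdd hCS hφ)
    have hM : ∀ w, ‖vF φ (fS f) w‖ ≤ C' * ∫ g, ‖φ g‖ := fun w => mol_norm hφ.cc hCS (one_Om w)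
    obtain ⟨L, hLT⟩ := mol_T_bdd hS hCS hφ
    obtain ⟨K, hK0, hK⟩ := gauss_int_abs
    refine slice_CR hφ.cc hF hv (L := L * K) (fun β hβ q hq => ?_) hp
    obtain ⟨k1, k2⟩ := hK β hβ
    refine mol_sub_Gb hn hα hF hC hharm hbv hφ.cc hβ hv hM
      (fun q hq => LQ_Gb hf hC' hL hφ hβ hq) (fun w => ?_) q hq
    have := Gb_approx hβ hv (vF_lip hφ.cc hS hLT) k1 k2 w
    rwa [mul_div_assoc]
  have hD : ∀ p ∈ Om n, LD (eA n) F p = -Complex.I * LD (eTS n) F p := by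
    intro p hp
    have := mol_zero (F := fun q => LD (eA n) F q + Complex.I * LD (eTS n) F q)
      ((hF.LD _).add ((hF.LD _).cmul _)) (fun φ hφ q hq => ?_) hp
    · linear_combination this
    · rw [mol_add hφ.cc (hF.LD _) ((hF.LD _).cmul _) hq, mol_cmul, hmol φ hφ q hq]
      ring
  refine antiHolo_of_DQ hn hF hC hD fun p hp => ?_
  have hp0 : 0 < p.2 := hp
  have h1 : LD (eA n) (LD (eA n) F) p = - LD (eTS n) (LD (eTS n) F) p := by
    rw [LD_congr hD hp, LD_cmul _ (hF.LD _) hp, LD_comm_A hF hp, LD_congr hD hp, LD_cmul _ (hF.LD _) hp]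
    linear_combination (LD (eTS n) (LD (eTS n) F) p) * Complex.I_sq
  have h2 := hharm p hp
  rw [Lalpha_eq, h1, neg_add_cancel, mul_zero, add_zero] at h2
  have h3 : (α : ℂ) * p.2 ≠ 0 := by
    exact mul_ne_zero (by exact_mod_cast hα.ne') (by exact_mod_cast hp0.ne')
  exact (mul_eq_zero.1 h2).resolve_left h3

/-- A bounded smooth `L_α`-harmonic function `F` on `S` with smooth bounded
boundary value `f` is anti-holomorphic if and only if `ℒ_{-n} f = 0`. -/
theorem stmt2 (n : ℕ) (hn : 1 ≤ n) (α : ℝ) (hα : 0 < α)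
    (F : Sg n → ℂ) (hFbdd : ∃ C, ∀ p : Sg n, 0 < p.2 → ‖F p‖ ≤ C)
    (hFsmooth : ContDiffOn ℝ (⊤ : ℕ∞) F {p : Sg n | 0 < p.2})
    (hFharm : ∀ p : Sg n, 0 < p.2 → Lalpha n α F p = 0)
    (f : Hn n → ℂ) (hfsmooth : ContDiff ℝ (⊤ : ℕ∞) f) (hfbdd : BddFun f)
    (hbv : IsBoundaryValue n F f) :
    IsAntiHolo n F ↔ ∀ w : Hn n, LH n (-(n : ℝ)) f w = 0 := by
  obtain ⟨C, hC⟩ := hFbdd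
  obtain ⟨C', hC'⟩ := hfbdd
  constructor
  · intro hA w
    exact forward hFsmooth hfsmooth hbv hA w
  · intro hL
    exact backward hn hα hFsmooth hC hFharm hfsmooth hC' hbv hL
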